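/- Let n and m be positive integers. If every connected link projection with exactly n, n+1, or n+2 crossings has m or more pairwise independent regions, then IR(P) ≥ m − 1 holds for every reduced knot projection P with n or more crossings, where IR(P) is the maximal independent region number of P. -/

import Mathlib

/-!
Formalization framework for knot/link projections on the 2-sphere,
their regions, independent region sets, warping degree, and the
maximal independent region number, following Ohya–Shimizu,
"Lower bounds for the warping degree of a knot projection".
-/

noncomputable section
open Set

local instance : Fact ((0:ℝ) < 1) := ⟨zero_lt_one⟩

/-- The 2-sphere, realized as the unit sphere in ℝ³. -/
abbrev Sphere2 : Type := Metric.sphere (0 : EuclideanSpace ℝ (Fin 3)) 1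

/-- The parameter circle ℝ/ℤ. -/
abbrev Param : Type := AddCircle (1 : ℝ)

/-- The time (in `[0,1)`) needed to reach the point `t` when travelling from the
point `b` along the circle in the positive direction. -/
def timeFrom (b t : Param) : ℝ := ((AddCircle.equivIco 1 0) (t - b) : ℝ)

/-- A knot projection: a closed curve on the 2-sphere whose only
multiple points are finitely many transverse double points (crossings),
with at least one crossing.  (Each fibre of the parametrization is finite, of
cardinality at most two; the double points form a finite nonempty set.) -/
structure KnotProjection where
  /-- the parametrizing closed curve -/
  f : C(Param, Sphere2)
  fibers_finite : ∀ p : Sphere2, (f ⁻¹' {p} : Set Param).Finite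
  fibers_le_two : ∀ p : Sphere2, Nat.card (f ⁻¹' {p} : Set Param) ≤ 2
  crossings_finite : {p : Sphere2 | Nat.card (f ⁻¹' {p} : Set Param) = 2}.Finite
  exists_crossing : ∃ p : Sphere2, Nat.card (f ⁻¹' {p} : Set Param) = 2

namespace KnotProjection

/-- The image of the projection on the sphere. -/
def image (P : KnotProjection) : Set Sphere2 := Set.range P.f

/-- The crossings: the double points of the projection. -/
def crossings (P : KnotProjection) : Set Sphere2 :=
  {p : Sphere2 | Nat.card (P.f ⁻¹' {p} : Set Param) = 2}

/-- The crossing number `c(P)`. -/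
def crossingNumber (P : KnotProjection) : ℕ := Nat.card P.crossings

/-- A region: a connected component of the complement of the projection. -/
def IsRegion (P : KnotProjection) (R : Set Sphere2) : Prop :=
  ∃ x : Sphere2, x ∉ P.image ∧ R = connectedComponentIn P.imageᶜ x

/-- A region `R` is incident to a crossing `p` when `p` lies on the boundary of `R`. -/
def Incident (P : KnotProjection) (R : Set Sphere2) (p : Sphere2) : Prop :=
  P.IsRegion R ∧ p ∈ P.crossings ∧ p ∈ frontier R

/-- Two regions are independent when they share no crossing on their boundaries. -/
def IndepPair (P : KnotProjection) (R S : Set Sphere2) : Prop :=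
  ∀ p ∈ P.crossings, ¬(p ∈ frontier R ∧ p ∈ frontier S)

/-- A finite family of pairwise independent regions. -/
def IndepRegions (P : KnotProjection) (S : Finset (Set Sphere2)) : Prop :=
  (∀ R ∈ S, P.IsRegion R) ∧ (S : Set (Set Sphere2)).Pairwise P.IndepPair

/-- An independent region set for `P^c`: a finite family of pairwise independent
regions, none of which is incident to the base crossing `c`. -/
def IndepRegionsFor (P : KnotProjection) (c : Sphere2) (S : Finset (Set Sphere2)) : Prop :=
  P.IndepRegions S ∧ ∀ R ∈ S, c ∉ frontier R

/-- `IR(P^c)`: the maximal cardinality of an independent region set for `P^c`. -/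
def IRat (P : KnotProjection) (c : Sphere2) : ℕ :=
  sSup {m : ℕ | ∃ S : Finset (Set Sphere2), P.IndepRegionsFor c S ∧ m = S.card}

/-- `IR(P)`: the maximal independent region number of `P`. -/
def IR (P : KnotProjection) : ℕ :=
  sSup {m : ℕ | ∃ c ∈ P.crossings, m = P.IRat c}

/-- A crossing is reducible when two of the four local regions around it
coincide, i.e. when fewer than four regions are incident to it. -/
def Reducible (P : KnotProjection) (c : Sphere2) : Prop :=
  c ∈ P.crossings ∧ Nat.card {R : Set Sphere2 | P.IsRegion R ∧ c ∈ frontier R} < 4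

/-- A knot projection is reduced when it has no reducible crossing. -/
def Reduced (P : KnotProjection) : Prop := ∀ c : Sphere2, ¬ P.Reducible c

/-- Auxiliary: preimages under the reversal `t ↦ -t` have the same cardinality. -/
theorem card_neg_preimage (s : Set Param) :
    Nat.card ((Neg.neg : Param → Param) ⁻¹' s) = Nat.card s := by
  have h : (Neg.neg : Param → Param) ⁻¹' s = Neg.neg '' s := by
    ext t
    simp only [Set.mem_preimage, Set.mem_image]
    constructor
    · intro h; exact ⟨-t, h, neg_neg t⟩
    · rintro ⟨u, hu, rfl⟩; rwa [neg_neg]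
  rw [h, Nat.card_image_of_injective neg_injective]

/-- The same knot projection with the reversed orientation. -/
def reverse (P : KnotProjection) : KnotProjection where
  f := P.f.comp ⟨fun t => -t, continuous_neg⟩
  fibers_finite := by
    intro p
    have : (P.f.comp ⟨fun t => -t, continuous_neg⟩) ⁻¹' {p}
        = (Neg.neg : Param → Param) ⁻¹' (P.f ⁻¹' {p}) := rfl
    rw [this]
    exact (P.fibers_finite p).preimage (neg_injective.injOn)
  fibers_le_two := by
    intro p
    have : (P.f.comp ⟨fun t => -t, continuous_neg⟩) ⁻¹' {p}
        = (Neg.neg : Param → Param) ⁻¹' (P.f ⁻¹' {p}) := rfl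
    rw [this, card_neg_preimage]
    exact P.fibers_le_two p
  crossings_finite := by
    have : {p : Sphere2 |
        Nat.card ((P.f.comp ⟨fun t => -t, continuous_neg⟩) ⁻¹' {p} : Set Param) = 2}
        = {p : Sphere2 | Nat.card (P.f ⁻¹' {p} : Set Param) = 2} := by
      ext p
      have h : (P.f.comp ⟨fun t => -t, continuous_neg⟩) ⁻¹' {p}
          = (Neg.neg : Param → Param) ⁻¹' (P.f ⁻¹' {p}) := rfl
      simp only [Set.mem_setOf_eq, h, card_neg_preimage]
    rw [this]
    exact P.crossings_finite
  exists_crossing := by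
    obtain ⟨p, hp⟩ := P.exists_crossing
    refine ⟨p, ?_⟩
    have h : (P.f.comp ⟨fun t => -t, continuous_neg⟩) ⁻¹' {p}
        = (Neg.neg : Param → Param) ⁻¹' (P.f ⁻¹' {p}) := rfl
    rw [h, card_neg_preimage]
    exact hp

end KnotProjection

/-- A knot diagram: a knot projection together with over/under information; at
each crossing, `over` designates the parameter of the over-passage. -/
structure KnotDiagram extends KnotProjection where
  /-- the parameter at which the strand passes over the given crossing -/
  overParam : Sphere2 → Param
  over_mem : ∀ p ∈ toKnotProjection.crossings, toKnotProjection.f (overParam p) = p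

namespace KnotDiagram

/-- A passage through a crossing at parameter `t` is an over-passage when `t`
is the designated over-parameter of the crossing below. -/
def IsOverPass (D : KnotDiagram) (t : Param) : Prop :=
  t = D.overParam (D.toKnotProjection.f t)

/-- A diagram is alternating when, travelling along the diagram, consecutive
crossing passages are alternately over- and under-passages. -/
def Alternating (D : KnotDiagram) : Prop :=
  ∀ t₁ t₂ : Param,
    D.toKnotProjection.f t₁ ∈ D.toKnotProjection.crossings →
    D.toKnotProjection.f t₂ ∈ D.toKnotProjection.crossings →
    t₁ ≠ t₂ →
    (∀ s : Param, D.toKnotProjection.f s ∈ D.toKnotProjection.crossings →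
      s ≠ t₁ → s ≠ t₂ → timeFrom t₁ t₂ ≤ timeFrom t₁ s) →
    (D.IsOverPass t₁ ↔ ¬ D.IsOverPass t₂)

/-- A base point: a point of the diagram avoiding the crossings (given by its
parameter `b`). -/
def IsBasePoint (D : KnotDiagram) (b : Param) : Prop :=
  D.toKnotProjection.f b ∉ D.toKnotProjection.crossings

/-- A crossing `p` is a warping crossing point of `D_b` when, travelling from
`b`, one meets `p` first as an under-crossing, i.e. its under-passage occurs
strictly before its over-passage. -/
def IsWarping (D : KnotDiagram) (b : Param) (p : Sphere2) : Prop :=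
  p ∈ D.toKnotProjection.crossings ∧
  ∃ t : Param, D.toKnotProjection.f t = p ∧ t ≠ D.overParam p ∧
    timeFrom b t < timeFrom b (D.overParam p)

/-- The warping degree `d(D_b)` of the based diagram `D_b`. -/
def wdAt (D : KnotDiagram) (b : Param) : ℕ :=
  Nat.card {p : Sphere2 | D.IsWarping b p}

/-- The warping degree `d(D)` of the diagram: the minimum of `d(D_b)` over all
base points `b`. -/
def warpingDegree (D : KnotDiagram) : ℕ :=
  sInf {m : ℕ | ∃ b : Param, D.IsBasePoint b ∧ m = D.wdAt b}

end KnotDiagram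

/-- The warping degree `d(P)` of an (unoriented) knot projection: the minimal
warping degree of all oriented alternating diagrams obtained from `P` by
choosing an orientation and over/under information at every crossing. -/
def KnotProjection.warpingDegree (P : KnotProjection) : ℕ :=
  sInf {m : ℕ | ∃ D : KnotDiagram,
    (D.toKnotProjection = P ∨ D.toKnotProjection = P.reverse) ∧
    D.Alternating ∧ m = D.warpingDegree}

/-- A link projection: a closed curve with finitely many components on the
2-sphere whose only multiple points are finitely many double points. -/
structure LinkProjection where
  /-- the number of circle components -/
  comps : ℕ
  comps_pos : 0 < comps
  /-- the parametrizing curves -/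
  f : C(Fin comps × Param, Sphere2)
  fibers_finite : ∀ p : Sphere2, (f ⁻¹' {p} : Set (Fin comps × Param)).Finite
  fibers_le_two : ∀ p : Sphere2, Nat.card (f ⁻¹' {p} : Set (Fin comps × Param)) ≤ 2
  crossings_finite :
    {p : Sphere2 | Nat.card (f ⁻¹' {p} : Set (Fin comps × Param)) = 2}.Finite

namespace LinkProjection

/-- The image of the link projection on the sphere. -/
def image (L : LinkProjection) : Set Sphere2 := Set.range L.f

/-- The crossings: the double points of the projection. -/
def crossings (L : LinkProjection) : Set Sphere2 :=
  {p : Sphere2 | Nat.card (L.f ⁻¹' {p} : Set (Fin L.comps × Param)) = 2}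

/-- The crossing number of the link projection. -/
def crossingNumber (L : LinkProjection) : ℕ := Nat.card L.crossings

/-- A link projection is connected when its image is connected. -/
def Connected (L : LinkProjection) : Prop := IsConnected L.image

/-- A region: a connected component of the complement of the projection. -/
def IsRegion (L : LinkProjection) (R : Set Sphere2) : Prop :=
  ∃ x : Sphere2, x ∉ L.image ∧ R = connectedComponentIn L.imageᶜ x

/-- Two regions are independent when they share no crossing on their boundaries. -/
def IndepPair (L : LinkProjection) (R S : Set Sphere2) : Prop :=
  ∀ p ∈ L.crossings, ¬(p ∈ frontier R ∧ p ∈ frontier S)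

/-- A finite family of pairwise independent regions. -/
def IndepRegions (L : LinkProjection) (S : Finset (Set Sphere2)) : Prop :=
  (∀ R ∈ S, L.IsRegion R) ∧ (S : Set (Set Sphere2)).Pairwise L.IndepPair

/-- `L` has at least `m` pairwise independent regions. -/
def HasIndepRegions (L : LinkProjection) (m : ℕ) : Prop :=
  ∃ S : Finset (Set Sphere2), L.IndepRegions S ∧ m ≤ S.card

end LinkProjection

namespace KP

/-- `f` has a continuous logarithm on `X`. -/
def HasLog (X : Set ℂ) (f : ℂ → ℂ) : Prop :=
  ∃ g : ℂ → ℂ, ContinuousOn g X ∧ ∀ z ∈ X, Complex.exp (g z) = f z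

theorem exists_log_of_sc {A : Type} [TopologicalSpace A] [SimplyConnectedSpace A]
    [LocallyPathConnectedSpace A] (f : A → ℂ) (hc : Continuous f) (hf : ∀ a, f a ≠ 0) :
    ∃ g : A → ℂ, Continuous g ∧ ∀ a, Complex.exp (g a) = f a := by
  obtain ⟨a0⟩ : Nonempty A := inferInstance
  obtain ⟨g, ⟨-, hg⟩, -⟩ := Complex.isCoveringMapOn_exp.existsUnique_continuousMap_lifts
    (⟨f, hc⟩ : C(A, ℂ)) (a₀ := a0) (Complex.exp_log (hf a0)) (fun x => hf x)
  exact ⟨g, g.continuous, fun a => congr_fun hg a⟩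

/-- path logarithm on an interval -/
theorem exists_log_Icc {a b : ℝ} (hab : a ≤ b) (f : ℝ → ℂ) (hc : ContinuousOn f (Icc a b))
    (hf : ∀ u ∈ Icc a b, f u ≠ 0) :
    ∃ g : ℝ → ℂ, Continuous g ∧ ∀ u ∈ Icc a b, Complex.exp (g u) = f u := by
  obtain ⟨g, hg, h⟩ := exists_log_of_sc (fun u : ℝ => f (projIcc a b hab u))
    ((continuousOn_iff_continuous_domRestrict.1 hc).comp continuous_projIcc) (fun u => hf _ (projIcc a b hab u).2)
  refine ⟨g, hg, fun u hu => ?_⟩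
  rw [h, projIcc_of_mem hab hu]

theorem exists_tietze {X : Set ℂ} (hX : IsClosed X) {g : ℂ → ℂ} (hg : ContinuousOn g X) :
    ∃ G : ℂ → ℂ, Continuous G ∧ ∀ z ∈ X, G z = g z := by
  obtain ⟨G, hG⟩ := ContinuousMap.exists_restrict_eq hX
    (⟨X.domRestrict g, continuousOn_iff_continuous_domRestrict.1 hg⟩ : C(X, ℂ))
  exact ⟨G, G.continuous, fun z hz => DFunLike.congr_fun hG ⟨z, hz⟩⟩

theorem hasLog_arc {a b : ℝ} (hab : a ≤ b) {δ : ℝ → ℂ} (hd : ContinuousOn δ (Icc a b))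
    (hi : InjOn δ (Icc a b)) {f : ℂ → ℂ} (hc : ContinuousOn f (δ '' Icc a b))
    (hf : ∀ z ∈ δ '' Icc a b, f z ≠ 0) : HasLog (δ '' Icc a b) f := by
  obtain ⟨θ, hθ, h⟩ := exists_log_Icc hab (f ∘ δ) (hc.comp hd (mapsTo_image _ _))
    (fun u hu => hf _ (mem_image_of_mem _ hu))
  have he : Topology.IsClosedEmbedding ((Icc a b).domRestrict δ) :=
    (continuousOn_iff_continuous_domRestrict.1 hd).isClosedEmbedding (injOn_iff_injective.1 hi)
  obtain ⟨G, hG⟩ := ContinuousMap.exists_extension' he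
    (⟨fun u => θ u, by fun_prop⟩ : C(Icc a b, ℂ))
  refine ⟨G, G.continuous.continuousOn, ?_⟩
  rintro _ ⟨u, hu, rfl⟩
  have := congr_fun hG ⟨u, hu⟩
  simp at this
  rw [this, h u hu]; rfl

theorem HasLog.mono {X Y : Set ℂ} {f : ℂ → ℂ} (h : HasLog Y f) (hXY : X ⊆ Y) : HasLog X f := by
  obtain ⟨g, hg, h⟩ := h
  exact ⟨g, hg.mono hXY, fun z hz => h z (hXY hz)⟩

theorem HasLog.congr {X : Set ℂ} {f f' : ℂ → ℂ} (h : HasLog X f) (hff : ∀ z ∈ X, f' z = f z) :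
    HasLog X f' := by
  obtain ⟨g, hg, h⟩ := h
  exact ⟨g, hg, fun z hz => by rw [h z hz, hff z hz]⟩

theorem HasLog.mul {X : Set ℂ} {f f' : ℂ → ℂ} (h : HasLog X f) (h' : HasLog X f') :
    HasLog X (fun z => f z * f' z) := by
  obtain ⟨g, hg, h⟩ := h
  obtain ⟨g', hg', h'⟩ := h'
  exact ⟨g + g', hg.add hg', fun z hz => by simp [Complex.exp_add, h z hz, h' z hz]⟩

theorem HasLog.inv {X : Set ℂ} {f : ℂ → ℂ} (h : HasLog X f) :
    HasLog X (fun z => (f z)⁻¹) := by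
  obtain ⟨g, hg, h⟩ := h
  exact ⟨-g, hg.neg, fun z hz => by simp [Complex.exp_neg, h z hz]⟩

/-- G2: gluing logs whose difference on the overlap is constant. -/
theorem glue_logs {Y D : Set ℂ} (hY : IsClosed Y) (hD : IsClosed D) {f g₁ g₂ : ℂ → ℂ} {κ : ℂ}
    (h1 : ContinuousOn g₁ Y) (h2 : ContinuousOn g₂ D) (e1 : ∀ z ∈ Y, Complex.exp (g₁ z) = f z)
    (e2 : ∀ z ∈ D, Complex.exp (g₂ z) = f z) (hκ : ∀ z ∈ Y ∩ D, g₁ z - g₂ z = κ) :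
    HasLog (Y ∪ D) f := by
  classical
  by_cases hne : (Y ∩ D).Nonempty
  · obtain ⟨z0, hz0⟩ := hne
    have hk : Complex.exp κ = 1 := by
      have hne : Complex.exp (g₂ z0) ≠ 0 := Complex.exp_ne_zero _
      rw [← hκ z0 hz0, Complex.exp_sub, e1 z0 hz0.1, ← e2 z0 hz0.2]
      exact div_self hne
    refine ⟨fun z => if z ∈ Y then g₁ z else g₂ z + κ, ?_, ?_⟩
    · refine ContinuousOn.union_of_isClosed ?_ ?_ hY hD
      · exact h1.congr fun z hz => by simp [hz]
      · refine (h2.add (continuousOn_const (c := κ))).congr fun z hz => ?_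
        by_cases hzY : z ∈ Y
        · simp [hzY, ← hκ z ⟨hzY, hz⟩]
        · simp [hzY]
    · rintro z hz
      by_cases hzY : z ∈ Y
      · simp [hzY, e1 z hzY]
      · simp [hzY, Complex.exp_add, hk, e2 z (hz.resolve_left hzY)]
  · refine ⟨fun z => if z ∈ Y then g₁ z else g₂ z, ?_, ?_⟩
    · refine ContinuousOn.union_of_isClosed ?_ ?_ hY hD
      · exact h1.congr fun z hz => by simp [hz]
      · refine h2.congr fun z hz => ?_
        have : z ∉ Y := fun h => hne ⟨z, h, hz⟩
        simp [this]
    · rintro z hz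
      by_cases hzY : z ∈ Y
      · simp [hzY, e1 z hzY]
      · simp [hzY, e2 z (hz.resolve_left hzY)]

/-- G1 -/
theorem HasLog.union_subsingleton {Y D : Set ℂ} (hY : IsClosed Y) (hD : IsClosed D) {f : ℂ → ℂ}
    (h1 : HasLog Y f) (h2 : HasLog D f) (hs : (Y ∩ D).Subsingleton) : HasLog (Y ∪ D) f := by
  obtain ⟨g₁, hg₁, e1⟩ := h1
  obtain ⟨g₂, hg₂, e2⟩ := h2
  rcases hs.eq_empty_or_singleton with h | ⟨x, h⟩
  · exact glue_logs hY hD hg₁ hg₂ e1 e2 (κ := 0) (by simp [h])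
  · exact glue_logs hY hD hg₁ hg₂ e1 e2 (κ := g₁ x - g₂ x) (by simp [h])

/-- Two logarithms of the same function differ by a constant on a preconnected set. -/
theorem log_sub_const {A : Type*} [TopologicalSpace A] {X : Set A} (hX : IsPreconnected X)
    {g₁ g₂ : A → ℂ} (h1 : ContinuousOn g₁ X) (h2 : ContinuousOn g₂ X)
    (h : ∀ z ∈ X, Complex.exp (g₁ z) = Complex.exp (g₂ z)) {x y : A} (hx : x ∈ X) (hy : y ∈ X) :
    g₁ x - g₂ x = g₁ y - g₂ y := by
  choose! n hn using fun z hz => Complex.exp_eq_exp_iff_exists_int.1 (h z hz)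
  have hpi : (2 * Real.pi * Complex.I : ℂ) ≠ 0 := Complex.two_pi_I_ne_zero
  have hn' : ∀ z ∈ X, (n z : ℝ) = ((g₁ z - g₂ z) / (2 * Real.pi * Complex.I)).re := by
    intro z hz
    rw [hn z hz, add_sub_cancel_left, mul_div_cancel_right₀ _ hpi]; simp
  have hc : ContinuousOn n X := by
    have : ContinuousOn (fun z => (n z : ℝ)) X := by
      refine ContinuousOn.congr ?_ hn'
      exact Complex.continuous_re.comp_continuousOn ((h1.sub h2).div_const _)
    exact Int.isClosedEmbedding_coe_real.isEmbedding.continuousOn_iff.2 this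
  have := hX.constant hc hx hy
  rw [hn x hx, hn y hy, this]; ring

end KP

namespace KP

theorem circle_lemma {M : ℝ → ℂ} (hM : ContinuousOn M (Icc 0 (2 * Real.pi)))
    (hper : M (2 * Real.pi) = M 0)
    {C : ℂ} (hC : C ≠ 0) {k : ℤ}
    (h : ∀ θ ∈ Icc (0:ℝ) (2 * Real.pi), Complex.exp (M θ) = C * Complex.exp (θ * Complex.I) ^ k) :
    k = 0 := by
  have hpi : (2 * Real.pi * Complex.I : ℂ) ≠ 0 := Complex.two_pi_I_ne_zero
  have := log_sub_const (isPreconnected_Icc (a := (0:ℝ)) (b := 2 * Real.pi)) hM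
    (g₂ := fun θ : ℝ => Complex.log C + k * (θ * Complex.I)) (by fun_prop)
    (fun θ hθ => by
      rw [h θ hθ, Complex.exp_add, Complex.exp_log hC, Complex.exp_int_mul])
    (x := 0) (y := 2 * Real.pi) (by simp [Real.pi_pos.le]) (by simp [Real.pi_pos.le])
  rw [hper] at this
  have h2 : (k : ℂ) * (2 * Real.pi * Complex.I) = 0 := by
    push_cast at this
    linear_combination this
  rcases mul_eq_zero.1 h2 with h3 | h3
  · exact_mod_cast h3
  · exact absurd h3 hpi

theorem continuousOn_log_one_sub {X : Set ℂ} {p : ℂ} (h : ∀ z ∈ X, ‖p‖ < ‖z‖) :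
    ContinuousOn (fun z => Complex.log (1 - p / z)) X := by
  have h0 : ∀ z ∈ X, z ≠ 0 := fun z hz h' => by
    have := h z hz; rw [h', norm_zero] at this; exact absurd this (not_lt.2 (norm_nonneg _))
  refine ContinuousOn.clog (continuousOn_const.sub (continuousOn_const.div continuousOn_id h0)) ?_
  intro z hz
  have : ‖-(p / z)‖ < 1 := by
    rw [norm_neg, norm_div, div_lt_one (norm_pos_iff.2 (h0 z hz))]; exact h z hz
  simpa [sub_eq_add_neg] using! Complex.mem_slitPlane_of_norm_lt_one this

theorem zpow_finset_sum {κ : Type*} (w : ℂ) (hw : w ≠ 0) (s : Finset κ) (n : κ → ℤ) :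
    w ^ (∑ i ∈ s, n i) = ∏ i ∈ s, w ^ n i := by
  classical
  induction s using Finset.induction_on with
  | empty => simp
  | insert a s ha ih => rw [Finset.sum_insert ha, Finset.prod_insert ha, zpow_add₀ hw, ih]

theorem lemmaB {κ : Type*} (s : Finset κ) (p : κ → ℂ) (n : κ → ℤ) {X U : Set ℂ}
    (hX : IsClosed X) (hUo : IsOpen U) (hUb : Bornology.IsBounded U) (hfr : frontier U ⊆ X)
    (hp : ∀ i ∈ s, p i ∉ X) (hlog : HasLog X (fun z => ∏ i ∈ s, (z - p i) ^ (n i))) [DecidablePred (fun i => p i ∈ U)] :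
    ∑ i ∈ s with p i ∈ U, n i = 0 := by
  classical
  obtain ⟨g, hg, hge⟩ := hlog
  obtain ⟨G, hG, hGg⟩ := exists_tietze hX hg
  set A := s.filter (fun i => p i ∈ U) with hA
  set B := s.filter (fun i => ¬ p i ∈ U) with hB
  have hAB : ∀ z, ∏ i ∈ s, (z - p i) ^ (n i) =
      (∏ i ∈ A, (z - p i) ^ (n i)) * ∏ i ∈ B, (z - p i) ^ (n i) := fun z =>
    (Finset.prod_filter_mul_prod_filter_not s _ _).symm
  let F : ℂ → ℂ := fun z => if z ∈ U then Complex.exp (G z) * (∏ i ∈ B, (z - p i) ^ (n i))⁻¹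
    else ∏ i ∈ A, (z - p i) ^ (n i)
  have hBne : ∀ z ∈ closure U, ∀ i ∈ B, z - p i ≠ 0 := by
    intro z hz i hi h0
    rw [hB, Finset.mem_filter] at hi
    have : z = p i := sub_eq_zero.1 h0
    by_cases hzU : z ∈ U
    · exact hi.2 (this ▸ hzU)
    · exact hp i hi.1 (this ▸ hfr (by rw [frontier, hUo.interior_eq]; exact ⟨hz, hzU⟩))
  have hAne : ∀ z ∉ U, ∀ i ∈ A, z - p i ≠ 0 := by
    intro z hz i hi h0
    rw [hA, Finset.mem_filter] at hi
    exact hz ((sub_eq_zero.1 h0) ▸ hi.2)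
  have hFc : Continuous F := by
    rw [← continuousOn_univ]
    refine ContinuousOn.if ?_ ?_ ?_
    · rintro z ⟨-, hz⟩
      change z ∈ frontier U at hz
      have hzX := hfr hz
      have hzc : z ∈ closure U := hz.1
      rw [hGg z hzX, hge z hzX]
      simp only []
      rw [hAB, mul_assoc, mul_inv_cancel₀, mul_one]
      exact Finset.prod_ne_zero_iff.2 fun i hi => zpow_ne_zero _ (hBne z hzc i hi)
    · rw [univ_inter]
      change ContinuousOn _ (closure U)
      refine (hG.cexp.continuousOn).mul (ContinuousOn.inv₀ ?_ ?_)
      · refine continuousOn_finsetProd _ fun i hi => ?_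
        exact ContinuousOn.zpow₀ (by fun_prop) _ fun z hz => Or.inl (hBne z hz i hi)
      · intro z hz
        exact Finset.prod_ne_zero_iff.2 fun i hi => zpow_ne_zero _ (hBne z hz i hi)
    · rw [univ_inter]
      change ContinuousOn _ (closure Uᶜ)
      rw [hUo.isClosed_compl.closure_eq]
      refine continuousOn_finsetProd _ fun i hi => ?_
      exact ContinuousOn.zpow₀ (by fun_prop) _ fun z hz => Or.inl (hAne z hz i hi)
  have hFne : ∀ z, F z ≠ 0 := by
    intro z
    by_cases hz : z ∈ U
    · simp only [F, hz, if_true]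
      refine mul_ne_zero (Complex.exp_ne_zero _) (inv_ne_zero ?_)
      exact Finset.prod_ne_zero_iff.2 fun i hi => zpow_ne_zero _ (hBne z (subset_closure hz) i hi)
    · simp only [F, hz, if_false]
      exact Finset.prod_ne_zero_iff.2 fun i hi => zpow_ne_zero _ (hAne z hz i hi)
  obtain ⟨H, hH, hHe⟩ := exists_log_of_sc F hFc hFne
  obtain ⟨ρ, hρ0, hρ⟩ : ∃ ρ > 0, U ⊆ Metric.ball 0 ρ := by
    obtain ⟨ρ, hρ⟩ := hUb.subset_ball 0
    exact ⟨max ρ 1, by positivity, hρ.trans (Metric.ball_subset_ball (le_max_left _ _))⟩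
  have hcn : ∀ θ : ℝ, ‖(ρ : ℂ) * Complex.exp (θ * Complex.I)‖ = ρ := by
    intro θ; rw [norm_mul, Complex.norm_exp_ofReal_mul_I]; simp [abs_of_pos hρ0]
  have hpA : ∀ i ∈ A, ‖p i‖ < ρ := by
    intro i hi
    rw [hA, Finset.mem_filter] at hi
    simpa using hρ hi.2
  have hρc : (ρ : ℂ) ≠ 0 := by exact_mod_cast hρ0.ne'
  refine circle_lemma (M := fun θ => H (ρ * Complex.exp (θ * Complex.I)) -
    ∑ i ∈ A, n i * Complex.log (1 - p i / (ρ * Complex.exp (θ * Complex.I)))) ?_ ?_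
    (C := (ρ : ℂ) ^ (∑ i ∈ A, n i)) (zpow_ne_zero _ hρc) ?_
  · refine ContinuousOn.sub (hH.comp (by fun_prop)).continuousOn ?_
    refine continuousOn_finsetSum _ fun i hi => continuousOn_const.mul ?_
    refine (continuousOn_log_one_sub (X := Metric.sphere 0 ρ) (p := p i) ?_).comp
      (f := fun θ : ℝ => (ρ : ℂ) * Complex.exp (θ * Complex.I)) (by fun_prop) ?_
    · intro z hz; rw [mem_sphere_zero_iff_norm.1 hz]; exact hpA i hi
    · intro θ _; rw [mem_sphere_zero_iff_norm]; exact hcn θ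
  · simp
  · intro θ _
    set w := (ρ : ℂ) * Complex.exp (θ * Complex.I) with hw
    have hwU : w ∉ U := fun h => by
      have := hρ h; rw [mem_ball_zero_iff, hcn] at this; exact lt_irrefl _ this
    have hw0 : w ≠ 0 := by
      intro h; have := hcn θ; rw [← hw, h, norm_zero] at this; exact hρ0.ne this
    rw [← mul_zpow, ← hw, Complex.exp_sub, hHe, Complex.exp_sum, div_eq_iff (Finset.prod_ne_zero_iff.2 fun i _ => Complex.exp_ne_zero _),
      zpow_finset_sum w hw0, ← Finset.prod_mul_distrib]
    simp only [F, hwU, if_false]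
    refine Finset.prod_congr rfl fun i hi => ?_
    have : (1 : ℂ) - p i / w ≠ 0 := by
      intro h
      have h2 : p i = w := (div_eq_one_iff_eq hw0).1 (sub_eq_zero.1 h).symm
      have := hpA i hi; rw [h2, hcn] at this; exact lt_irrefl _ this
    rw [Complex.exp_int_mul, Complex.exp_log this, ← mul_zpow]
    congr 1; field_simp

theorem lemmaE {Y C : Set ℂ} (hY : IsClosed Y) (hC : IsPreconnected C) (hd : Disjoint C Y)
    {r q : ℂ} (hr : r ∈ C) (hq : q ∈ C) : HasLog Y (fun z => (z - r) / (z - q)) := by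
  have hne : ∀ x ∈ C, ∀ z ∈ Y, z - x ≠ 0 := fun x hx z hz h =>
    hd.le_bot ⟨hx, (sub_eq_zero.1 h) ▸ hz⟩
  refine hC.induction₂ (fun x y => HasLog Y (fun z => (z - x) / (z - y))) ?_ ?_ ?_ hr hq
  · intro x hx
    have hxY : x ∈ Yᶜ := fun h => hd.le_bot ⟨hx, h⟩
    obtain ⟨ε, hε, hb⟩ := Metric.isOpen_iff.1 hY.isOpen_compl x hxY
    refine mem_nhdsWithin_of_mem_nhds ?_
    filter_upwards [Metric.ball_mem_nhds x hε] with y hy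
    have key : HasLog Y (fun z => (z - y) / (z - x)) := by
      refine ⟨fun z => Complex.log (1 - (y - x) / (z - x)), ?_, ?_⟩
      · refine (continuousOn_log_one_sub (X := {w | ε ≤ ‖w‖}) (p := y - x) ?_).comp
          (f := fun z => z - x) (by fun_prop) ?_
        · intro w hw; exact lt_of_lt_of_le (mem_ball_iff_norm.1 hy) hw
        · intro z hz
          by_contra h
          exact hb (mem_ball_iff_norm.2 (not_le.1 h)) hz
      · intro z hz
        have h0 := hne x hx z hz
        have : (1 : ℂ) - (y - x) / (z - x) = (z - y) / (z - x) := by field_simp; ring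
        simp only [this]
        refine Complex.exp_log (div_ne_zero ?_ h0)
        intro h
        exact hb hy ((sub_eq_zero.1 h) ▸ hz)
    simpa using key.inv
  · intro x y z hx hy hz h1 h2
    refine (h1.mul h2).congr fun w hw => ?_
    have := hne y hy w hw
    have := hne z hz w hw
    field_simp
  · intro x y hx hy h
    simpa using h.inv

end KP

namespace KP

open Classical in
/-- change of the logarithm of `γ - p` along the path `γ`. -/
def logChange (γ : ℝ → ℂ) (p : ℂ) : ℂ :=
  if h : ∃ θ : ℝ → ℂ, ContinuousOn θ (Icc 0 1) ∧ ∀ u ∈ Icc (0:ℝ) 1, Complex.exp (θ u) = γ u - p then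
    h.choose 1 - h.choose 0 else 0

theorem logChange_eq {γ : ℝ → ℂ} {p : ℂ} {θ : ℝ → ℂ} (hθ : ContinuousOn θ (Icc 0 1))
    (h : ∀ u ∈ Icc (0:ℝ) 1, Complex.exp (θ u) = γ u - p) : logChange γ p = θ 1 - θ 0 := by
  have hex : ∃ θ : ℝ → ℂ, ContinuousOn θ (Icc 0 1) ∧ ∀ u ∈ Icc (0:ℝ) 1, Complex.exp (θ u) = γ u - p :=
    ⟨θ, hθ, h⟩
  rw [logChange, dif_pos hex]
  have := log_sub_const (isPreconnected_Icc (a := (0:ℝ)) (b := 1)) hex.choose_spec.1 hθ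
    (fun u hu => by rw [hex.choose_spec.2 u hu, h u hu]) (x := 0) (y := 1) (by simp) (by simp)
  linear_combination -this

theorem exists_theta {γ : ℝ → ℂ} (hγ : ContinuousOn γ (Icc 0 1)) {p : ℂ} (hp : p ∉ γ '' Icc 0 1) :
    ∃ θ : ℝ → ℂ, ContinuousOn θ (Icc 0 1) ∧ ∀ u ∈ Icc (0:ℝ) 1, Complex.exp (θ u) = γ u - p := by
  obtain ⟨g, hg, h⟩ := exists_log_Icc zero_le_one (fun u => γ u - p) (by fun_prop)
    (fun u hu h => hp ⟨u, hu, sub_eq_zero.1 h⟩)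
  exact ⟨g, hg.continuousOn, h⟩

theorem exp_logChange {γ : ℝ → ℂ} (hγ : ContinuousOn γ (Icc 0 1)) {p : ℂ} (hp : p ∉ γ '' Icc 0 1) :
    Complex.exp (logChange γ p) = (γ 1 - p) / (γ 0 - p) := by
  obtain ⟨θ, hθ, h⟩ := exists_theta hγ hp
  rw [logChange_eq hθ h, Complex.exp_sub, h 1 (by simp), h 0 (by simp)]

theorem one_sub_div_ne {a b : ℂ} (h : ‖a‖ < ‖b‖) : (1:ℂ) - a / b ≠ 0 := by
  intro h0
  have hb : b ≠ 0 := by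
    rintro rfl; rw [norm_zero] at h; exact absurd h (not_lt.2 (norm_nonneg _))
  have : a = b := (div_eq_one_iff_eq hb).1 (sub_eq_zero.1 h0).symm
  rw [this] at h; exact lt_irrefl _ h

theorem one_sub_div_mem {a b : ℂ} (h : ‖a‖ < ‖b‖) : (1:ℂ) - a / b ∈ Complex.slitPlane := by
  have hb : b ≠ 0 := by
    rintro rfl; rw [norm_zero] at h; exact absurd h (not_lt.2 (norm_nonneg _))
  have : ‖-(a / b)‖ < 1 := by
    rw [norm_neg, norm_div, div_lt_one (norm_pos_iff.2 hb)]; exact h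
  simpa [sub_eq_add_neg] using! Complex.mem_slitPlane_of_norm_lt_one this

theorem continuousOn_logChange {γ : ℝ → ℂ} (hγ : ContinuousOn γ (Icc 0 1)) :
    ContinuousOn (logChange γ) (γ '' Icc 0 1)ᶜ := by
  have hcl : IsClosed (γ '' Icc 0 1) := (isCompact_Icc.image_of_continuousOn hγ).isClosed
  intro p hp
  refine ContinuousAt.continuousWithinAt ?_
  obtain ⟨ε, hε, hb⟩ := Metric.isOpen_iff.1 hcl.isOpen_compl p hp
  obtain ⟨θ, hθ, h⟩ := exists_theta hγ hp
  have hne : ∀ u ∈ Icc (0:ℝ) 1, ε ≤ ‖γ u - p‖ := by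
    intro u hu
    by_contra hlt
    exact hb (mem_ball_iff_norm.2 (not_le.1 hlt)) ⟨u, hu, rfl⟩
  have key : ∀ q ∈ Metric.ball p ε, logChange γ q = logChange γ p +
      (Complex.log (1 - (q - p) / (γ 1 - p)) - Complex.log (1 - (q - p) / (γ 0 - p))) := by
    intro q hq
    have hq' := mem_ball_iff_norm.1 hq
    rw [logChange_eq hθ h, logChange_eq (θ := fun u => θ u + Complex.log (1 - (q - p) / (γ u - p)))]
    · ring
    · refine hθ.add (ContinuousOn.clog ?_ ?_)
      · refine continuousOn_const.sub (continuousOn_const.div (by fun_prop) ?_)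
        intro u hu h0
        have := hne u hu
        rw [h0, norm_zero] at this; linarith
      · intro u hu
        exact one_sub_div_mem (lt_of_lt_of_le hq' (hne u hu))
    · intro u hu
      have h0 : γ u - p ≠ 0 := by
        intro h0
        have := hne u hu
        rw [h0, norm_zero] at this; linarith
      rw [Complex.exp_add, h u hu, Complex.exp_log (one_sub_div_ne (lt_of_lt_of_le hq' (hne u hu)))]
      field_simp; ring
  have : ContinuousAt (fun q => logChange γ p +
      (Complex.log (1 - (q - p) / (γ 1 - p)) - Complex.log (1 - (q - p) / (γ 0 - p)))) p := by
    have : ∀ a : ℂ, ContinuousAt (fun q => Complex.log (1 - (q - p) / a)) p := by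
      intro a
      refine ContinuousAt.clog (by fun_prop) ?_
      simp
    exact continuousAt_const.add ((this _).sub (this _))
  exact this.congr (by filter_upwards [Metric.ball_mem_nhds p hε] with q hq using (key q hq).symm)

theorem tendsto_logChange {γ : ℝ → ℂ} (hγ : ContinuousOn γ (Icc 0 1)) :
    Filter.Tendsto (logChange γ) (Bornology.cobounded ℂ) (nhds 0) := by
  have hcp : IsCompact (γ '' Icc 0 1) := isCompact_Icc.image_of_continuousOn hγ
  obtain ⟨ρ, hρ⟩ := hcp.isBounded.subset_ball (γ 0)
  have ht : Filter.Tendsto (fun p => Complex.log (1 - (γ 1 - γ 0) / (p - γ 0)))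
      (Bornology.cobounded ℂ) (nhds 0) := by
    have h1 : Filter.Tendsto (fun p : ℂ => p - γ 0) (Bornology.cobounded ℂ) (Bornology.cobounded ℂ) :=
      tendsto_sub_const_cobounded _
    have h2 : Filter.Tendsto (fun p : ℂ => (1:ℂ) - (γ 1 - γ 0) * (p - γ 0)⁻¹) (Bornology.cobounded ℂ)
        (nhds (1 - (γ 1 - γ 0) * 0)) :=
      tendsto_const_nhds.sub (tendsto_const_nhds.mul (Filter.tendsto_inv₀_cobounded.comp h1))
    have h3 := (continuousAt_clog (x := 1 - (γ 1 - γ 0) * 0) (by simp)).tendsto.comp h2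
    simpa [div_eq_mul_inv, Function.comp_def] using h3
  refine ht.congr' ?_
  have hev : ∀ᶠ p : ℂ in Bornology.cobounded ℂ, p ∉ Metric.ball (γ 0) ρ :=
    Bornology.isBounded_def.1 Metric.isBounded_ball
  filter_upwards [hev] with p hp
  have hlt : ∀ u ∈ Icc (0:ℝ) 1, ‖γ u - γ 0‖ < ‖p - γ 0‖ := by
    intro u hu
    have h1 := mem_ball_iff_norm.1 (hρ ⟨u, hu, rfl⟩)
    have h2 : ¬ ‖p - γ 0‖ < ρ := fun h => hp (mem_ball_iff_norm.2 h)
    linarith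
  have h0 : p - γ 0 ≠ 0 := by
    intro h0; have := hlt 0 (by simp); simp [h0] at this
  have h0' : γ 0 - p ≠ 0 := by rw [← neg_sub]; exact neg_ne_zero.2 h0
  rw [logChange_eq (θ := fun u => Complex.log (γ 0 - p) + Complex.log (1 - (γ u - γ 0) / (p - γ 0)))]
  · simp
  · refine continuousOn_const.add (ContinuousOn.clog (by fun_prop) ?_)
    intro u hu
    exact one_sub_div_mem (hlt u hu)
  · intro u hu
    rw [Complex.exp_add, Complex.exp_log h0', Complex.exp_log (one_sub_div_ne (hlt u hu))]
    field_simp; ring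

end KP

namespace KP

/-- finite system of arcs in the plane with disjoint interiors -/
structure ArcSys (ι : Type) where
  γ : ι → ℝ → ℂ
  V : Finset ℂ
  cont : ∀ i, Continuous (γ i)
  s_mem : ∀ i, γ i 0 ∈ V
  t_mem : ∀ i, γ i 1 ∈ V
  int_notMem : ∀ i, ∀ u ∈ Ioo (0:ℝ) 1, γ i u ∉ V
  inj : ∀ i j, ∀ u ∈ Ioo (0:ℝ) 1, ∀ v ∈ Ioo (0:ℝ) 1, γ i u = γ j v → i = j ∧ u = v

namespace ArcSys
variable {ι : Type} (A : ArcSys ι)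

/-- closed edge -/
def E (i : ι) : Set ℂ := A.γ i '' Icc 0 1
/-- open edge -/
def O (i : ι) : Set ℂ := A.γ i '' Ioo 0 1
/-- the part of the system carried by a set of edges, plus all vertices -/
def K (S : Set ι) : Set ℂ := (A.V : Set ℂ) ∪ ⋃ i ∈ S, A.E i
/-- support -/
def X : Set ℂ := A.K univ

theorem isCompact_E (i : ι) : IsCompact (A.E i) :=
  isCompact_Icc.image_of_continuousOn (A.cont i).continuousOn

theorem isCompact_K [Finite ι] (S : Set ι) : IsCompact (A.K S) :=
  A.V.finite_toSet.isCompact.union (S.toFinite.isCompact_biUnion fun i _ => A.isCompact_E i)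

theorem isCompact_X [Finite ι] : IsCompact A.X := A.isCompact_K _

theorem E_eq (i : ι) : A.E i = A.O i ∪ {A.γ i 0, A.γ i 1} := by
  rw [E, O]
  have : Icc (0:ℝ) 1 = Ioo 0 1 ∪ {0, 1} := by
    ext x; simp only [mem_Icc, mem_union, mem_Ioo, mem_insert_iff, mem_singleton_iff]
    constructor
    · rintro ⟨h0, h1⟩
      rcases h0.eq_or_lt with h | h
      · exact Or.inr (Or.inl h.symm)
      · rcases h1.eq_or_lt with h' | h'
        · exact Or.inr (Or.inr h')
        · exact Or.inl ⟨h, h'⟩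
    · rintro (h | h | h)
      · exact ⟨h.1.le, h.2.le⟩
      · simp [h]
      · simp [h]
  rw [this, image_union, image_pair]

theorem mem_E_of_O {i : ι} {p : ℂ} (h : p ∈ A.O i) : p ∈ A.E i := by
  rw [E_eq]; exact Or.inl h

theorem O_notMem_V {i : ι} {p : ℂ} (h : p ∈ A.O i) : p ∉ A.V := by
  obtain ⟨u, hu, rfl⟩ := h; exact A.int_notMem i u hu

theorem mem_O_of_E {i : ι} {p : ℂ} (h : p ∈ A.E i) (hV : p ∉ A.V) : p ∈ A.O i := by
  rw [E_eq] at h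
  rcases h with h | h | h
  · exact h
  · exact absurd (h ▸ A.s_mem i) hV
  · exact absurd (h ▸ A.t_mem i) hV

theorem O_unique {i j : ι} {p : ℂ} (h : p ∈ A.O i) (h' : p ∈ A.E j) : i = j := by
  obtain ⟨v, hv, hv'⟩ := A.mem_O_of_E h' (A.O_notMem_V h)
  obtain ⟨u, hu, rfl⟩ := h
  exact (A.inj i j u hu v hv hv'.symm).1

theorem E_subset_X (i : ι) : A.E i ⊆ A.X := fun _ h => Or.inr (by simp only [mem_iUnion]; exact ⟨i, trivial, h⟩)

theorem V_subset_X : (A.V : Set ℂ) ⊆ A.X := fun _ h => Or.inl h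

/-- integral boundary -/
def bdZ [Fintype ι] (z : ι → ℤ) (v : ℂ) : ℤ :=
  ∑ i, z i * ((if A.γ i 1 = v then 1 else 0) - (if A.γ i 0 = v then 1 else 0))

theorem sum_potential [Fintype ι] (z : ι → ℤ) (h : ∀ v ∈ A.V, A.bdZ z v = 0) (φ : ℂ → ℂ) :
    ∑ i, (z i : ℂ) * (φ (A.γ i 1) - φ (A.γ i 0)) = 0 := by
  have h1 : ∀ x ∈ A.V, φ x = ∑ v ∈ A.V, (if x = v then 1 else 0) * φ v := by
    intro x hx; simp [hx]
  have : ∑ i, (z i : ℂ) * (φ (A.γ i 1) - φ (A.γ i 0)) = ∑ v ∈ A.V, (A.bdZ z v : ℂ) * φ v := by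
    simp only [bdZ]
    push_cast
    simp only [Finset.sum_mul]
    rw [Finset.sum_comm]
    refine Finset.sum_congr rfl fun i _ => ?_
    rw [h1 _ (A.t_mem i), h1 _ (A.s_mem i), ← Finset.sum_sub_distrib, Finset.mul_sum]
    refine Finset.sum_congr rfl fun v _ => ?_
    ring
  rw [this]
  exact Finset.sum_eq_zero fun v hv => by simp [h v hv]

theorem exp_logChange' (i : ι) {p : ℂ} (hp : p ∉ A.E i) (hV : p ∉ A.V) :
    Complex.exp (logChange (A.γ i) p) =
      Complex.exp (Complex.log (A.γ i 1 - p) - Complex.log (A.γ i 0 - p)) := by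
  have h1 : A.γ i 1 - p ≠ 0 := fun h => hV ((sub_eq_zero.1 h) ▸ A.t_mem i)
  have h0 : A.γ i 0 - p ≠ 0 := fun h => hV ((sub_eq_zero.1 h) ▸ A.s_mem i)
  rw [exp_logChange (A.cont i).continuousOn hp, Complex.exp_sub, Complex.exp_log h1, Complex.exp_log h0]

theorem cont_logChange (i : ι) : ContinuousOn (logChange (A.γ i)) (A.E i)ᶜ :=
  continuousOn_logChange (A.cont i).continuousOn

theorem exp_sub_sum {κ : Type*} (s : Finset κ) (z : κ → ℤ) (f g : κ → ℂ)
    (h : ∀ i ∈ s, Complex.exp (f i) = Complex.exp (g i)) :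
    Complex.exp (∑ i ∈ s, z i * f i) = Complex.exp (∑ i ∈ s, z i * g i) := by
  rw [Complex.exp_sum, Complex.exp_sum]
  refine Finset.prod_congr rfl fun i hi => ?_
  rw [Complex.exp_int_mul, Complex.exp_int_mul, h i hi]

theorem coeff_eq_zero [Fintype ι] [DecidableEq ι] (z : ι → ℤ) (hbd : ∀ v ∈ A.V, A.bdZ z v = 0)
    (hw : ∀ p ∉ A.X, ∑ i, (z i : ℂ) * logChange (A.γ i) p = 0) (e : ι) (he : A.γ e 0 ≠ A.γ e 1) :
    z e = 0 := by
  classical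
  set t := A.γ e 1 with ht
  set s := A.γ e 0 with hs
  let N : ℂ → ℂ := fun p => - ∑ i ∈ Finset.univ.erase e, (z i : ℂ) * logChange (A.γ i) p
  let M : ℂ → ℂ := fun p => if p ∈ A.E e then N p else z e * logChange (A.γ e) p
  have hMN : ∀ p, p ∈ A.E e ∨ p ∉ A.X → M p = N p := by
    intro p hp
    by_cases hpe : p ∈ A.E e
    · simp [M, hpe]
    · have := hw p (hp.resolve_left hpe)
      rw [← Finset.add_sum_erase _ _ (Finset.mem_univ e)] at this
      simp only [M, hpe, if_false, N]
      linear_combination this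
  have hMc : ContinuousOn M (A.V : Set ℂ)ᶜ := by
    intro p hpV
    refine ContinuousAt.continuousWithinAt ?_
    by_cases hpe : p ∈ A.E e
    · -- near p the other edges are absent
      have hpO := A.mem_O_of_E hpe hpV
      have hKc := (A.isCompact_K {i | i ≠ e}).isClosed
      have hpK : p ∈ (A.K {i | i ≠ e})ᶜ := by
        rintro (h | h)
        · exact hpV h
        · simp only [mem_iUnion] at h
          obtain ⟨i, hi, h⟩ := h
          exact hi (A.O_unique hpO h).symm
      have hnb := hKc.isOpen_compl.mem_nhds hpK
      have hNc : ContinuousAt N p := by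
        refine ContinuousAt.neg (tendsto_finsetSum _ fun i hi => ?_)
        refine ContinuousAt.mul continuousAt_const ((A.cont_logChange i).continuousAt ?_)
        refine Filter.mem_of_superset hnb fun q hq hqE => hq (Or.inr ?_)
        simp only [mem_iUnion]
        exact ⟨i, (Finset.mem_erase.1 hi).1, hqE⟩
      refine hNc.congr ?_
      filter_upwards [hnb] with q hq
      refine (hMN q ?_).symm
      by_cases hqe : q ∈ A.E e
      · exact Or.inl hqe
      · refine Or.inr ?_
        rintro (h | h)
        · exact hq (Or.inl h)
        · simp only [mem_iUnion] at h
          obtain ⟨i, -, h⟩ := h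
          refine hq (Or.inr ?_)
          simp only [mem_iUnion]
          exact ⟨i, fun h' => hqe (h' ▸ h), h⟩
    · have hnb := (A.isCompact_E e).isClosed.isOpen_compl.mem_nhds hpe
      have : ContinuousAt (fun p => (z e : ℂ) * logChange (A.γ e) p) p :=
        continuousAt_const.mul ((A.cont_logChange e).continuousAt hnb)
      refine this.congr ?_
      filter_upwards [hnb] with q hq
      have hq' : q ∉ A.E e := hq
      simp [M, hq']
  have hMe : ∀ p ∉ A.V, Complex.exp (M p) = ((t - p) / (s - p)) ^ (z e) := by
    intro p hpV
    have h1 : t - p ≠ 0 := fun h => hpV ((sub_eq_zero.1 h) ▸ A.t_mem e)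
    have h0 : s - p ≠ 0 := fun h => hpV ((sub_eq_zero.1 h) ▸ A.s_mem e)
    have hgoal : ((t - p) / (s - p)) ^ (z e) =
        Complex.exp (z e * (Complex.log (t - p) - Complex.log (s - p))) := by
      rw [Complex.exp_int_mul, Complex.exp_sub, Complex.exp_log h1, Complex.exp_log h0]
    rw [hgoal]
    by_cases hpe : p ∈ A.E e
    · simp only [M, hpe, if_true, N]
      have hsum := A.sum_potential z hbd (fun v => Complex.log (v - p))
      rw [← Finset.add_sum_erase _ _ (Finset.mem_univ e)] at hsum
      rw [eq_neg_of_add_eq_zero_left hsum, Complex.exp_neg, Complex.exp_neg]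
      congr 1
      refine exp_sub_sum _ _ _ _ fun i hi => A.exp_logChange' i (fun h => ?_) hpV
      exact (Finset.mem_erase.1 hi).1 (A.O_unique (A.mem_O_of_E hpe hpV) h).symm
    · simp only [M, hpe, if_false]
      rw [Complex.exp_int_mul, Complex.exp_int_mul, A.exp_logChange' e hpe hpV]
  -- small circle around t
  obtain ⟨ρ, hρ0, hρ⟩ : ∃ ρ > 0, ∀ v ∈ A.V, v ≠ t → ρ < ‖v - t‖ := by
    have hcl : IsClosed ((A.V.erase t : Finset ℂ) : Set ℂ) := (A.V.erase t).finite_toSet.isClosed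
    obtain ⟨ε, hε, hb⟩ := Metric.isOpen_iff.1 hcl.isOpen_compl t (by simp)
    refine ⟨ε / 2, by positivity, fun v hv hvt => ?_⟩
    by_contra hle
    exact hb (a := v) (mem_ball_iff_norm.2 (by linarith)) (by simp [hvt, hv])
  have hts : s - t ≠ 0 := sub_ne_zero.2 he
  have hρs : ρ < ‖s - t‖ := hρ s (A.s_mem e) he
  let c : ℝ → ℂ := fun θ => ρ * Complex.exp (θ * Complex.I)
  have hcn : ∀ θ, ‖c θ‖ = ρ := by
    intro θ; simp only [c]; rw [norm_mul, Complex.norm_exp_ofReal_mul_I]; simp [abs_of_pos hρ0]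
  have hcc : Continuous c := by fun_prop
  have hcV : ∀ θ, t + c θ ∉ A.V := by
    intro θ h
    by_cases hc : t + c θ = t
    · have h0 : c θ = 0 := by simpa using hc
      have := hcn θ; rw [h0, norm_zero] at this; exact hρ0.ne this
    · have := hρ _ h hc
      rw [add_sub_cancel_left, hcn] at this; exact lt_irrefl _ this
  have hρc : (ρ : ℂ) ≠ 0 := by exact_mod_cast hρ0.ne'
  refine circle_lemma (M := fun θ => M (t + c θ) + z e * Complex.log (1 - c θ / (s - t))) ?_ ?_
    (C := ((-ρ : ℂ) / (s - t)) ^ (z e)) (zpow_ne_zero _ (div_ne_zero (neg_ne_zero.2 hρc) hts)) ?_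
  · refine ContinuousOn.add (hMc.comp (by fun_prop) fun θ _ => hcV θ) ?_
    refine continuousOn_const.mul (ContinuousOn.clog (by fun_prop) fun θ _ => ?_)
    exact one_sub_div_mem (by rw [hcn]; exact hρs)
  · simp [c]
  · intro θ _
    have h1 := one_sub_div_ne (a := c θ) (b := s - t) (by rw [hcn]; exact hρs)
    rw [Complex.exp_add, hMe _ (hcV θ), Complex.exp_int_mul, Complex.exp_log h1, ← mul_zpow, ← mul_zpow]
    congr 1
    have h2 : s - t - c θ ≠ 0 := by
      intro h
      have h3 : s - t = c θ := sub_eq_zero.1 h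
      rw [h3, hcn] at hρs; exact lt_irrefl _ hρs
    have h4 : s - (t + c θ) = s - t - c θ := by ring
    rw [h4]
    have h5 : (1:ℂ) - c θ / (s - t) = (s - t - c θ) / (s - t) := by field_simp
    rw [h5]
    have h6 : t - (t + c θ) = - (ρ * Complex.exp (θ * Complex.I)) := by simp [c]
    rw [h6]
    field_simp

end ArcSys
end KP

namespace KP
namespace ArcSys
variable {ι : Type} (A : ArcSys ι)

theorem exists_d (i : ι) {p : ℂ} (hp : p ∉ A.X) : ∃ d : ℤ, logChange (A.γ i) p =
    (Complex.log (A.γ i 1 - p) - Complex.log (A.γ i 0 - p)) + d * (2 * Real.pi * Complex.I) :=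
  Complex.exp_eq_exp_iff_exists_int.1
    (A.exp_logChange' i (fun h => hp (A.E_subset_X i h)) (fun h => hp (A.V_subset_X h)))

theorem sum_bdZ [Fintype ι] (z : ι → ℤ) : ∑ v ∈ A.V, A.bdZ z v = 0 := by
  simp only [bdZ]
  rw [Finset.sum_comm]
  refine Finset.sum_eq_zero fun i _ => ?_
  rw [← Finset.mul_sum, Finset.sum_sub_distrib]
  simp [A.s_mem, A.t_mem]

/-- the winding function is zero everywhere if zero at test points of the bounded regions -/
theorem winding_zero [Fintype ι] (z : ι → ℤ) (hbd : ∀ v ∈ A.V, A.bdZ z v = 0)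
    {p : ℂ} (hp : p ∉ A.X)
    (h : ¬ Bornology.IsBounded (connectedComponentIn A.Xᶜ p) ∨
      ∃ q ∈ connectedComponentIn A.Xᶜ p, ∑ i, (z i : ℂ) * logChange (A.γ i) q = 0) :
    ∑ i, (z i : ℂ) * logChange (A.γ i) p = 0 := by
  set R := connectedComponentIn A.Xᶜ p with hR
  have hRX : R ⊆ A.Xᶜ := connectedComponentIn_subset _ _
  have hpR : p ∈ R := mem_connectedComponentIn hp
  set w : ℂ → ℂ := fun p => ∑ i, (z i : ℂ) * logChange (A.γ i) p with hw
  have hwc : ContinuousOn w R := by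
    refine continuousOn_finsetSum _ fun i _ => continuousOn_const.mul ?_
    exact (A.cont_logChange i).mono fun q hq hqE => hRX hq (A.E_subset_X i hqE)
  have hwe : ∀ q ∈ R, Complex.exp (w q) = Complex.exp ((fun _ => 0) q) := by
    intro q hq
    have hqX := hRX hq
    simp only [hw]
    rw [exp_sub_sum _ z _ (fun i => Complex.log (A.γ i 1 - q) - Complex.log (A.γ i 0 - q))
      (fun i _ => A.exp_logChange' i (fun h => hqX (A.E_subset_X i h)) (fun h => hqX (A.V_subset_X h)))]
    rw [A.sum_potential z hbd (fun v => Complex.log (v - q))]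
  have hconst : ∀ q ∈ R, w p = w q := by
    intro q hq
    simpa using log_sub_const isPreconnected_connectedComponentIn hwc continuousOn_const hwe hpR hq
  change w p = 0
  rcases h with h | ⟨q, hq, h⟩
  · have ht : Filter.Tendsto w (Bornology.cobounded ℂ) (nhds 0) := by
      have : Filter.Tendsto w (Bornology.cobounded ℂ) (nhds (∑ i, (z i : ℂ) * 0)) :=
        tendsto_finsetSum _ fun i _ => tendsto_const_nhds.mul (tendsto_logChange (A.cont i).continuousOn)
      simpa using this
    have hne : (Bornology.cobounded ℂ ⊓ Filter.principal R).NeBot := by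
      rw [Filter.inf_principal_neBot_iff]
      intro U hU
      by_contra hemp
      refine h ((Bornology.isBounded_def).2 (Filter.mem_of_superset hU fun x hx hxR => hemp ⟨x, hx, hxR⟩))
    have h1 : Filter.Tendsto w (Bornology.cobounded ℂ ⊓ Filter.principal R) (nhds 0) :=
      ht.mono_left inf_le_left
    have h2 : Filter.Tendsto w (Bornology.cobounded ℂ ⊓ Filter.principal R) (nhds (w p)) := by
      refine tendsto_const_nhds.congr' ?_
      filter_upwards [Filter.mem_inf_of_right (Filter.mem_principal_self R)] with q hq using hconst q hq
    exact tendsto_nhds_unique h2 h1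
  · rw [hconst q hq]; exact h

theorem card_edges_le [Fintype ι] [DecidableEq ι] (hloop : ∀ i, A.γ i 0 ≠ A.γ i 1) (hV : A.V.Nonempty)
    {B : Type} [Fintype B] (q : B → ℂ) (hq : ∀ b, q b ∉ A.X)
    (hcover : ∀ p ∉ A.X, Bornology.IsBounded (connectedComponentIn A.Xᶜ p) →
      ∃ b, q b ∈ connectedComponentIn A.Xᶜ p) :
    Fintype.card ι + 1 ≤ A.V.card + Fintype.card B := by
  classical
  obtain ⟨v0, hv0⟩ := hV
  choose d hd using fun (i : ι) (b : B) => A.exists_d i (hq b)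
  let T : (ι → ℤ) →ₗ[ℤ] (({v // v ∈ A.V.erase v0} ⊕ B) → ℤ) :=
    LinearMap.pi fun x => ∑ i, (match x with
      | Sum.inl v => (if A.γ i 1 = v.1 then 1 else 0) - (if A.γ i 0 = v.1 then 1 else 0)
      | Sum.inr b => d i b : ℤ) • LinearMap.proj i
  have hT1 : ∀ z v, T z (Sum.inl v) = A.bdZ z v.1 := by
    intro z v
    simp only [T, LinearMap.pi_apply, bdZ, LinearMap.sum_apply, LinearMap.smul_apply, LinearMap.proj_apply, smul_eq_mul]
    exact Finset.sum_congr rfl fun i _ => mul_comm _ _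
  have hT2 : ∀ z b, T z (Sum.inr b) = ∑ i, z i * d i b := by
    intro z v
    simp only [T, LinearMap.pi_apply, LinearMap.sum_apply, LinearMap.smul_apply, LinearMap.proj_apply, smul_eq_mul]
    exact Finset.sum_congr rfl fun i _ => mul_comm _ _
  have hinj : Function.Injective T := by
    rw [injective_iff_map_eq_zero]
    intro z hz
    have hbd' : ∀ v ∈ A.V.erase v0, A.bdZ z v = 0 := by
      intro v hv
      rw [← hT1 z ⟨v, hv⟩, hz]; rfl
    have hbd : ∀ v ∈ A.V, A.bdZ z v = 0 := by
      intro v hv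
      by_cases h : v = v0
      · have := A.sum_bdZ z
        rw [← Finset.add_sum_erase _ _ hv0, Finset.sum_eq_zero hbd', add_zero] at this
        rw [h, this]
      · exact hbd' v (Finset.mem_erase.2 ⟨h, hv⟩)
    have hw : ∀ p ∉ A.X, ∑ i, (z i : ℂ) * logChange (A.γ i) p = 0 := by
      intro p hp
      refine A.winding_zero z hbd hp ?_
      by_cases hb : Bornology.IsBounded (connectedComponentIn A.Xᶜ p)
      · obtain ⟨b, hb⟩ := hcover p hp hb
        refine Or.inr ⟨q b, hb, ?_⟩
        simp only [hd _ b, mul_add, Finset.sum_add_distrib]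
        rw [A.sum_potential z hbd (fun v => Complex.log (v - q b)), zero_add]
        have h2 : ∑ i, z i * d i b = 0 := by rw [← hT2, hz]; rfl
        have h3 : (∑ i, (z i : ℂ) * (d i b)) = 0 := by exact_mod_cast h2
        simp only [← mul_assoc, ← Finset.sum_mul]
        rw [h3]; simp
      · exact Or.inl hb
    funext e
    exact A.coeff_eq_zero z hbd hw e (hloop e)
  have h1 := LinearMap.finrank_le_finrank_of_injective hinj
  rw [Module.finrank_fintype_fun_eq_card, Module.finrank_fintype_fun_eq_card, Fintype.card_sum,
    Fintype.card_coe, Finset.card_erase_of_mem hv0] at h1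
  have : 0 < A.V.card := Finset.card_pos.2 ⟨v0, hv0⟩
  omega

end ArcSys
end KP

namespace KP

theorem frontier_cc_subset {M : Type*} [TopologicalSpace M] [LocallyConnectedSpace M] {X : Set M}
    (hX : IsClosed X) (p : M) : frontier (connectedComponentIn Xᶜ p) ⊆ X := by
  intro x hx
  by_contra hxX
  have ho : IsOpen (connectedComponentIn Xᶜ x) := hX.isOpen_compl.connectedComponentIn
  have hmem : x ∈ connectedComponentIn Xᶜ x := mem_connectedComponentIn hxX
  obtain ⟨y, hy1, hy2⟩ := mem_closure_iff.1 hx.1 _ ho hmem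
  have h1 := connectedComponentIn_eq hy1
  have h2 := connectedComponentIn_eq hy2
  have ho' : IsOpen (connectedComponentIn Xᶜ p) := hX.isOpen_compl.connectedComponentIn
  refine hx.2 ?_
  rw [ho'.interior_eq, h2, ← h1]; exact hmem

theorem preconnected_union_of_frontier {M : Type*} [TopologicalSpace M] {R C : Set M}
    (hR : IsPreconnected R) (hC : IsPreconnected C) {x : M} (hx : x ∈ closure R) (hxC : x ∈ C) :
    IsPreconnected (R ∪ C) := by
  have h1 : IsPreconnected (insert x R) :=
    hR.subset_closure (subset_insert _ _) (insert_subset hx subset_closure)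
  have h2 := h1.union x (mem_insert _ _) hxC hC
  rwa [insert_union, insert_eq_of_mem (mem_union_right R hxC)] at h2

/-- incidence of an edge at a vertex, mod 2 -/
def inc {ι α : Type*} [DecidableEq α] (s t : ι → α) (i : ι) (v : α) : ZMod 2 :=
  (if s i = v then 1 else 0) + (if t i = v then 1 else 0)

/-- mod 2 boundary -/
def bd {ι α : Type*} [DecidableEq α] (s t : ι → α) (Z : Finset ι) (v : α) : ZMod 2 :=
  ∑ i ∈ Z, inc s t i v

theorem bd_toggle {ι α : Type*} [DecidableEq ι] [DecidableEq α] (s t : ι → α) {S T : Finset ι} (hT : T ⊆ S) {i : ι}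
    (hi : i ∈ S) : ∃ T' ⊆ S, ∀ v, bd s t T' v = bd s t T v + inc s t i v := by
  by_cases h : i ∈ T
  · refine ⟨T.erase i, (Finset.erase_subset _ _).trans hT, fun v => ?_⟩
    rw [bd, bd, ← Finset.add_sum_erase _ _ h, add_comm, ← add_assoc, CharTwo.add_self_eq_zero, zero_add]
  · refine ⟨insert i T, Finset.insert_subset hi hT, fun v => ?_⟩
    rw [bd, bd, Finset.sum_insert h, add_comm]

namespace ArcSys
variable {ι : Type} (A : ArcSys ι)

theorem injOn_edge {e : ι} (he : A.γ e 0 ≠ A.γ e 1) : InjOn (A.γ e) (Icc 0 1) := by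
  have key : ∀ u ∈ Icc (0:ℝ) 1, u = 0 ∨ u = 1 ∨ u ∈ Ioo (0:ℝ) 1 := by
    rintro u ⟨h0, h1⟩
    rcases h0.eq_or_lt with h | h
    · exact Or.inl h.symm
    · rcases h1.eq_or_lt with h' | h'
      · exact Or.inr (Or.inl h')
      · exact Or.inr (Or.inr ⟨h, h'⟩)
  have h0 := A.s_mem e
  have h1 := A.t_mem e
  intro u hu v hv huv
  rcases key u hu with rfl | rfl | hu' <;> rcases key v hv with rfl | rfl | hv'
  · rfl
  · exact absurd huv he
  · exact absurd (huv ▸ h0) (A.int_notMem e v hv')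
  · exact absurd huv.symm he
  · rfl
  · exact absurd (huv ▸ h1) (A.int_notMem e v hv')
  · exact absurd (huv ▸ h0) (A.int_notMem e u hu')
  · exact absurd (huv ▸ h1) (A.int_notMem e u hu')
  · exact (A.inj e e u hu' v hv' huv).2

theorem hasLog_edge {e : ι} (he : A.γ e 0 ≠ A.γ e 1) {f : ℂ → ℂ} (hc : ContinuousOn f (A.E e))
    (hf : ∀ z ∈ A.E e, f z ≠ 0) : HasLog (A.E e) f :=
  hasLog_arc zero_le_one (A.cont e).continuousOn (A.injOn_edge he) hc hf

theorem E_inter_E {i j : ι} (hij : i ≠ j) {p : ℂ} (h : p ∈ A.E i) (h' : p ∈ A.E j) : p ∈ A.V := by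
  by_contra hV
  exact hij (A.O_unique (A.mem_O_of_E h hV) h')

theorem E_inter_V {i : ι} {p : ℂ} (h : p ∈ A.E i) (h' : p ∈ A.V) : p = A.γ i 0 ∨ p = A.γ i 1 := by
  rw [E_eq] at h
  rcases h with h | h
  · exact absurd h' (A.O_notMem_V h)
  · exact h

theorem s_mem_E (i : ι) : A.γ i 0 ∈ A.E i := ⟨0, by simp, rfl⟩
theorem t_mem_E (i : ι) : A.γ i 1 ∈ A.E i := ⟨1, by simp, rfl⟩

/-- Forest lemma -/
theorem forest [Finite ι] [DecidableEq ι] (S : Finset ι)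
    (hS : ∀ Z ⊆ S, Z.Nonempty → ∃ v, bd (fun i => A.γ i 0) (fun i => A.γ i 1) Z v ≠ 0)
    {f : ℂ → ℂ} (hc : ContinuousOn f (A.K S)) (hf : ∀ z ∈ A.K S, f z ≠ 0) : HasLog (A.K S) f := by
  classical
  induction S using Finset.induction_on with
  | empty =>
    refine ⟨fun z => Complex.log (f z), ?_, fun z hz => Complex.exp_log (hf z hz)⟩
    have : (A.K (∅ : Finset ι)).Finite := by simp [K]
    exact this.continuousOn _
  | insert e S heS ih =>
    have hsub : A.K S ⊆ A.K (insert e S : Finset ι) := by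
      refine union_subset_union_right _ (biUnion_subset_biUnion_left ?_)
      simp
    have hEsub : A.E e ⊆ A.K (insert e S : Finset ι) := by
      intro z hz; refine Or.inr ?_; simp only [mem_iUnion]; exact ⟨e, by simp, hz⟩
    have ih := ih (fun Z hZ => hS Z (hZ.trans (Finset.subset_insert _ _))) (hc.mono hsub)
      (fun z hz => hf z (hsub hz))
    set a := A.γ e 0 with ha
    set b := A.γ e 1 with hb
    let P : ℂ → Prop := fun v => ∃ T ⊆ S, ∀ w, bd (fun i => A.γ i 0) (fun i => A.γ i 1) T w =
      (if a = w then 1 else 0) + (if v = w then 1 else 0)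
    have hPa : P a := ⟨∅, by simp, fun w => by simp [bd, CharTwo.add_self_eq_zero]⟩
    have hPb : ¬ P b := by
      rintro ⟨T, hT, h⟩
      obtain ⟨v, hv⟩ := hS (insert e T) (Finset.insert_subset_insert _ hT) (Finset.insert_nonempty _ _)
      apply hv
      rw [bd, Finset.sum_insert (fun h => heS (hT h))]
      change inc _ _ e v + bd _ _ T v = 0
      rw [h v, inc]; exact CharTwo.add_self_eq_zero _
    have hP : ∀ i ∈ S, P (A.γ i 0) ↔ P (A.γ i 1) := by
      intro i hi
      constructor
      · rintro ⟨T, hT, h⟩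
        obtain ⟨T', hT', h'⟩ := bd_toggle (fun i => A.γ i 0) (fun i => A.γ i 1) hT hi
        refine ⟨T', hT', fun w => ?_⟩
        rw [h' w, h w, inc, add_assoc, ← add_assoc (if A.γ i 0 = w then (1 : ZMod 2) else 0),
          CharTwo.add_self_eq_zero, zero_add]
      · rintro ⟨T, hT, h⟩
        obtain ⟨T', hT', h'⟩ := bd_toggle (fun i => A.γ i 0) (fun i => A.γ i 1) hT hi
        refine ⟨T', hT', fun w => ?_⟩
        rw [h' w, h w, inc, add_comm (if A.γ i 0 = w then (1 : ZMod 2) else 0), add_assoc,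
          ← add_assoc (if A.γ i 1 = w then (1 : ZMod 2) else 0),
          CharTwo.add_self_eq_zero, zero_add]
    have hab : a ≠ b := fun h => hPb (h ▸ hPa)
    let K1 : Set ℂ := {v | v ∈ A.V ∧ P v} ∪ ⋃ i ∈ {i | i ∈ S ∧ P (A.γ i 0)}, A.E i
    let K2 : Set ℂ := {v | v ∈ A.V ∧ ¬ P v} ∪ ⋃ i ∈ {i | i ∈ S ∧ ¬ P (A.γ i 0)}, A.E i
    have hK1 : ∀ z ∈ K1, z ∈ A.V → P z := by
      rintro z (hz | hz) hV
      · exact hz.2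
      · simp only [mem_iUnion] at hz
        obtain ⟨i, ⟨hi, hPi⟩, hz⟩ := hz
        rcases A.E_inter_V hz hV with rfl | rfl
        · exact hPi
        · exact (hP i hi).1 hPi
    have hK2 : ∀ z ∈ K2, z ∈ A.V → ¬ P z := by
      rintro z (hz | hz) hV
      · exact hz.2
      · simp only [mem_iUnion] at hz
        obtain ⟨i, ⟨hi, hPi⟩, hz⟩ := hz
        rcases A.E_inter_V hz hV with rfl | rfl
        · exact hPi
        · exact fun h => hPi ((hP i hi).2 h)
    have hdisj : ∀ z ∈ K1, z ∉ K2 := by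
      intro z h1 h2
      have hV : z ∉ A.V := fun hV => hK2 z h2 hV (hK1 z h1 hV)
      rcases h1 with h1 | h1
      · exact hV h1.1
      rcases h2 with h2 | h2
      · exact hV h2.1
      simp only [mem_iUnion] at h1 h2
      obtain ⟨i, ⟨hi, hPi⟩, h1⟩ := h1
      obtain ⟨j, ⟨hj, hPj⟩, h2⟩ := h2
      have : i = j := A.O_unique (A.mem_O_of_E h1 hV) h2
      exact hPj (this ▸ hPi)
    have hED : ∀ z ∈ A.E e, z ∈ K1 ∪ K2 → z ∈ A.V := by
      intro z hz h
      by_contra hV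
      have : ∃ i ∈ S, z ∈ A.E i := by
        rcases h with (h | h) | (h | h)
        · exact absurd h.1 hV
        · simp only [mem_iUnion] at h; obtain ⟨i, hi, h⟩ := h; exact ⟨i, hi.1, h⟩
        · exact absurd h.1 hV
        · simp only [mem_iUnion] at h; obtain ⟨i, hi, h⟩ := h; exact ⟨i, hi.1, h⟩
      obtain ⟨i, hi, h⟩ := this
      exact heS ((A.O_unique (A.mem_O_of_E hz hV) h) ▸ hi)
    have hcl1 : IsClosed K1 := (A.V.finite_toSet.subset (fun v hv => hv.1)).isClosed.union
      ((toFinite _).isClosed_biUnion fun i _ => (A.isCompact_E i).isClosed)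
    have hcl2 : IsClosed K2 := (A.V.finite_toSet.subset (fun v hv => hv.1)).isClosed.union
      ((toFinite _).isClosed_biUnion fun i _ => (A.isCompact_E i).isClosed)
    have hclE : IsClosed (A.E e) := (A.isCompact_E e).isClosed
    have hs1 : K1 ⊆ A.K S := by
      rintro z (h | h)
      · exact Or.inl h.1
      · refine Or.inr ?_
        simp only [mem_iUnion] at h ⊢; obtain ⟨i, hi, h⟩ := h; exact ⟨i, hi.1, h⟩
    have hs2 : K2 ⊆ A.K S := by
      rintro z (h | h)
      · exact Or.inl h.1
      · refine Or.inr ?_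
        simp only [mem_iUnion] at h ⊢; obtain ⟨i, hi, h⟩ := h; exact ⟨i, hi.1, h⟩
    have hE := A.hasLog_edge hab (hc.mono hEsub) (fun z hz => hf z (hEsub hz))
    have hG := (ih.mono hs1).union_subsingleton hcl1 hclE hE (by
      intro z hz z' hz'
      have : ∀ z ∈ K1 ∩ A.E e, z = a := by
        intro z hz
        have hV := hED z hz.2 (Or.inl hz.1)
        rcases A.E_inter_V hz.2 hV with h | h
        · exact h
        · exact absurd (hK1 z hz.1 hV) (h ▸ hPb)
      rw [this z hz, this z' hz'])
    have hG2 := hG.union_subsingleton (hcl1.union hclE) hcl2 (ih.mono hs2) (by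
      have : ∀ z ∈ (K1 ∪ A.E e) ∩ K2, z = b := by
        rintro z ⟨hz1 | hz1, hz2⟩
        · exact absurd hz2 (hdisj z hz1)
        have hV := hED z hz1 (Or.inr hz2)
        rcases A.E_inter_V hz1 hV with h | h
        · exact absurd (h ▸ hPa) (hK2 z hz2 hV)
        · exact h
      intro z hz z' hz'
      rw [this z hz, this z' hz'])
    refine hG2.mono ?_
    rintro z (hz | hz)
    · by_cases hPz : P z
      · exact Or.inl (Or.inl (Or.inl ⟨hz, hPz⟩))
      · exact Or.inr (Or.inl ⟨hz, hPz⟩)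
    · simp only [mem_iUnion] at hz
      obtain ⟨i, hi, hz⟩ := hz
      rcases Finset.mem_insert.1 (Finset.mem_coe.1 hi) with rfl | hi
      · exact Or.inl (Or.inr hz)
      · by_cases hPz : P (A.γ i 0)
        · refine Or.inl (Or.inl (Or.inr ?_)); simp only [mem_iUnion]; exact ⟨i, ⟨hi, hPz⟩, hz⟩
        · refine Or.inr (Or.inr ?_); simp only [mem_iUnion]; exact ⟨i, ⟨hi, hPz⟩, hz⟩

/-- (c) -/
theorem region_edges [Finite ι] [DecidableEq ι] {r : ℂ} (hr : r ∉ A.X)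
    (hb : Bornology.IsBounded (connectedComponentIn A.Xᶜ r)) (S : Finset ι)
    (hSR : ∀ i, (A.O i ∩ frontier (connectedComponentIn A.Xᶜ r)).Nonempty → i ∈ S)
    (hS : ∀ Z ⊆ S, Z.Nonempty → ∃ v, bd (fun i => A.γ i 0) (fun i => A.γ i 1) Z v ≠ 0) : False := by
  classical
  have hXc := A.isCompact_X.isClosed
  set R := connectedComponentIn A.Xᶜ r
  have hKX : A.K S ⊆ A.X := by
    refine union_subset_union_right _ (biUnion_subset_biUnion_left (subset_univ _))
  have hne : ∀ z ∈ A.K S, z - r ≠ 0 := fun z hz h => hr ((sub_eq_zero.1 h) ▸ hKX hz)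
  have hlog : HasLog (A.K S) (fun z => z - r) := A.forest S hS (by fun_prop) hne
  have hfr : frontier R ⊆ A.K S := by
    intro z hz
    rcases frontier_cc_subset hXc r hz with h | h
    · exact Or.inl h
    · by_cases hV : z ∈ A.V
      · exact Or.inl hV
      · simp only [mem_iUnion] at h
        obtain ⟨i, -, h⟩ := h
        refine Or.inr ?_
        simp only [mem_iUnion]
        exact ⟨i, hSR i ⟨z, A.mem_O_of_E h hV, hz⟩, h⟩
  have := lemmaB (Finset.univ : Finset Unit) (fun _ => r) (fun _ => 1) (A.isCompact_K S).isClosed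
    (hXc.isOpen_compl.connectedComponentIn) hb hfr (fun _ _ h => hr (hKX h))
    (by simpa using hlog)
  have hrR : r ∈ R := mem_connectedComponentIn hr
  simp [R, hrR] at this

end ArcSys
end KP

namespace KP
namespace ArcSys
variable {ι : Type} (A : ArcSys ι)

/-- ratio of two points in regions adjacent to the open edge `e` -/
theorem hasLog_ratio [Finite ι] {e : ι} {r q : ℂ} (hr : r ∉ A.X) (hq : q ∈ A.O e)
    (hre : (A.O e ∩ frontier (connectedComponentIn A.Xᶜ r)).Nonempty) :
    HasLog (A.K {i | i ≠ e}) (fun z => (z - r) / (z - q)) := by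
  have hKX : A.K {i | i ≠ e} ⊆ A.X :=
    union_subset_union_right _ (biUnion_subset_biUnion_left (subset_univ _))
  obtain ⟨x, hxO, hx⟩ := hre
  have hO : IsPreconnected (A.O e) := isPreconnected_Ioo.image _ (A.cont e).continuousOn
  have hC := preconnected_union_of_frontier (R := connectedComponentIn A.Xᶜ r)
    isPreconnected_connectedComponentIn hO hx.1 hxO
  refine lemmaE (A.isCompact_K _).isClosed hC ?_ (Or.inl (mem_connectedComponentIn hr)) (Or.inr hq)
  rw [Set.disjoint_left]
  rintro y (hy | hy) hyK
  · exact connectedComponentIn_subset _ _ hy (hKX hyK)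
  · rcases hyK with h | h
    · exact A.O_notMem_V hy h
    · simp only [mem_iUnion] at h
      obtain ⟨i, hi, h⟩ := h
      exact hi (A.O_unique hy h).symm

/-- (b): an open edge is adjacent to at most two bounded regions -/
theorem edge_regions [Finite ι] {e : ι} (he : A.γ e 0 ≠ A.γ e 1) (r : Fin 3 → ℂ) (hr : ∀ k, r k ∉ A.X)
    (hb : ∀ k, Bornology.IsBounded (connectedComponentIn A.Xᶜ (r k)))
    (hdist : ∀ k l, r k ∈ connectedComponentIn A.Xᶜ (r l) → k = l)
    (hre : ∀ k, (A.O e ∩ frontier (connectedComponentIn A.Xᶜ (r k))).Nonempty) : False := by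
  classical
  have hXc := A.isCompact_X.isClosed
  set Y := A.K {i | i ≠ e} with hY
  have hYX : Y ⊆ A.X := union_subset_union_right _ (biUnion_subset_biUnion_left (subset_univ _))
  have hYc : IsClosed Y := (A.isCompact_K _).isClosed
  have hDc : IsClosed (A.E e) := (A.isCompact_E e).isClosed
  have hXYD : A.X ⊆ Y ∪ A.E e := by
    rintro z (h | h)
    · exact Or.inl (Or.inl h)
    · simp only [mem_iUnion] at h
      obtain ⟨i, -, h⟩ := h
      by_cases hi : i = e
      · exact Or.inr (hi ▸ h)
      · refine Or.inl (Or.inr ?_); simp only [mem_iUnion]; exact ⟨i, hi, h⟩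
  have h_int : ∀ z ∈ Y ∩ A.E e, z = A.γ e 0 ∨ z = A.γ e 1 := by
    rintro z ⟨hz, hzE⟩
    refine A.E_inter_V hzE ?_
    rcases hz with h | h
    · exact h
    · simp only [mem_iUnion] at h
      obtain ⟨i, hi, h⟩ := h
      exact A.E_inter_E hi h hzE
  have hne : ∀ k, ∀ z ∈ A.X, z - r k ≠ 0 := fun k z hz h => hr k ((sub_eq_zero.1 h) ▸ hz)
  obtain ⟨q, hq⟩ : (A.O e).Nonempty := ⟨_, 1/2, by norm_num, rfl⟩
  have hqY : ∀ z ∈ Y, z - q ≠ 0 := by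
    intro z hz h
    have h' : z = q := sub_eq_zero.1 h
    rcases hz with h | h
    · exact A.O_notMem_V hq (h' ▸ h)
    · simp only [mem_iUnion] at h
      obtain ⟨i, hi, h⟩ := h
      exact hi (A.O_unique hq (h' ▸ h)).symm
  have hφ : ∀ k : Fin 3, ∃ φ : ℂ → ℂ, ContinuousOn φ Y ∧
      ∀ z ∈ Y, Complex.exp (φ z) = (z - r k) / (z - r 2) := by
    intro k
    have h1 := A.hasLog_ratio (hr k) hq (hre k)
    have h2 := A.hasLog_ratio (hr 2) hq (hre 2)
    refine (h1.mul h2.inv).congr fun z hz => ?_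
    have := hqY z hz
    have := hne 2 z (hYX hz)
    field_simp
  have hψ : ∀ k : Fin 3, ∃ ψ : ℂ → ℂ, ContinuousOn ψ (A.E e) ∧
      ∀ z ∈ A.E e, Complex.exp (ψ z) = (z - r k) / (z - r 2) := by
    intro k
    refine A.hasLog_edge he (f := fun z => (z - r k) / (z - r 2)) ?_ ?_
    · exact ContinuousOn.div (by fun_prop) (by fun_prop) fun z hz => hne 2 z (A.E_subset_X e hz)
    · intro z hz
      exact div_ne_zero (hne k z (A.E_subset_X e hz)) (hne 2 z (A.E_subset_X e hz))
  choose φ hφc hφe using hφ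
  choose ψ hψc hψe using hψ
  have hsY : A.γ e 0 ∈ Y := Or.inl (A.s_mem e)
  have htY : A.γ e 1 ∈ Y := Or.inl (A.t_mem e)
  have hm : ∀ k, ∀ z ∈ Y ∩ A.E e, ∃ m : ℤ, φ k z = ψ k z + m * (2 * Real.pi * Complex.I) := by
    intro k z hz
    exact Complex.exp_eq_exp_iff_exists_int.1 (by rw [hφe k z hz.1, hψe k z hz.2])
  choose ms hms using fun k => hm k _ ⟨hsY, A.s_mem_E e⟩
  choose mt hmt using fun k => hm k _ ⟨htY, A.t_mem_E e⟩
  obtain ⟨n0, n1, hn, hn0⟩ : ∃ n0 n1 : ℤ, n0 * (ms 0 - mt 0) + n1 * (ms 1 - mt 1) = 0 ∧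
      (n0 ≠ 0 ∨ n1 ≠ 0) := by
    by_cases h : ms 0 - mt 0 = 0
    · exact ⟨1, 0, by simp [h], by simp⟩
    · exact ⟨-(ms 1 - mt 1), ms 0 - mt 0, by ring, Or.inr h⟩
  have hglue := glue_logs hYc hDc (g₁ := fun z => n0 * φ 0 z + n1 * φ 1 z)
    (g₂ := fun z => n0 * ψ 0 z + n1 * ψ 1 z)
    (f := fun z => ((z - r 0) / (z - r 2)) ^ n0 * ((z - r 1) / (z - r 2)) ^ n1)
    (κ := (n0 * ms 0 + n1 * ms 1 : ℤ) * (2 * Real.pi * Complex.I))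
    ((continuousOn_const.mul (hφc 0)).add (continuousOn_const.mul (hφc 1)))
    ((continuousOn_const.mul (hψc 0)).add (continuousOn_const.mul (hψc 1)))
    (fun z hz => by rw [Complex.exp_add, Complex.exp_int_mul, Complex.exp_int_mul, hφe 0 z hz, hφe 1 z hz])
    (fun z hz => by rw [Complex.exp_add, Complex.exp_int_mul, Complex.exp_int_mul, hψe 0 z hz, hψe 1 z hz])
    (by
      intro z hz
      rcases h_int z hz with rfl | rfl
      · rw [hms 0, hms 1]; push_cast; ring
      · have hn' : (n0 * ms 0 + n1 * ms 1 : ℤ) = n0 * mt 0 + n1 * mt 1 := by linarith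
        rw [hmt 0, hmt 1, hn']; push_cast; ring)
  let n : Fin 3 → ℤ := ![n0, n1, -n0 - n1]
  have hlog : HasLog A.X (fun z => ∏ k ∈ Finset.univ, (z - r k) ^ (n k)) := by
    refine (hglue.mono hXYD).congr fun z hz => ?_
    have h0 := hne 0 z hz
    have h1 := hne 1 z hz
    have h2 := hne 2 z hz
    simp only [Fin.prod_univ_three, n, Matrix.cons_val_zero, Matrix.cons_val_one, Matrix.cons_val_two,
      Matrix.tail_cons, Matrix.head_cons, div_zpow]
    rw [zpow_sub₀ h2, zpow_neg]
    field_simp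
  have hB : ∀ k, n k = 0 := by
    intro k
    have := lemmaB Finset.univ r n hXc (hXc.isOpen_compl.connectedComponentIn) (hb k)
      (frontier_cc_subset hXc _) (fun l _ => hr l) hlog
    have hfil : (Finset.univ.filter fun l => r l ∈ connectedComponentIn A.Xᶜ (r k)) = {k} := by
      ext l; simp only [Finset.mem_filter, Finset.mem_univ, true_and, Finset.mem_singleton]
      constructor
      · exact hdist l k
      · rintro rfl; exact mem_connectedComponentIn (hr l)
    rw [hfil, Finset.sum_singleton] at this
    exact this
  rcases hn0 with h | h
  · exact h (hB 0)
  · exact h (hB 1)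

/-- The planar lemma. -/
theorem planar_lemma [Fintype ι] [DecidableEq ι] (hV : A.V.Nonempty)
    (hcard : 2 * A.V.card ≤ Fintype.card ι + 1) :
    ∃ Z : Finset ι, Z.Nonempty ∧ Z.card ≤ 3 ∧ ∀ v, bd (fun i => A.γ i 0) (fun i => A.γ i 1) Z v = 0 := by
  classical
  by_contra hcon
  have hcon' : ∀ Z : Finset ι, Z.Nonempty → Z.card ≤ 3 →
      ∃ v, bd (fun i => A.γ i 0) (fun i => A.γ i 1) Z v ≠ 0 := by
    intro Z h1 h2
    by_contra h3
    simp only [not_exists, not_not] at h3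
    exact hcon ⟨Z, h1, h2, h3⟩
  have hloop : ∀ i, A.γ i 0 ≠ A.γ i 1 := by
    intro i h
    obtain ⟨v, hv⟩ := hcon' {i} (by simp) (by simp)
    apply hv
    simp [bd, inc, h, CharTwo.add_self_eq_zero]
  -- any finite family of points in distinct bounded regions
  have hcount : ∀ B : Finset ℂ, (∀ r ∈ B, r ∉ A.X) →
      (∀ r ∈ B, Bornology.IsBounded (connectedComponentIn A.Xᶜ r)) →
      (∀ r ∈ B, ∀ r' ∈ B, r ∈ connectedComponentIn A.Xᶜ r' → r = r') →
      4 * B.card ≤ 2 * Fintype.card ι := by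
    intro B h1 h2 h3
    have := Finset.sum_card_bipartiteAbove_eq_sum_card_bipartiteBelow (s := B)
      (t := (Finset.univ : Finset ι))
      (fun r i => (A.O i ∩ frontier (connectedComponentIn A.Xᶜ r)).Nonempty)
    have hl : B.card * 4 ≤ ∑ r ∈ B, (Finset.bipartiteAbove
        (fun r i => (A.O i ∩ frontier (connectedComponentIn A.Xᶜ r)).Nonempty) Finset.univ r).card := by
      rw [← smul_eq_mul]
      refine Finset.card_nsmul_le_sum _ _ _ fun r hr => ?_
      by_contra hlt
      refine A.region_edges (h1 r hr) (h2 r hr) (fun i hi => ?_) (fun Z hZ hZn => ?_)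
        (S := Finset.bipartiteAbove
        (fun r i => (A.O i ∩ frontier (connectedComponentIn A.Xᶜ r)).Nonempty) Finset.univ r)
      · simp [Finset.mem_bipartiteAbove, hi]
      · refine hcon' Z hZn ?_
        have := Finset.card_le_card hZ
        omega
    have hr : ∑ i ∈ (Finset.univ : Finset ι), (Finset.bipartiteBelow
        (fun r i => (A.O i ∩ frontier (connectedComponentIn A.Xᶜ r)).Nonempty) B i).card ≤
        Fintype.card ι * 2 := by
      rw [← Finset.card_univ, ← smul_eq_mul]
      refine Finset.sum_le_card_nsmul _ _ _ fun i _ => ?_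
      by_contra hlt
      obtain ⟨a, b, c, ha, hb, hc, hab, hac, hbc⟩ := Finset.two_lt_card_iff.1 (not_le.1 hlt)
      rw [Finset.mem_bipartiteBelow] at ha hb hc
      have hmem : ∀ k : Fin 3, ![a, b, c] k ∈ B := by
        intro k; fin_cases k <;> simp [ha.1, hb.1, hc.1]
      have hinj : Function.Injective ![a, b, c] := by
        intro k l hkl
        fin_cases k <;> fin_cases l <;> simp_all
      refine A.edge_regions (hloop i) ![a, b, c] (fun k => h1 _ (hmem k)) (fun k => h2 _ (hmem k))
        (fun k l hkl => hinj (h3 _ (hmem k) _ (hmem l) hkl)) ?_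
      intro k; fin_cases k
      · exact ha.2
      · exact hb.2
      · exact hc.2
    omega
  -- a maximal family
  obtain ⟨B, ⟨h1, h2, h3⟩, hmax⟩ : ∃ B : Finset ℂ, ((∀ r ∈ B, r ∉ A.X) ∧
      (∀ r ∈ B, Bornology.IsBounded (connectedComponentIn A.Xᶜ r)) ∧
      (∀ r ∈ B, ∀ r' ∈ B, r ∈ connectedComponentIn A.Xᶜ r' → r = r')) ∧
      ∀ p ∉ A.X, Bornology.IsBounded (connectedComponentIn A.Xᶜ p) →
      ∃ b ∈ B, b ∈ connectedComponentIn A.Xᶜ p := by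
    let Q : ℕ → Prop := fun n => ∃ B : Finset ℂ, ((∀ r ∈ B, r ∉ A.X) ∧
      (∀ r ∈ B, Bornology.IsBounded (connectedComponentIn A.Xᶜ r)) ∧
      (∀ r ∈ B, ∀ r' ∈ B, r ∈ connectedComponentIn A.Xᶜ r' → r = r')) ∧ B.card = n
    have hQ0 : Q 0 := ⟨∅, by simp, by simp⟩
    have hQb : ∀ n, Q n → n ≤ Fintype.card ι := by
      rintro n ⟨B, ⟨h1, h2, h3⟩, rfl⟩
      have := hcount B h1 h2 h3
      omega
    obtain ⟨B, hB, hBc⟩ := Nat.findGreatest_spec (P := Q) (Nat.zero_le (Fintype.card ι)) hQ0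
    refine ⟨B, hB, fun p hp hpb => ?_⟩
    by_contra hnone
    simp only [not_exists, not_and] at hnone
    have hpB : p ∉ B := fun h => hnone p h (mem_connectedComponentIn hp)
    have hQ : Q (B.card + 1) := by
      refine ⟨insert p B, ⟨?_, ?_, ?_⟩, Finset.card_insert_of_notMem hpB⟩
      · intro r hr
        rcases Finset.mem_insert.1 hr with rfl | hr
        · exact hp
        · exact hB.1 r hr
      · intro r hr
        rcases Finset.mem_insert.1 hr with rfl | hr
        · exact hpb
        · exact hB.2.1 r hr
      · intro r hr r' hr' h
        rcases Finset.mem_insert.1 hr with h4 | h4 <;> rcases Finset.mem_insert.1 hr' with h5 | h5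
        · rw [h4, h5]
        · refine absurd ?_ (hnone r' h5)
          rw [← h4, ← connectedComponentIn_eq h]; exact mem_connectedComponentIn (hB.1 r' h5)
        · exact absurd (h5 ▸ h) (hnone r h4)
        · exact hB.2.2 r h4 r' h5 h
    have := Nat.le_findGreatest (hQb _ hQ) hQ
    omega
  have hc := hcount B h1 h2 h3
  have := A.card_edges_le hloop hV (fun b : B => (b : ℂ)) (fun b => h1 b b.2) (by
    intro p hp hpb
    obtain ⟨b, hb, h⟩ := hmax p hp hpb
    exact ⟨⟨b, hb⟩, h⟩)
  rw [Fintype.card_coe] at this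
  omega

end ArcSys
end KP

namespace KP
section comb
variable {ι α : Type} [Fintype ι] [DecidableEq ι] [DecidableEq α] (s t : ι → α)

/-- the vertices of a set of edges -/
def vs (K : Finset ι) : Finset α := K.image s ∪ K.image t

/-- degree of a vertex in a set of edges -/
def degN (K : Finset ι) (v : α) : ℕ :=
  ∑ i ∈ K, ((if s i = v then 1 else 0) + (if t i = v then 1 else 0))

theorem mem_vs {K : Finset ι} {v : α} : v ∈ vs s t K ↔ ∃ i ∈ K, s i = v ∨ t i = v := by
  simp only [vs, Finset.mem_union, Finset.mem_image]
  constructor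
  · rintro (⟨i, hi, h⟩ | ⟨i, hi, h⟩)
    · exact ⟨i, hi, Or.inl h⟩
    · exact ⟨i, hi, Or.inr h⟩
  · rintro ⟨i, hi, h | h⟩
    · exact Or.inl ⟨i, hi, h⟩
    · exact Or.inr ⟨i, hi, h⟩

theorem vs_mono {K L : Finset ι} (h : K ⊆ L) : vs s t K ⊆ vs s t L := by
  intro v hv
  rw [mem_vs] at hv ⊢
  obtain ⟨i, hi, h'⟩ := hv
  exact ⟨i, h hi, h'⟩

theorem vs_nonempty {K : Finset ι} (h : K.Nonempty) : (vs s t K).Nonempty := by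
  obtain ⟨i, hi⟩ := h
  exact ⟨s i, (mem_vs s t).2 ⟨i, hi, Or.inl rfl⟩⟩

theorem degN_pos {K : Finset ι} {v : α} : 0 < degN s t K v ↔ v ∈ vs s t K := by
  rw [mem_vs, degN, Finset.sum_pos_iff]
  refine exists_congr fun i => and_congr_right fun _ => ?_
  by_cases h1 : s i = v <;> by_cases h2 : t i = v <;> simp [h1, h2]

theorem bd_eq_cast (K : Finset ι) (v : α) : bd s t K v = (degN s t K v : ZMod 2) := by
  simp [bd, degN, inc]

theorem sum_degN (K : Finset ι) {W : Finset α} (h : vs s t K ⊆ W) :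
    ∑ v ∈ W, degN s t K v = 2 * K.card := by
  simp only [degN]
  rw [Finset.sum_comm, mul_comm, ← smul_eq_mul, ← Finset.sum_const]
  refine Finset.sum_congr rfl fun i hi => ?_
  have h1 : s i ∈ W := h ((mem_vs s t).2 ⟨i, hi, Or.inl rfl⟩)
  have h2 : t i ∈ W := h ((mem_vs s t).2 ⟨i, hi, Or.inr rfl⟩)
  rw [Finset.sum_add_distrib]
  simp [h1, h2]

theorem degN_add_compl (K : Finset ι) (v : α) :
    degN s t K v + degN s t Kᶜ v = degN s t Finset.univ v :=
  Finset.sum_add_sum_compl K _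

theorem card_vs_le {Z : Finset ι} (hZ : ∀ v, bd s t Z v = 0) : (vs s t Z).card ≤ Z.card := by
  have h1 := sum_degN s t Z (W := vs s t Z) le_rfl
  have h2 : (vs s t Z).card • 2 ≤ ∑ v ∈ vs s t Z, degN s t Z v := by
    refine Finset.card_nsmul_le_sum _ _ _ fun v hv => ?_
    have h3 := (degN_pos s t).2 hv
    have h4 := hZ v
    rw [bd_eq_cast, ZMod.natCast_eq_zero_iff] at h4
    omega
  rw [smul_eq_mul] at h2
  omega

/-- connectedness of an edge set -/
def Conn (A : Finset ι) : Prop :=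
  ∀ K ⊆ A, K.Nonempty → (A \ K).Nonempty → (vs s t K ∩ vs s t (A \ K)).Nonempty

theorem comb_step [Nonempty ι] (hdeg : ∀ v ∈ vs s t Finset.univ, degN s t Finset.univ v = 4)
    (hconn : Conn s t Finset.univ)
    (hPL : ∀ (S : Finset ι) (W : Finset α), W.Nonempty → vs s t S ⊆ W → 2 * W.card ≤ S.card + 1 →
      ∃ Z ⊆ S, Z.Nonempty ∧ Z.card ≤ 3 ∧ ∀ v, bd s t Z v = 0) :
    ∃ Z : Finset ι, Z.Nonempty ∧ (∀ v, bd s t Z v = 0) ∧ (vs s t Z).card ≤ 3 ∧ Conn s t Zᶜ := by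
  classical
  have hconn' : ∀ K : Finset ι, K.Nonempty → Kᶜ.Nonempty → (vs s t K ∩ vs s t Kᶜ).Nonempty := by
    intro K h1 h2
    have := hconn K (Finset.subset_univ _) h1
    rw [← Finset.compl_eq_univ_sdiff] at this
    exact this h2
  let Cut : Finset ι → Prop := fun D => D.Nonempty ∧ Dᶜ.Nonempty ∧ (vs s t D ∩ vs s t Dᶜ).card = 1
  have hCutc : ∀ D, Cut D → Cut Dᶜ := by
    rintro D ⟨h1, h2, h3⟩
    refine ⟨h2, by simpa using h1, ?_⟩
    rw [compl_compl, Finset.inter_comm]; exact h3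
  -- splitting analysis
  have hsplit : ∀ Z : Finset ι, Z.Nonempty → (vs s t Z).card ≤ 3 → ¬ Conn s t Zᶜ →
      ∃ K K' : Finset ι, Cut K ∧ Disjoint K K' ∧ K ∪ K' = Zᶜ ∧ K'.Nonempty ∧
        Disjoint (vs s t K) (vs s t K') ∧ (vs s t Z ∩ vs s t K).Nonempty ∧ (vs s t Z ∩ vs s t K').Nonempty := by
    intro Z hZ hZ3 hnc
    simp only [Conn, not_forall] at hnc
    obtain ⟨K, hKZ, hK, hK', hne⟩ := hnc
    rw [Finset.not_nonempty_iff_eq_empty, ← Finset.disjoint_iff_inter_eq_empty] at hne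
    set K' := Zᶜ \ K with hK'def
    have hcov : K ∪ K' = Zᶜ := Finset.union_sdiff_of_subset hKZ
    have hdis : Disjoint K K' := Finset.disjoint_sdiff
    have key : ∀ L L' : Finset ι, L.Nonempty → Disjoint L L' → L ∪ L' = Zᶜ →
        Disjoint (vs s t L) (vs s t L') →
        Lᶜ.Nonempty ∧ (vs s t L ∩ vs s t Lᶜ).Nonempty ∧ vs s t L ∩ vs s t Lᶜ ⊆ vs s t Z ∩ vs s t L := by
      intro L L' hL hLL' hu hd
      have hLc : Lᶜ.Nonempty := by
        obtain ⟨z, hz⟩ := hZ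
        refine ⟨z, ?_⟩
        rw [Finset.mem_compl]; intro h
        have : z ∈ Zᶜ := hu ▸ Finset.mem_union_left _ h
        exact (Finset.mem_compl.1 this) hz
      refine ⟨hLc, hconn' L hL hLc, ?_⟩
      intro v hv
      rw [Finset.mem_inter] at hv ⊢
      refine ⟨?_, hv.1⟩
      obtain ⟨i, hi, hiv⟩ := (mem_vs s t).1 hv.2
      by_cases hiZ : i ∈ Z
      · exact (mem_vs s t).2 ⟨i, hiZ, hiv⟩
      · have : i ∈ L ∪ L' := hu ▸ Finset.mem_compl.2 hiZ
        rcases Finset.mem_union.1 this with h | h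
        · exact absurd h (Finset.mem_compl.1 hi)
        · exact absurd ((mem_vs s t).2 ⟨i, h, hiv⟩) (Finset.disjoint_left.1 hd hv.1)
    obtain ⟨a1, a2, a3⟩ := key K K' hK hdis hcov hne
    obtain ⟨b1, b2, b3⟩ := key K' K hK' hdis.symm (by rw [Finset.union_comm]; exact hcov) hne.symm
    have hdz : Disjoint (vs s t K ∩ vs s t Kᶜ) (vs s t K' ∩ vs s t K'ᶜ) :=
      hne.mono Finset.inter_subset_left Finset.inter_subset_left
    have hcard : (vs s t K ∩ vs s t Kᶜ).card + (vs s t K' ∩ vs s t K'ᶜ).card ≤ 3 := by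
      rw [← Finset.card_union_of_disjoint hdz]
      exact (Finset.card_le_card (Finset.union_subset (a3.trans Finset.inter_subset_left)
        (b3.trans Finset.inter_subset_left))).trans hZ3
    have ha := Finset.card_pos.2 a2
    have hb := Finset.card_pos.2 b2
    by_cases h1 : (vs s t K ∩ vs s t Kᶜ).card = 1
    · exact ⟨K, K', ⟨hK, a1, h1⟩, hdis, hcov, hK', hne, a2.mono a3, b2.mono b3⟩
    · exact ⟨K', K, ⟨hK', b1, by omega⟩, hdis.symm, by rw [Finset.union_comm]; exact hcov, hK, hne.symm,
        b2.mono b3, a2.mono a3⟩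
  by_cases hcut : ∃ D, Cut D
  · -- minimal cut set
    obtain ⟨D, hD, hmin⟩ : ∃ D, Cut D ∧ ∀ D', Cut D' → ¬ D' ⊂ D := by
      obtain ⟨D0, hD0⟩ := hcut
      obtain ⟨D, hD, h⟩ := (Finset.univ.filter Cut).exists_minimal ⟨D0, by simp [hD0]⟩
      refine ⟨D, (Finset.mem_filter.1 hD).2, fun D' hD' hlt => ?_⟩
      exact hlt.2 (h (by simp [hD']) hlt.1)
    obtain ⟨c, hc⟩ := Finset.card_eq_one.1 hD.2.2
    have hcD : c ∈ vs s t D := (Finset.mem_inter.1 (hc ▸ Finset.mem_singleton_self c)).1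
    have hcB : c ∈ vs s t Dᶜ := (Finset.mem_inter.1 (hc ▸ Finset.mem_singleton_self c)).2
    have honly : ∀ v ∈ vs s t D, v ∈ vs s t Dᶜ → v = c := by
      intro v h1 h2
      have : v ∈ vs s t D ∩ vs s t Dᶜ := Finset.mem_inter.2 ⟨h1, h2⟩
      rw [hc] at this; exact Finset.mem_singleton.1 this
    by_cases hW : ((vs s t D).erase c).Nonempty
    · set W := (vs s t D).erase c with hWdef
      set S := D.filter (fun i => s i ≠ c ∧ t i ≠ c) with hSdef
      have hSW : vs s t S ⊆ W := by
        intro v hv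
        obtain ⟨i, hi, hiv⟩ := (mem_vs s t).1 hv
        rw [hSdef, Finset.mem_filter] at hi
        refine Finset.mem_erase.2 ⟨?_, (mem_vs s t).2 ⟨i, hi.1, hiv⟩⟩
        rcases hiv with rfl | rfl
        · exact hi.2.1
        · exact hi.2.2
      have hcard : 2 * W.card ≤ S.card + 1 := by
        have h1 := sum_degN s t D (W := vs s t D) le_rfl
        rw [← Finset.add_sum_erase _ _ hcD] at h1
        have h2 : ∑ v ∈ W, degN s t D v = W.card * 4 := by
          rw [← smul_eq_mul, ← Finset.sum_const]
          refine Finset.sum_congr rfl fun v hv => ?_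
          obtain ⟨hvc, hvD⟩ := Finset.mem_erase.1 hv
          have h3 := degN_add_compl s t D v
          rw [hdeg v (vs_mono s t (Finset.subset_univ _) hvD)] at h3
          have h4 : ¬ 0 < degN s t Dᶜ v := fun h => hvc (honly v hvD ((degN_pos s t).1 h))
          omega
        rw [h2] at h1
        have h3 := degN_add_compl s t D c
        rw [hdeg c (vs_mono s t (Finset.subset_univ _) hcD)] at h3
        have h4 := (degN_pos s t).2 hcD
        have h5 := (degN_pos s t).2 hcB
        have h6 : (D.filter (fun i => ¬ (s i ≠ c ∧ t i ≠ c))).card ≤ degN s t D c := by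
          rw [Finset.card_filter, degN]
          refine Finset.sum_le_sum fun i _ => ?_
          by_cases h7 : s i = c <;> by_cases h8 : t i = c <;> simp [h7, h8]
        have h7 := Finset.card_filter_add_card_filter_not (s := D) (fun i => s i ≠ c ∧ t i ≠ c)
        have h8 : S.card = (D.filter (fun i => s i ≠ c ∧ t i ≠ c)).card := by
          rw [hSdef]
        have h9 : 2 * W.card ≤ (D.filter (fun i => s i ≠ c ∧ t i ≠ c)).card + 1 := by omega
        convert h9
      obtain ⟨Z, hZS, hZ, hZ3, hZbd⟩ := hPL S W hW hSW hcard
      have hZv := (card_vs_le s t hZbd).trans hZ3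
      refine ⟨Z, hZ, hZbd, hZv, ?_⟩
      by_contra hnc
      obtain ⟨K, K', hK, hKK', hu, hK', hvd, -, -⟩ := hsplit Z hZ hZv hnc
      have hZD : Z ⊆ D := hZS.trans (Finset.filter_subset _ _)
      have hmem : ∀ i, i ∉ Z → i ∈ K ∨ i ∈ K' := fun i hi =>
        Finset.mem_union.1 (hu ▸ Finset.mem_compl.2 hi)
      have hZK : ∀ i ∈ Z, i ∉ K ∧ i ∉ K' := by
        intro i hi
        constructor
        · intro h
          exact Finset.mem_compl.1 (hu ▸ Finset.mem_union_left _ h : i ∈ Zᶜ) hi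
        · intro h
          exact Finset.mem_compl.1 (hu ▸ Finset.mem_union_right _ h : i ∈ Zᶜ) hi
      -- Dᶜ is on one side
      have hside : ∀ L L' : Finset ι, (∀ i, i ∉ Z → i ∈ L ∨ i ∈ L') → Disjoint (vs s t L) (vs s t L') →
          c ∉ vs s t (Dᶜ ∩ L) → Dᶜ ∩ L = ∅ := by
        intro L L' hLL hd hcL
        by_contra hne
        have hne := Finset.nonempty_iff_ne_empty.2 hne
        have hcne : (Dᶜ ∩ L)ᶜ.Nonempty := by
          obtain ⟨d, hd⟩ := hD.1
          exact ⟨d, by simp [hd]⟩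
        obtain ⟨v, hv⟩ := hconn' _ hne hcne
        rw [Finset.mem_inter] at hv
        obtain ⟨i, hi, hiv⟩ := (mem_vs s t).1 hv.2
        have hv1 : v ∈ vs s t Dᶜ := vs_mono s t Finset.inter_subset_left hv.1
        have hv2 : v ∈ vs s t L := vs_mono s t Finset.inter_subset_right hv.1
        by_cases hiD : i ∈ D
        · have := honly v ((mem_vs s t).2 ⟨i, hiD, hiv⟩) hv1
          exact hcL (this ▸ hv.1)
        · rcases hLL i (fun h => hiD (hZD h)) with h | h
          · rw [Finset.mem_compl, Finset.mem_inter] at hi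
            exact hi ⟨Finset.mem_compl.2 hiD, h⟩
          · exact Finset.disjoint_left.1 hd hv2 ((mem_vs s t).2 ⟨i, h, hiv⟩)
      by_cases hcK : c ∈ vs s t (Dᶜ ∩ K)
      · -- Dᶜ ⊆ K
        have hcK1 : c ∈ vs s t K := vs_mono s t Finset.inter_subset_right hcK
        have h1 := hside K' K (fun i hi => (hmem i hi).symm) hvd.symm (fun h =>
          Finset.disjoint_left.1 hvd hcK1 (vs_mono s t Finset.inter_subset_right h))
        have hKc : Kᶜ ⊆ D := by
          intro i hi
          by_contra hiD
          rcases hmem i (fun h => hiD (hZD h)) with h | h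
          · exact Finset.mem_compl.1 hi h
          · have : i ∈ Dᶜ ∩ K' := Finset.mem_inter.2 ⟨Finset.mem_compl.2 hiD, h⟩
            rw [h1] at this; exact absurd this (Finset.notMem_empty _)
        refine hmin Kᶜ (hCutc K hK) ⟨hKc, fun hle => ?_⟩
        obtain ⟨d, hd, hdc⟩ := (mem_vs s t).1 hcD
        have hdZ : d ∉ Z := by
          intro h
          have := (Finset.mem_filter.1 (hZS h)).2
          rcases hdc with h' | h'
          · exact this.1 h'
          · exact this.2 h'
        rcases hmem d hdZ with h | h
        · exact Finset.mem_compl.1 (hle hd) h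
        · exact Finset.disjoint_left.1 hvd hcK1 ((mem_vs s t).2 ⟨d, h, hdc⟩)
      · have h1 := hside K K' hmem hvd hcK
        have hKD : K ⊆ D := by
          intro i hi
          by_contra hiD
          have : i ∈ Dᶜ ∩ K := Finset.mem_inter.2 ⟨Finset.mem_compl.2 hiD, hi⟩
          rw [h1] at this; exact absurd this (Finset.notMem_empty _)
        refine hmin K hK ⟨hKD, fun hle => ?_⟩
        obtain ⟨z, hz⟩ := hZ
        exact (hZK z hz).1 (hle (hZD hz))
    · -- D consists of loops at c
      rw [Finset.not_nonempty_iff_eq_empty] at hW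
      obtain ⟨e, he⟩ := hD.1
      have hall : ∀ v ∈ vs s t D, v = c := by
        intro v hv
        by_contra h
        have : v ∈ (vs s t D).erase c := Finset.mem_erase.2 ⟨h, hv⟩
        rw [hW] at this; exact absurd this (Finset.notMem_empty _)
      have hsc : s e = c := hall _ ((mem_vs s t).2 ⟨e, he, Or.inl rfl⟩)
      have htc : t e = c := hall _ ((mem_vs s t).2 ⟨e, he, Or.inr rfl⟩)
      have hvs : vs s t {e} = {c} := by simp [vs, hsc, htc]
      refine ⟨{e}, by simp, fun v => ?_, by simp [hvs], ?_⟩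
      · simp [bd, inc, hsc, htc, CharTwo.add_self_eq_zero]
      · by_contra hnc
        obtain ⟨K, K', -, -, -, -, hvd, ⟨x, hx⟩, ⟨y, hy⟩⟩ := hsplit {e} (by simp) (by simp [hvs]) hnc
        rw [hvs, Finset.mem_inter, Finset.mem_singleton] at hx hy
        exact Finset.disjoint_left.1 hvd (hx.1 ▸ hx.2) (hy.1 ▸ hy.2)
  · have h1 := sum_degN s t Finset.univ (W := vs s t Finset.univ) le_rfl
    rw [Finset.sum_congr rfl hdeg, Finset.sum_const, smul_eq_mul] at h1
    obtain ⟨Z, -, hZ, hZ3, hZbd⟩ := hPL Finset.univ (vs s t Finset.univ)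
      (vs_nonempty s t Finset.univ_nonempty) le_rfl (by omega)
    have hZv := (card_vs_le s t hZbd).trans hZ3
    refine ⟨Z, hZ, hZbd, hZv, ?_⟩
    by_contra hnc
    obtain ⟨K, K', hK, -⟩ := hsplit Z hZ hZv hnc
    exact hcut ⟨K, hK⟩

end comb
end KP

namespace KP
section euler
variable {ι α : Type} [Fintype ι] [DecidableEq ι] [DecidableEq α] (s t : ι → α)

/-- source of an oriented edge -/
def dsrc (d : ι × Bool) : α := if d.2 then s d.1 else t d.1

/-- target of an oriented edge -/
def dtgt (d : ι × Bool) : α := if d.2 then t d.1 else s d.1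

/-- walks -/
def Tr : α → List (ι × Bool) → α → Prop
  | u, [], w => u = w
  | u, d :: l, w => dsrc s t d = u ∧ Tr (dtgt s t d) l w

theorem Tr_append {u w : α} {l1 l2 : List (ι × Bool)} :
    Tr s t u (l1 ++ l2) w ↔ ∃ x, Tr s t u l1 x ∧ Tr s t x l2 w := by
  induction l1 generalizing u with
  | nil => simp [Tr]
  | cons d l ih => simp [Tr, ih, and_assoc]

theorem inc_dart (d : ι × Bool) (v : α) :
    inc s t d.1 v = (if dsrc s t d = v then 1 else 0) + (if dtgt s t d = v then 1 else 0) := by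
  obtain ⟨i, b⟩ := d
  cases b
  · simp [inc, dsrc, dtgt, add_comm]
  · simp [inc, dsrc, dtgt]

theorem Tr_bd {u w : α} {l : List (ι × Bool)} (h : Tr s t u l w) (hn : (l.map Prod.fst).Nodup) (v : α) :
    bd s t (l.map Prod.fst).toFinset v = (if u = v then 1 else 0) + (if w = v then 1 else 0) := by
  induction l generalizing u with
  | nil =>
    simp only [Tr] at h
    subst h
    simp [bd, CharTwo.add_self_eq_zero]
  | cons d l ih =>
    obtain ⟨h1, h2⟩ := h
    rw [List.map_cons, List.nodup_cons] at hn
    have := ih h2 hn.2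
    rw [List.map_cons, List.toFinset_cons, bd, Finset.sum_insert (by simpa using hn.1)]
    change inc s t d.1 v + bd s t _ v = _
    rw [this, inc_dart, h1, add_assoc, ← add_assoc (if dtgt s t d = v then (1 : ZMod 2) else 0),
      CharTwo.add_self_eq_zero, zero_add]

/-- Euler circuits -/
theorem euler {A : Finset ι} (hA : A.Nonempty) (hc : Conn s t A) (hbd : ∀ v, bd s t A v = 0) :
    ∃ l u, Tr s t u l u ∧ (l.map Prod.fst).Nodup ∧ (l.map Prod.fst).toFinset = A := by
  let Good : List (ι × Bool) → Prop := fun l => (∃ u w, Tr s t u l w) ∧ (l.map Prod.fst).Nodup ∧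
    (l.map Prod.fst).toFinset ⊆ A
  have hlen : ∀ l, Good l → l.length ≤ A.card := by
    intro l hl
    have := Finset.card_le_card hl.2.2
    rwa [List.toFinset_card_of_nodup hl.2.1, List.length_map] at this
  obtain ⟨l, hl, hmax⟩ : ∃ l, Good l ∧ ∀ l', Good l' → l'.length ≤ l.length := by
    have hne : {k | ∃ l, Good l ∧ l.length = k}.Nonempty := by
      obtain ⟨e, he⟩ := hA
      exact ⟨_, [], ⟨⟨s e, s e, rfl⟩, by simp, by simp⟩, rfl⟩
    have hb : BddAbove {k | ∃ l, Good l ∧ l.length = k} :=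
      ⟨A.card, by rintro k ⟨l, hl, rfl⟩; exact hlen l hl⟩
    obtain ⟨l, hl, hk⟩ := Nat.sSup_mem hne hb
    exact ⟨l, hl, fun l' hl' => hk ▸ le_csSup hb ⟨l', hl', rfl⟩⟩
  -- appending and prepending
  have happ : ∀ l' u w e, Tr s t u l' w → (l'.map Prod.fst).Perm (l.map Prod.fst) → e ∈ A →
      e ∉ l.map Prod.fst → (s e = w ∨ t e = w) → False := by
    intro l' u w e h hp heA hel hew
    obtain ⟨b, hb⟩ : ∃ b, dsrc s t (e, b) = w := by
      rcases hew with h | h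
      · exact ⟨true, by simp [dsrc, h]⟩
      · exact ⟨false, by simp [dsrc, h]⟩
    have hg : Good (l' ++ [(e, b)]) := by
      refine ⟨⟨u, dtgt s t (e, b), (Tr_append s t).2 ⟨w, h, hb, rfl⟩⟩, ?_, ?_⟩
      · rw [List.map_append, List.nodup_append]
        refine ⟨hp.nodup_iff.2 hl.2.1, by simp, ?_⟩
        intro a ha b' hb' hab
        simp at hb'
        subst hab hb'
        exact hel (hp.mem_iff.1 ha)
      · intro i hi
        rw [List.map_append, List.toFinset_append, Finset.mem_union] at hi
        rcases hi with hi | hi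
        · exact hl.2.2 (List.mem_toFinset.2 (hp.mem_iff.1 (List.mem_toFinset.1 hi)))
        · simp at hi; subst hi; exact heA
    have h1 := hmax _ hg
    have h2 := hp.length_eq
    simp at h1 h2
    omega
  have hpre : ∀ l' u w e, Tr s t u l' w → (l'.map Prod.fst).Perm (l.map Prod.fst) → e ∈ A →
      e ∉ l.map Prod.fst → (s e = u ∨ t e = u) → False := by
    intro l' u w e h hp heA hel hew
    obtain ⟨b, hb⟩ : ∃ b, dtgt s t (e, b) = u := by
      rcases hew with h | h
      · exact ⟨false, by simp [dtgt, h]⟩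
      · exact ⟨true, by simp [dtgt, h]⟩
    have hg : Good ((e, b) :: l') := by
      refine ⟨⟨dsrc s t (e, b), w, rfl, hb.symm ▸ h⟩, ?_, ?_⟩
      · rw [List.map_cons, List.nodup_cons]
        exact ⟨fun h => hel (hp.mem_iff.1 h), hp.nodup_iff.2 hl.2.1⟩
      · intro i hi
        rw [List.map_cons, List.toFinset_cons, Finset.mem_insert] at hi
        rcases hi with hi | hi
        · rw [hi]; exact heA
        · exact hl.2.2 (List.mem_toFinset.2 (hp.mem_iff.1 (List.mem_toFinset.1 hi)))
    have h1 := hmax _ hg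
    have h2 := hp.length_eq
    simp at h1 h2
    omega
  obtain ⟨⟨u, w, htr⟩, hnd, hsub⟩ := hl
  set K := (l.map Prod.fst).toFinset with hK
  -- closed
  have hclosed : u = w := by
    by_contra huw
    have h1 := Tr_bd s t htr hnd w
    rw [if_neg huw, if_pos rfl, zero_add] at h1
    have h2 : bd s t (A \ K) w ≠ 0 := by
      intro h
      have h3 : bd s t (A \ K) w + bd s t K w = bd s t A w := Finset.sum_sdiff hsub
      rw [h, hbd w, h1] at h3
      exact absurd h3 (by decide)
    obtain ⟨e, he, hinc⟩ := Finset.exists_ne_zero_of_sum_ne_zero h2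
    rw [Finset.mem_sdiff] at he
    refine happ l u w e htr (List.Perm.refl _) he.1 (fun h => he.2 (List.mem_toFinset.2 h)) ?_
    by_contra hno
    rw [not_or] at hno
    exact hinc (by simp [inc, hno.1, hno.2])
  subst hclosed
  have hlne : l ≠ [] := by
    rintro rfl
    obtain ⟨e, he⟩ := hA
    exact happ [] (s e) (s e) e rfl (List.Perm.refl _) he (by simp) (Or.inl rfl)
  refine ⟨l, u, htr, hnd, ?_⟩
  by_contra hne
  have hd : (A \ K).Nonempty := by
    rw [Finset.sdiff_nonempty]
    exact fun h => hne (Finset.Subset.antisymm hsub h)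
  have hKne : K.Nonempty := by
    obtain ⟨d, l', rfl⟩ := List.exists_cons_of_ne_nil hlne
    exact ⟨d.1, by simp [hK]⟩
  obtain ⟨v, hv⟩ := hc K hsub hKne hd
  rw [Finset.mem_inter, mem_vs, mem_vs] at hv
  obtain ⟨⟨i, hi, hiv⟩, ⟨e, he, hev⟩⟩ := hv
  rw [Finset.mem_sdiff] at he
  have hel : e ∉ l.map Prod.fst := fun h => he.2 (List.mem_toFinset.2 h)
  obtain ⟨d, hdl, hdi⟩ := List.mem_map.1 (List.mem_toFinset.1 hi)
  subst hdi
  obtain ⟨l1, l2, hl12⟩ := List.append_of_mem hdl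
  rw [hl12, Tr_append] at htr
  obtain ⟨x, hx1, hx2, hx3⟩ := htr
  have hv' : v = dsrc s t d ∨ v = dtgt s t d := by
    rcases d with ⟨i, b⟩
    cases b
    · rcases hiv with h | h
      · right; simp [dtgt, ← h]
      · left; simp [dsrc, ← h]
    · rcases hiv with h | h
      · left; simp [dsrc, ← h]
      · right; simp [dtgt, ← h]
  rcases hv' with h | h
  · refine hpre (d :: l2 ++ l1) v x e ?_ ?_ he.1 hel hev
    · exact (Tr_append s t).2 ⟨u, ⟨h.symm, hx3⟩, hx1⟩
    · exact List.Perm.map _ (hl12 ▸ List.perm_append_comm)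
  · refine happ ((l2 ++ l1) ++ [d]) v v e ?_ ?_ he.1 hel hev
    · refine (Tr_append s t).2 ⟨x, (Tr_append s t).2 ⟨u, h ▸ hx3, hx1⟩, hx2, h.symm⟩
    · refine List.Perm.map _ ?_
      rw [hl12, List.append_assoc]
      refine (List.perm_append_comm).trans ?_
      rw [List.append_assoc]
      exact List.Perm.refl _

theorem Tr_get {u w : α} {l : List (ι × Bool)} (h : Tr s t u l w) (j : ℕ) (hj : j < l.length) :
    dtgt s t l[j] = if h' : j + 1 < l.length then dsrc s t l[j + 1] else w := by
  induction l generalizing u j with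
  | nil => simp at hj
  | cons d l ih =>
    obtain ⟨h1, h2⟩ := h
    cases j with
    | zero =>
      cases l with
      | nil => simpa [Tr] using h2
      | cons d' l => simpa using h2.1.symm
    | succ j =>
      have := ih h2 j (by simpa using hj)
      simpa using this

/-- cyclic form of the Euler circuit -/
theorem euler_cyc {A : Finset ι} (hA : A.Nonempty) (hc : Conn s t A) (hbd : ∀ v, bd s t A v = 0) :
    ∃ (k : ℕ) (_ : 0 < k) (p : ℕ → ι × Bool), (∀ j, p (j + k) = p j) ∧
      (∀ j, dtgt s t (p j) = dsrc s t (p (j + 1))) ∧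
      (∀ i < k, ∀ j < k, (p i).1 = (p j).1 → i = j) ∧
      (∀ e, e ∈ A ↔ ∃ j < k, (p j).1 = e) := by
  obtain ⟨l, u, htr, hnd, hset⟩ := euler s t hA hc hbd
  have hk : 0 < l.length := by
    rw [List.length_pos_iff]
    rintro rfl
    simp at hset
    subst hset
    exact absurd hA (by simp)
  have hm : ∀ j, j % l.length < l.length := fun j => Nat.mod_lt _ hk
  refine ⟨l.length, hk, fun j => l[j % l.length]'(hm j), ?_, ?_, ?_, ?_⟩
  · intro j; simp
  · intro j
    change dtgt s t (l[j % l.length]'(hm j)) = dsrc s t (l[(j + 1) % l.length]'(hm _))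
    rw [Tr_get s t htr _ (hm j)]
    split_ifs with h
    · have : (j + 1) % l.length = j % l.length + 1 := by
        rw [← Nat.mod_add_mod, Nat.mod_eq_of_lt h]
      simp only [this]
    · have : (j + 1) % l.length = 0 := by
        have h1 : j % l.length + 1 = l.length := by have := hm j; omega
        rw [← Nat.mod_add_mod, h1, Nat.mod_self]
      simp only [this]
      obtain ⟨d, l', rfl⟩ := List.exists_cons_of_ne_nil (List.length_pos_iff.1 hk)
      exact htr.1.symm
  · intro i hi j hj hij
    simp only [Nat.mod_eq_of_lt hi, Nat.mod_eq_of_lt hj] at hij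
    have := hnd.getElem_inj_iff (i := i) (hi := by simpa using hi) (j := j) (hj := by simpa using hj)
    simp only [List.getElem_map] at this
    exact this.1 hij
  · intro e
    rw [← hset, List.mem_toFinset, List.mem_iff_getElem]
    constructor
    · rintro ⟨j, hj, h⟩
      refine ⟨j, by simpa using hj, ?_⟩
      simp only [List.length_map] at hj
      simpa [Nat.mod_eq_of_lt hj] using h
    · rintro ⟨j, hj, h⟩
      refine ⟨j, by simpa using hj, ?_⟩
      simpa [Nat.mod_eq_of_lt hj] using h
end euler
end KP

namespace KP
set_option linter.unusedSectionVars false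
section param
variable {ι X : Type} [Fintype ι] [DecidableEq ι] [TopologicalSpace X] [DecidableEq X]

/-- the arc of an oriented edge -/
def dγ (γ : ι → ℝ → X) (d : ι × Bool) (u : ℝ) : X := if d.2 then γ d.1 u else γ d.1 (1 - u)

theorem dγ_zero (γ : ι → ℝ → X) (d : ι × Bool) :
    dγ γ d 0 = dsrc (fun i => γ i 0) (fun i => γ i 1) d := by
  simp [dγ, dsrc]

theorem dγ_one (γ : ι → ℝ → X) (d : ι × Bool) :
    dγ γ d 1 = dtgt (fun i => γ i 0) (fun i => γ i 1) d := by
  simp [dγ, dtgt]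

theorem dγ_cont {γ : ι → ℝ → X} (h : ∀ i, Continuous (γ i)) (d : ι × Bool) : Continuous (dγ γ d) := by
  unfold dγ
  cases d.2
  · simp only [Bool.false_eq_true, if_false]
    exact (h d.1).comp (continuous_const.sub continuous_id)
  · simpa using h d.1

theorem dγ_image (γ : ι → ℝ → X) (d : ι × Bool) : dγ γ d '' Icc 0 1 = γ d.1 '' Icc 0 1 := by
  rcases d with ⟨i, b⟩
  cases b
  · have : dγ γ (i, false) = γ i ∘ (fun u => 1 - u) := by ext u; simp [dγ]
    rw [this, image_comp]
    simp
  · have : dγ γ (i, true) = γ i := by ext u; simp [dγ]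
    rw [this]

theorem sum_src {s t : ι → X} {A : Finset ι} {k : ℕ} {p : ℕ → ι × Bool}
    (hper : ∀ j, p (j + k) = p j) (hst : ∀ j, dtgt s t (p j) = dsrc s t (p (j + 1)))
    (hinj : ∀ i < k, ∀ j < k, (p i).1 = (p j).1 → i = j) (hA : ∀ e, e ∈ A ↔ ∃ j < k, (p j).1 = e) (v : X) :
    2 * ((Finset.range k).filter (fun j => dsrc s t (p j) = v)).card = degN s t A v := by
  have h1 : A = (Finset.range k).image (fun j => (p j).1) := by
    ext e; rw [hA]; simp
  have h2 : degN s t A v = ∑ j ∈ Finset.range k, ((if dsrc s t (p j) = v then 1 else 0) +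
      (if dtgt s t (p j) = v then 1 else 0)) := by
    rw [h1, degN, Finset.sum_image]
    · refine Finset.sum_congr rfl fun j _ => ?_
      rcases p j with ⟨i, b⟩
      cases b
      · simp [dsrc, dtgt, add_comm]
      · simp [dsrc, dtgt]
    · intro i hi j hj h
      exact hinj i (by simpa using hi) j (by simpa using hj) h
  have h3 : ∑ j ∈ Finset.range k, (if dtgt s t (p j) = v then 1 else 0) =
      ∑ j ∈ Finset.range k, (if dsrc s t (p j) = v then 1 else 0) := by
    simp only [hst]
    have h4 := Finset.sum_range_succ' (fun j => if dsrc s t (p j) = v then 1 else 0) k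
    rw [Finset.sum_range_succ] at h4
    have h5 : p k = p 0 := by simpa using hper 0
    rw [h5] at h4
    omega
  rw [h2, Finset.sum_add_distrib, h3, ← Finset.card_filter]
  omega

theorem euler_param {γ : ι → ℝ → X} {V : Finset X} (hcont : ∀ i, Continuous (γ i))
    (hs : ∀ i, γ i 0 ∈ V)
    (h_int : ∀ i, ∀ u ∈ Ioo (0:ℝ) 1, γ i u ∉ V)
    (hinj : ∀ i j, ∀ u ∈ Ioo (0:ℝ) 1, ∀ v ∈ Ioo (0:ℝ) 1, γ i u = γ j v → i = j ∧ u = v)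
    (ht : ∀ i, γ i 1 ∈ V)
    {A : Finset ι} (hA : A.Nonempty) (hc : Conn (fun i => γ i 0) (fun i => γ i 1) A)
    (hbd : ∀ v, bd (fun i => γ i 0) (fun i => γ i 1) A v = 0) :
    ∃ f : C(AddCircle (1:ℝ), X), range f = ⋃ i ∈ A, γ i '' Icc 0 1 ∧
      (∀ v ∈ V, (f ⁻¹' {v}).Finite ∧
        2 * Nat.card (f ⁻¹' {v}) = degN (fun i => γ i 0) (fun i => γ i 1) A v) ∧
      ∀ v ∉ V, (f ⁻¹' {v}).Subsingleton := by
  obtain ⟨k, hk, p, hper, hst, hpinj, hpA⟩ := euler_cyc _ _ hA hc hbd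
  let g : ℕ → ℝ → X := fun j => dγ γ (p j)
  have hg : ∀ j, Continuous (g j) := fun j => dγ_cont hcont _
  have hg1 : ∀ j, g j 1 = g (j + 1) 0 := fun j => by
    simp only [g]; rw [dγ_one, dγ_zero, hst]
  have hg0V : ∀ j, g j 0 ∈ V := by
    intro j
    simp only [g, dγ]
    split_ifs
    · exact hs _
    · rw [sub_zero]; exact ht _
  have hgV : ∀ j, ∀ u ∈ Ioo (0:ℝ) 1, g j u ∉ V := by
    intro j u hu
    simp only [g, dγ]
    split_ifs
    · exact h_int _ _ hu
    · exact h_int _ _ ⟨by linarith [hu.2], by linarith [hu.1]⟩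
  have hginj : ∀ i < k, ∀ j < k, ∀ u ∈ Ioo (0:ℝ) 1, ∀ v ∈ Ioo (0:ℝ) 1, g i u = g j v → i = j ∧ u = v := by
    intro i hi j hj u hu v hv h
    have hu' : 1 - u ∈ Ioo (0:ℝ) 1 := ⟨by linarith [hu.2], by linarith [hu.1]⟩
    have hv' : 1 - v ∈ Ioo (0:ℝ) 1 := ⟨by linarith [hv.2], by linarith [hv.1]⟩
    have hij : i = j := by
      refine hpinj i hi j hj ?_
      simp only [g, dγ] at h
      split_ifs at h
      · exact (hinj _ _ _ hu _ hv h).1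
      · exact (hinj _ _ _ hu _ hv' h).1
      · exact (hinj _ _ _ hu' _ hv h).1
      · exact (hinj _ _ _ hu' _ hv' h).1
    subst hij
    refine ⟨rfl, ?_⟩
    simp only [g, dγ] at h
    split_ifs at h
    · exact (hinj _ _ _ hu _ hv h).2
    · have := (hinj _ _ _ hu' _ hv' h).2
      linarith
  let Γ : ℝ → X := fun x => g ⌊x⌋₊ (x - ⌊x⌋₊)
  have hΓ : ∀ j : ℕ, ∀ u ∈ Icc (0:ℝ) 1, Γ (j + u) = g j u := by
    intro j u hu
    rcases eq_or_lt_of_le hu.2 with h | h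
    · subst h
      simp only [Γ]
      have : ⌊(j:ℝ) + 1⌋₊ = j + 1 := by
        have := Nat.floor_natCast (R := ℝ) (j + 1)
        push_cast at this; exact this
      rw [this, hg1]; congr 1; push_cast; ring
    · simp only [Γ]
      have : ⌊(j:ℝ) + u⌋₊ = j := by
        rw [Nat.floor_eq_iff (by linarith [hu.1, (Nat.cast_nonneg j : (0:ℝ) ≤ j)])]
        exact ⟨by linarith [hu.1], by linarith⟩
      rw [this]; congr 1; ring
  have hΓc : ∀ j : ℕ, ContinuousOn Γ (Icc (0:ℝ) j) := by
    intro j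
    induction j with
    | zero => simp
    | succ j ih =>
      have h0 : (0:ℝ) ≤ j := Nat.cast_nonneg j
      have h1 : Icc (0:ℝ) ((j + 1 : ℕ) : ℝ) = Icc (0:ℝ) j ∪ Icc (j:ℝ) (j + 1) := by
        rw [Icc_union_Icc_eq_Icc h0 (by linarith)]; push_cast; rfl
      rw [h1]
      refine ih.union_of_isClosed ?_ isClosed_Icc isClosed_Icc
      have h2 : ContinuousOn (fun x : ℝ => g j (x - j)) (Icc (j:ℝ) (j + 1)) :=
        ((hg j).comp (continuous_id.sub continuous_const)).continuousOn
      refine h2.congr fun x hx => ?_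
      have := hΓ j (x - j) ⟨by linarith [hx.1], by linarith [hx.2]⟩
      change Γ x = g j (x - j)
      rw [← this]; congr 1; ring
  have hk' : (0:ℝ) < k := Nat.cast_pos.2 hk
  have hcl : (fun x : ℝ => Γ (k * x)) 0 = (fun x : ℝ => Γ (k * x)) (0 + 1) := by
    have h1 := hΓ 0 0 (by simp)
    have h2 := hΓ k 0 (by simp)
    have h3 : g k = g 0 := by simp only [g]; rw [← hper 0, zero_add]
    rw [h3] at h2
    simp at h1 h2 ⊢
    rw [h1, h2]
  have hcc : ContinuousOn (fun x : ℝ => Γ (k * x)) (Icc 0 (0 + 1)) := by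
    refine (hΓc k).comp (continuous_const.mul continuous_id).continuousOn ?_
    intro x hx
    exact ⟨mul_nonneg hk'.le hx.1, by nlinarith [hx.2]⟩
  let f : C(AddCircle (1:ℝ), X) := ⟨AddCircle.liftIco 1 0 (fun x => Γ (k * x)),
    AddCircle.liftIco_continuous hcl hcc⟩
  have hmem : ∀ j < k, ∀ u ∈ Ico (0:ℝ) 1, ((j + u) / k : ℝ) ∈ Ico (0:ℝ) (0 + 1) := by
    intro j hj u hu
    have h0 : (0:ℝ) ≤ j := Nat.cast_nonneg j
    have h1 : (j:ℝ) + 1 ≤ k := by exact_mod_cast hj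
    refine ⟨div_nonneg (by linarith [hu.1]) hk'.le, ?_⟩
    rw [zero_add, div_lt_one hk']
    linarith [hu.2]
  have hf : ∀ j < k, ∀ u ∈ Ico (0:ℝ) 1, f (((j + u) / k : ℝ) : AddCircle (1:ℝ)) = g j u := by
    intro j hj u hu
    change AddCircle.liftIco 1 0 (fun x => Γ (k * x)) _ = _
    rw [AddCircle.liftIco_coe_apply (hmem j hj u hu)]
    rw [mul_div_cancel₀ _ hk'.ne']
    exact hΓ j u ⟨hu.1, hu.2.le⟩
  have hsurj : ∀ y : AddCircle (1:ℝ), ∃ j < k, ∃ u ∈ Ico (0:ℝ) 1, y = (((j + u) / k : ℝ) : AddCircle (1:ℝ)) := by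
    intro y
    obtain ⟨x, hx, rfl⟩ := AddCircle.coe_image_Ico_eq (1:ℝ) 0 ▸ mem_univ y
    have hx0 : 0 ≤ (k:ℝ) * x := mul_nonneg hk'.le hx.1
    refine ⟨⌊k * x⌋₊, ?_, k * x - ⌊k * x⌋₊, ⟨?_, ?_⟩, ?_⟩
    · rw [Nat.floor_lt hx0]
      nlinarith [hx.2]
    · linarith [Nat.floor_le hx0]
    · linarith [Nat.lt_floor_add_one (k * x)]
    · congr 1
      field_simp
      ring
  refine ⟨f, ?_, ?_, ?_⟩
  · ext z
    simp only [mem_range, mem_iUnion]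
    constructor
    · rintro ⟨y, rfl⟩
      obtain ⟨j, hj, u, hu, rfl⟩ := hsurj y
      refine ⟨(p j).1, (hpA _).2 ⟨j, hj, rfl⟩, ?_⟩
      rw [hf j hj u hu, ← dγ_image]
      exact ⟨u, ⟨hu.1, hu.2.le⟩, rfl⟩
    · rintro ⟨i, hi, hz⟩
      obtain ⟨j, hj, rfl⟩ := (hpA i).1 hi
      rw [← dγ_image] at hz
      obtain ⟨u, hu, rfl⟩ := hz
      rcases eq_or_lt_of_le hu.2 with h | h
      · subst h
        change ∃ y, f y = g j 1
        rw [hg1]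
        have h0 : (0:ℝ) ∈ Ico (0:ℝ) 1 := by simp
        by_cases hj' : j + 1 < k
        · exact ⟨_, hf (j + 1) hj' 0 h0⟩
        · have : j + 1 = 0 + k := by omega
          have h3 : g (j + 1) = g 0 := by simp only [g]; rw [this, hper]
          rw [h3]
          exact ⟨_, hf 0 hk 0 h0⟩
      · exact ⟨_, hf j hj u ⟨hu.1, h⟩⟩
  · intro v hv
    have hfib : f ⁻¹' {v} = (fun j : ℕ => (((j + 0) / k : ℝ) : AddCircle (1:ℝ))) ''
        ((Finset.range k).filter (fun j => dsrc (fun i => γ i 0) (fun i => γ i 1) (p j) = v)) := by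
      have h0 : (0:ℝ) ∈ Ico (0:ℝ) 1 := by simp
      ext y
      constructor
      · intro hy
        obtain ⟨j, hj, u, hu, rfl⟩ := hsurj y
        rw [mem_preimage, mem_singleton_iff, hf j hj u hu] at hy
        rcases eq_or_lt_of_le hu.1 with h | h
        · subst h
          refine ⟨j, ?_, rfl⟩
          rw [Finset.mem_coe, Finset.mem_filter, ← dγ_zero]
          exact ⟨by simpa using hj, hy⟩
        · exact absurd (hy ▸ hv) (hgV j u ⟨h, hu.2⟩)
      · rintro ⟨j, hj, rfl⟩
        rw [Finset.mem_coe, Finset.mem_filter, ← dγ_zero] at hj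
        rw [mem_preimage, mem_singleton_iff]
        change f (((j + 0) / k : ℝ) : AddCircle (1:ℝ)) = v
        rw [hf j (by simpa using hj.1) 0 h0]
        exact hj.2
    have hio : InjOn (fun j : ℕ => (((j + 0) / k : ℝ) : AddCircle (1:ℝ)))
        ((Finset.range k).filter (fun j => dsrc (fun i => γ i 0) (fun i => γ i 1) (p j) = v)) := by
      have h0 : (0:ℝ) ∈ Ico (0:ℝ) 1 := by simp
      intro i hi j hj h
      rw [Finset.mem_coe, Finset.mem_filter, Finset.mem_range] at hi hj
      have := (AddCircle.coe_eq_coe_iff_of_mem_Ico (hmem i hi.1 0 h0) (hmem j hj.1 0 h0)).1 h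
      rw [div_left_inj' hk'.ne'] at this
      exact_mod_cast (add_right_cancel this)
    refine ⟨hfib ▸ (Finset.finite_toSet _).image _, ?_⟩
    rw [hfib, Nat.card_image_of_injOn hio, ← sum_src hper hst hpinj hpA v]
    congr 1
    exact Nat.card_eq_card_toFinset _ |>.trans (by simp)
  · intro v hv y hy y' hy'
    obtain ⟨j, hj, u, hu, rfl⟩ := hsurj y
    obtain ⟨j', hj', u', hu', rfl⟩ := hsurj y'
    rw [mem_preimage, mem_singleton_iff, hf _ hj _ hu] at hy
    rw [mem_preimage, mem_singleton_iff, hf _ hj' _ hu'] at hy'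
    have h0 : 0 < u := lt_of_le_of_ne hu.1 (by rintro rfl; exact hv (hy ▸ hg0V j))
    have h0' : 0 < u' := lt_of_le_of_ne hu'.1 (by rintro rfl; exact hv (hy' ▸ hg0V j'))
    obtain ⟨rfl, rfl⟩ := hginj j hj j' hj' u ⟨h0, hu.2⟩ u' ⟨h0', hu'.2⟩ (hy.trans hy'.symm)
    rfl
end param
end KP

namespace KP
set_option linter.unusedSectionVars false
section extract
variable {X : Type} [TopologicalSpace X] [DecidableEq X]

theorem extract (f : C(AddCircle (1:ℝ), X)) (V : Finset X) (hV : V.Nonempty)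
    (hfin : ∀ v ∈ V, (f ⁻¹' {v}).Finite)
    (h2 : ∀ v ∈ V, Nat.card (f ⁻¹' {v}) = 2) (h1 : ∀ v ∉ V, (f ⁻¹' {v}).Subsingleton) :
    ∃ (k : ℕ) (γ : Fin k → ℝ → X), 0 < k ∧ (∀ i, Continuous (γ i)) ∧ (∀ i, γ i 0 ∈ V) ∧ (∀ i, γ i 1 ∈ V) ∧
      (∀ i, ∀ u ∈ Ioo (0:ℝ) 1, γ i u ∉ V) ∧
      (∀ i j, ∀ u ∈ Ioo (0:ℝ) 1, ∀ v ∈ Ioo (0:ℝ) 1, γ i u = γ j v → i = j ∧ u = v) ∧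
      (⋃ i, γ i '' Icc 0 1) = range f ∧
      (∀ v ∈ V, degN (fun i => γ i 0) (fun i => γ i 1) Finset.univ v = 4) ∧
      Conn (fun i => γ i 0) (fun i => γ i 1) Finset.univ := by
  let F : ℝ → X := fun x => f (x : AddCircle (1:ℝ))
  have hFc : Continuous F := f.continuous.comp (AddCircle.continuous_mk' 1)
  have hF1 : ∀ x, F (x + 1) = F x := by
    intro x; simp only [F]; congr 1; exact AddCircle.coe_add_period 1 x
  have hinjC : InjOn (fun x : ℝ => (x : AddCircle (1:ℝ))) (Ico 0 1) := by
    intro x hx y hy h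
    exact (AddCircle.coe_eq_coe_iff_of_mem_Ico (p := (1:ℝ)) (a := 0) (by simpa using hx)
      (by simpa using hy)).1 h
  have hIfin : {x : ℝ | x ∈ Ico (0:ℝ) 1 ∧ F x ∈ V}.Finite := by
    have h3 : (⋃ v ∈ V, f ⁻¹' {v}).Finite := V.finite_toSet.biUnion hfin
    refine Finite.of_finite_image (f := fun x : ℝ => (x : AddCircle (1:ℝ))) (h3.subset ?_)
      (hinjC.mono fun x hx => hx.1)
    rintro _ ⟨x, hx, rfl⟩
    exact mem_biUnion hx.2 rfl
  set I : Finset ℝ := hIfin.toFinset with hI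
  have hmemI : ∀ x, x ∈ I ↔ x ∈ Ico (0:ℝ) 1 ∧ F x ∈ V := by intro x; simp [hI]
  have hrep : ∀ y : AddCircle (1:ℝ), ∃ x ∈ Ico (0:ℝ) 1, (x : AddCircle (1:ℝ)) = y := by
    intro y
    obtain ⟨x, hx, rfl⟩ := AddCircle.coe_image_Ico_eq (1:ℝ) 0 ▸ mem_univ y
    exact ⟨x, by simpa using hx, rfl⟩
  have hk : 0 < I.card := by
    rw [Finset.card_pos]
    obtain ⟨v, hv⟩ := hV
    have hne : (f ⁻¹' {v}).Nonempty := by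
      by_contra h
      rw [not_nonempty_iff_eq_empty] at h
      have := h2 v hv
      rw [h] at this
      simp at this
    obtain ⟨y, hy⟩ := hne
    obtain ⟨x, hx, rfl⟩ := hrep y
    exact ⟨x, (hmemI x).2 ⟨hx, by have : F x = v := hy
                                  rw [this]; exact hv⟩⟩
  set k := I.card with hkdef
  let e : Fin k ↪o ℝ := I.orderEmbOfFin rfl
  have he : ∀ i, e i ∈ I := fun i => Finset.orderEmbOfFin_mem _ _ _
  have hesurj : ∀ x ∈ I, ∃ i, e i = x := by
    intro x hx
    have := Finset.range_orderEmbOfFin I (rfl : I.card = k)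
    rw [← Finset.mem_coe, ← this] at hx
    exact hx
  let a : ℕ → ℝ := fun j => if h : j < k then e ⟨j, h⟩ else e ⟨0, hk⟩ + 1
  have ha : ∀ i : Fin k, a i = e i := fun i => by simp [a]
  have ha' : ∀ j (h : j < k), a j = e ⟨j, h⟩ := fun j h => by simp [a, h]
  have hak : a k = a 0 + 1 := by simp [a, hk]
  have he01 : ∀ i, e i ∈ Ico (0:ℝ) 1 := fun i => ((hmemI _).1 (he i)).1
  have hamono : ∀ j < k, a j < a (j + 1) := by
    intro j hj
    by_cases h : j + 1 < k
    · rw [ha' j hj, ha' _ h]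
      exact e.strictMono (by simp)
    · have : j + 1 = k := by omega
      rw [this, hak, ha' j hj, ha' 0 hk]
      linarith [(he01 ⟨j, hj⟩).2, (he01 ⟨0, hk⟩).1]
  have halt : ∀ j ≤ k, ∀ i < j, a i < a j := by
    intro j
    induction j with
    | zero => intro _ i hi; omega
    | succ j ih =>
      intro hj i hi
      rcases Nat.lt_succ_iff_lt_or_eq.1 hi with h | h
      · exact (ih (by omega) i h).trans (hamono j (by omega))
      · subst h; exact hamono _ (by omega)
  have hale : ∀ j ≤ k, ∀ i ≤ j, a i ≤ a j := by
    intro j hj i hi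
    rcases eq_or_lt_of_le hi with h | h
    · rw [h]
    · exact (halt j hj i h).le
  have haV : ∀ j ≤ k, F (a j) ∈ V := by
    intro j hj
    rcases eq_or_lt_of_le hj with h | h
    · rw [h, hak, hF1, ha' 0 hk]; exact ((hmemI _).1 (he _)).2
    · rw [ha' j h]; exact ((hmemI _).1 (he _)).2
  have hgap : ∀ i < k, ∀ y ∈ Ioo (a i) (a (i + 1)), F y ∉ V := by
    intro i hi y hy hyV
    have hi0 : 0 ≤ a i := by rw [ha' i hi]; exact (he01 _).1
    by_cases hy1 : y < 1
    · obtain ⟨m, rfl⟩ := hesurj y ((hmemI y).2 ⟨⟨hi0.trans hy.1.le, hy1⟩, hyV⟩)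
      rw [← ha m] at hy
      have h3 : i < m := by
        by_contra h
        exact absurd hy.1 (not_lt.2 (hale i hi.le m (not_lt.1 h)))
      exact absurd hy.2 (not_lt.2 (hale m m.2.le (i + 1) h3))
    · rw [not_lt] at hy1
      have hk1 : i + 1 = k := by
        by_contra h
        have h3 : i + 1 < k := by omega
        have := hy.2
        rw [ha' _ h3] at this
        linarith [(he01 ⟨i + 1, h3⟩).2]
      have hy2 := hy.2
      rw [hk1, hak] at hy2
      have h0 : a 0 < 1 := by rw [ha' 0 hk]; exact (he01 _).2
      have hFy : F (y - 1) = F y := by rw [← hF1 (y - 1)]; congr 1; ring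
      obtain ⟨m, hm⟩ := hesurj (y - 1) ((hmemI _).2 ⟨⟨by linarith, by linarith⟩, hFy ▸ hyV⟩)
      rw [← ha m] at hm
      have := hale m m.2.le 0 (Nat.zero_le _)
      linarith
  have hcov : ∀ j ≤ k, ∀ y, a 0 ≤ y → y < a j → ∃ i < j, a i ≤ y ∧ y < a (i + 1) := by
    intro j
    induction j with
    | zero => intro _ y h h'; linarith
    | succ j ih =>
      intro hj y h h'
      by_cases h3 : y < a j
      · obtain ⟨i, hi, h4⟩ := ih (by omega) y h h3
        exact ⟨i, by omega, h4⟩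
      · exact ⟨j, by omega, not_lt.1 h3, h'⟩
  let γ : Fin k → ℝ → X := fun i u => F (a i + u * (a (i + 1) - a i))
  have hγ0 : ∀ i, γ i 0 = F (a i) := fun i => by simp [γ]
  have hγ1 : ∀ i, γ i 1 = F (a (i + 1)) := fun i => by simp [γ]
  have hio : ∀ i : Fin k, ∀ u ∈ Ioo (0:ℝ) 1, a i + u * (a (i + 1) - a i) ∈ Ioo (a i) (a (i + 1)) := by
    intro i u hu
    have := hamono i i.2
    constructor <;> nlinarith [hu.1, hu.2]
  have h_int : ∀ i, ∀ u ∈ Ioo (0:ℝ) 1, γ i u ∉ V := fun i u hu => hgap i i.2 _ (hio i u hu)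
  -- the cyclic successor
  let nx : Fin k → Fin k := fun i => ⟨(i + 1) % k, Nat.mod_lt _ hk⟩
  have hnx : ∀ i, γ i 1 = γ (nx i) 0 := by
    intro i
    rw [hγ1, hγ0]
    simp only [nx]
    by_cases h : (i : ℕ) + 1 < k
    · rw [Nat.mod_eq_of_lt h]
    · have : (i : ℕ) + 1 = k := by have := i.2; omega
      rw [this, Nat.mod_self, hak, hF1]
  refine ⟨k, γ, hk, ?_, fun i => by rw [hγ0]; exact haV i i.2.le, fun i => by rw [hγ1]; exact haV _ i.2, h_int,
    ?_, ?_, ?_, ?_⟩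
  · intro i
    exact hFc.comp (continuous_const.add (continuous_id.mul continuous_const))
  · intro i j u hu v hv h
    have hui := hio i u hu
    have hvj := hio j v hv
    have hmem : ∀ l : Fin k, ∀ y ∈ Ioo (a l) (a (l + 1)), y ∈ Ico (a 0) (a 0 + 1) := by
      intro l y hy
      exact ⟨(hale l l.2.le 0 (Nat.zero_le _)).trans hy.1.le,
        hy.2.trans_le (hak ▸ hale k le_rfl _ l.2)⟩
    have h3 := h1 _ (h_int i u hu) (show _ ∈ f ⁻¹' {γ i u} from rfl)
      (show ((a j + v * (a (j + 1) - a j) : ℝ) : AddCircle (1:ℝ)) ∈ f ⁻¹' {γ i u} from h.symm)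
    have h4 := (AddCircle.coe_eq_coe_iff_of_mem_Ico (hmem i _ hui) (hmem j _ hvj)).1 h3
    have hij : i = j := by
      rw [h4] at hui
      by_contra hne
      rcases lt_or_gt_of_ne hne with hlt | hlt
      · have := hale j j.2.le (i + 1) hlt
        linarith [hui.2, hvj.1]
      · have := hale i i.2.le (j + 1) hlt
        linarith [hui.1, hvj.2]
    subst hij
    refine ⟨rfl, ?_⟩
    have h5 := hamono i i.2
    have h6 : (u - v) * (a (i + 1) - a i) = 0 := by linarith
    rcases mul_eq_zero.1 h6 with h7 | h7 <;> linarith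
  · apply Subset.antisymm
    · rintro z hz
      obtain ⟨i, u, hu, rfl⟩ := mem_iUnion.1 hz
      exact ⟨_, rfl⟩
    · rintro _ ⟨y, rfl⟩
      have : y ∈ (fun x : ℝ => (x : AddCircle (1:ℝ))) '' Ico (a 0) (a 0 + 1) := by
        rw [AddCircle.coe_image_Ico_eq (1:ℝ) (a 0)]; exact mem_univ y
      obtain ⟨x, hx, rfl⟩ := this
      obtain ⟨i, hi, hxi⟩ := hcov k le_rfl x hx.1 (hak ▸ hx.2)
      rw [mem_iUnion]
      have h3 := hamono i hi
      refine ⟨⟨i, hi⟩, (x - a i) / (a (i + 1) - a i), ⟨?_, ?_⟩, ?_⟩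
      · exact div_nonneg (by linarith) (by linarith)
      · rw [div_le_one (by linarith)]; linarith
      · change F _ = F _
        congr 1
        simp only
        rw [div_mul_cancel₀ _ (by linarith)]
        ring
  · intro v hv
    have hcount : (Finset.univ.filter (fun i : Fin k => γ i 0 = v)).card = 2 := by
      rw [← h2 v hv]
      have hfib : f ⁻¹' {v} = (fun i : Fin k => ((e i : ℝ) : AddCircle (1:ℝ))) ''
          (Finset.univ.filter (fun i : Fin k => γ i 0 = v) : Finset (Fin k)) := by
        ext y
        constructor
        · intro hy
          obtain ⟨x, hx, rfl⟩ := hrep y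
          have hy' : F x = v := hy
          obtain ⟨i, rfl⟩ := hesurj x ((hmemI x).2 ⟨hx, by rw [hy']; exact hv⟩)
          refine ⟨i, ?_, rfl⟩
          simp only [Finset.coe_filter, Finset.mem_univ, true_and]
          change γ i 0 = v
          rw [hγ0, ha]; exact hy'
        · rintro ⟨i, hi, rfl⟩
          rw [Finset.mem_coe, Finset.mem_filter, hγ0, ha] at hi
          exact hi.2
      rw [hfib, Nat.card_image_of_injOn]
      · exact (Nat.card_eq_card_toFinset _ |>.trans (by simp)).symm
      · intro i _ j _ h
        exact e.injective (hinjC (he01 i) (he01 j) h)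
    have hnxb : Function.Bijective nx := by
      rw [← Finite.injective_iff_bijective]
      intro i j h
      have h3 : ((i : ℕ) + 1) % k = (j + 1) % k := congrArg Fin.val h
      have hi := i.2
      have hj := j.2
      have h4 : ((i : ℕ)) % k = j % k := Nat.ModEq.add_right_cancel' 1 h3
      rw [Nat.mod_eq_of_lt hi, Nat.mod_eq_of_lt hj] at h4
      exact Fin.ext h4
    rw [degN, Finset.sum_add_distrib]
    have h3 : ∑ i : Fin k, (if γ i 1 = v then 1 else 0) = ∑ i : Fin k, (if γ i 0 = v then 1 else 0) := by
      simp only [hnx]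
      exact hnxb.sum_comp (fun i => if γ i 0 = v then 1 else 0)
    rw [h3, ← Finset.card_filter, hcount]
  · intro K _ hK hK'
    obtain ⟨i, hi, hni⟩ : ∃ i ∈ K, nx i ∉ K := by
      by_contra hcon
      push Not at hcon
      obtain ⟨i, hi⟩ := hK
      have hall : ∀ n : ℕ, (⟨(i + n) % k, Nat.mod_lt _ hk⟩ : Fin k) ∈ K := by
        intro n
        induction n with
        | zero => simpa [Nat.mod_eq_of_lt i.2] using hi
        | succ n ih =>
          have := hcon _ ih
          simp only [nx, Nat.mod_add_mod] at this
          exact this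
      obtain ⟨j, hj⟩ := hK'
      rw [Finset.mem_sdiff] at hj
      apply hj.2
      have := hall (k - i + j)
      have h3 : ((i : ℕ) + (k - i + j)) % k = j := by
        have hi := i.2
        have : (i : ℕ) + (k - i + j) = k + j := by omega
        rw [this, Nat.add_mod_left, Nat.mod_eq_of_lt j.2]
      simpa only [h3] using this
    refine ⟨γ i 1, Finset.mem_inter.2 ⟨(mem_vs _ _).2 ⟨i, hi, Or.inr rfl⟩, (mem_vs _ _).2 ⟨nx i, ?_, Or.inl (hnx i).symm⟩⟩⟩
    simpa using hni
end extract
end KP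

namespace KP

theorem fact3 : Fact (Module.finrank ℝ (EuclideanSpace ℝ (Fin 3)) = 2 + 1) := ⟨by simp⟩

theorem sphere_lc : LocallyConnectedSpace Sphere2 := by
  haveI := fact3
  exact ChartedSpace.locallyConnectedSpace (EuclideanSpace ℝ (Fin 2)) Sphere2

theorem stereo (q : Sphere2) : ∃ (σ : Sphere2 → ℂ) (τ : ℂ → Sphere2), Continuous τ ∧
    ContinuousOn σ {q}ᶜ ∧ (∀ z, σ (τ z) = z) ∧ (∀ x, x ≠ q → τ (σ x) = x) ∧ ∀ z, τ z ≠ q := by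
  haveI := fact3
  let e := stereographic' 2 q
  let b := Complex.orthonormalBasisOneI.repr
  have hs : e.source = {q}ᶜ := stereographic'_source q
  have ht : e.target = univ := stereographic'_target q
  refine ⟨fun x => b.symm (e x), fun z => e.symm (b z), ?_, ?_, ?_, ?_, ?_⟩
  · have : Continuous e.symm := by
      rw [← continuousOn_univ, ← ht]; exact e.continuousOn_symm
    exact this.comp b.continuous
  · exact b.symm.continuous.comp_continuousOn (hs ▸ e.continuousOn)
  · intro z
    have : e (e.symm (b z)) = b z := e.right_inv (by rw [ht]; trivial)
    simp only [this, LinearIsometryEquiv.symm_apply_apply]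
  · intro x hx
    simp only [LinearIsometryEquiv.apply_symm_apply]
    exact e.left_inv (by rw [hs]; exact hx)
  · intro z
    have : e.symm (b z) ∈ e.source := e.map_target (by rw [ht]; trivial)
    rw [hs] at this
    exact this

theorem F1_aux {Y U : Set Sphere2} {γ : ℝ → Sphere2} (hY : IsClosed Y) (hγ : Continuous γ)
    (h0 : γ 0 ∈ Y) (h1 : γ 1 ∈ Y) (h_int : ∀ u ∈ Ioo (0:ℝ) 1, γ u ∉ Y) (hinj : InjOn γ (Ioo 0 1))
    (hUo : IsOpen U) (hUc : IsPreconnected U) (hUY : Disjoint U Y) (hUγ : ∀ u ∈ Icc (0:ℝ) 1, γ u ∉ U)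
    (hfr : frontier U ⊆ Y ∪ γ '' Icc 0 1) {u u' : ℝ} (hu : 0 < u) (huu : u < u') (hu' : u' < 1)
    (hγu : γ u ∈ frontier U) : γ u' ∈ frontier U := by
  by_contra hcon
  have hcl : closure U = U ∪ frontier U := closure_eq_self_union_frontier U
  have hq' : γ u' ∉ closure U := by
    rw [hcl]
    rintro (h | h)
    · exact hUγ u' ⟨by linarith, by linarith⟩ h
    · exact hcon h
  -- a neighbourhood
  have hnb : γ ⁻¹' (closure U)ᶜ ∈ nhds u' :=
    (hγ.isOpen_preimage _ isClosed_closure.isOpen_compl).mem_nhds hq'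
  obtain ⟨ε, hε, hball⟩ := Metric.mem_nhds_iff.1 hnb
  obtain ⟨δ, hδ, hδε, hδu, hδ1⟩ : ∃ δ > 0, δ < ε ∧ δ < u' - u ∧ δ < 1 - u' := by
    refine ⟨min ε (min (u' - u) (1 - u')) / 2, ?_, ?_, ?_, ?_⟩
    · have : 0 < min ε (min (u' - u) (1 - u')) := lt_min hε (lt_min (by linarith) (by linarith))
      linarith
    all_goals
      have h1 : min ε (min (u' - u) (1 - u')) ≤ ε := min_le_left _ _
      have h2 : min ε (min (u' - u) (1 - u')) ≤ u' - u := (min_le_right _ _).trans (min_le_left _ _)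
      have h3 : min ε (min (u' - u) (1 - u')) ≤ 1 - u' := (min_le_right _ _).trans (min_le_right _ _)
      have : 0 < min ε (min (u' - u) (1 - u')) := lt_min hε (lt_min (by linarith) (by linarith))
      linarith
  set w := u' - δ with hw
  set v := u' + δ with hv
  set v0 := u' + δ / 2 with hv0
  have hwv : ∀ x ∈ Icc w v, γ x ∉ closure U := by
    intro x hx
    exact hball (by rw [Metric.mem_ball, Real.dist_eq, abs_lt]; constructor <;> linarith [hx.1, hx.2])
  obtain ⟨σ, τ, hτ, hσ, hστ, hτσ, hτq⟩ := stereo (γ v0)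
  -- injectivity on half-open intervals
  have hinj0 : ∀ a ∈ Ico (0:ℝ) 1, ∀ b ∈ Ioo (0:ℝ) 1, γ a = γ b → a = b := by
    intro a ha b hb h
    rcases eq_or_lt_of_le ha.1 with h' | h'
    · subst h'; exact absurd (h ▸ h0) (h_int b hb)
    · exact hinj ⟨h', ha.2⟩ hb h
  have hinj1 : ∀ a ∈ Ioc (0:ℝ) 1, ∀ b ∈ Ioo (0:ℝ) 1, γ a = γ b → a = b := by
    intro a ha b hb h
    rcases eq_or_lt_of_le ha.2 with h' | h'
    · subst h'; exact absurd (h ▸ h1) (h_int b hb)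
    · exact hinj ⟨ha.1, h'⟩ hb h
  have hneq : ∀ b ∈ Ioo (0:ℝ) 1, ∀ a ∈ Icc (0:ℝ) 1, a ≠ b → γ a ≠ γ b := by
    intro b hb a ha hab h
    rcases eq_or_lt_of_le ha.2 with h' | h'
    · exact hab (hinj1 a ⟨by linarith, ha.2⟩ b hb h)
    · exact hab (hinj0 a ⟨ha.1, h'⟩ b hb h)
  have hv0I : v0 ∈ Ioo (0:ℝ) 1 := ⟨by linarith, by linarith⟩
  have hu'I : u' ∈ Ioo (0:ℝ) 1 := ⟨by linarith, by linarith⟩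
  have hσinj : ∀ x, x ≠ γ v0 → ∀ y, y ≠ γ v0 → σ x = σ y → x = y := by
    intro x hx y hy h
    rw [← hτσ x hx, ← hτσ y hy, h]
  have hUne : U.Nonempty := by
    by_contra h
    rw [not_nonempty_iff_eq_empty] at h
    rw [h] at hγu; simp at hγu
  obtain ⟨x, hx⟩ := hUne
  have hUq : ∀ y ∈ U, y ≠ γ v0 := by
    rintro y hy rfl; exact hUγ v0 ⟨by linarith, by linarith⟩ hy
  set r := σ x with hr
  set q := σ (γ u') with hq
  have hτr : τ r = x := hτσ x (hUq x hx)
  have hu'v : γ u' ≠ γ v0 := hneq v0 hv0I u' ⟨by linarith, by linarith⟩ (by linarith)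
  have hτq' : τ q = γ u' := hτσ _ hu'v
  -- the connecting set
  set C := U ∪ γ '' Icc u u' with hC
  have hCp : IsPreconnected C := by
    refine preconnected_union_of_frontier hUc (isPreconnected_Icc.image _ hγ.continuousOn)
      (x := γ u) (frontier_subset_closure hγu) ⟨u, ⟨le_rfl, huu.le⟩, rfl⟩
  have hCq : ∀ y ∈ C, y ≠ γ v0 := by
    rintro y (hy | ⟨a, ha, rfl⟩)
    · exact hUq y hy
    · exact hneq v0 hv0I a ⟨by linarith [ha.1], by linarith [ha.2]⟩ (by linarith [ha.2])
  have hCY : Disjoint C Y := by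
    rw [hC, disjoint_union_left]
    refine ⟨hUY, ?_⟩
    rw [disjoint_left]
    rintro _ ⟨a, ha, rfl⟩
    exact h_int a ⟨by linarith [ha.1], by linarith [ha.2]⟩
  have hlogY : HasLog (τ ⁻¹' Y) (fun z => (z - r) / (z - q)) := by
    refine lemmaE (C := σ '' C) (hY.preimage hτ) (hCp.image _ (hσ.mono fun y hy => hCq y hy)) ?_
      ⟨x, Or.inl hx, rfl⟩ ⟨γ u', Or.inr ⟨u', ⟨huu.le, le_rfl⟩, rfl⟩, rfl⟩
    rw [disjoint_left]
    rintro _ ⟨y, hy, rfl⟩ h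
    rw [mem_preimage, hτσ y (hCq y hy)] at h
    exact disjoint_left.1 hCY hy h
  have harc : ∀ a b, a ≤ b → 0 ≤ a → b ≤ 1 → u' ∉ Icc a b → v0 ∉ Icc a b → InjOn γ (Icc a b) →
      HasLog ((σ ∘ γ) '' Icc a b) (fun z => (z - r) / (z - q)) ∧ IsClosed ((σ ∘ γ) '' Icc a b) ∧
      r ∉ (σ ∘ γ) '' Icc a b ∧ q ∉ (σ ∘ γ) '' Icc a b := by
    intro a b hab ha hb hu'n hv0n hi
    have hne : ∀ y ∈ Icc a b, γ y ≠ γ v0 := by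
      intro y hy
      refine hneq v0 hv0I y ⟨ha.trans hy.1, hy.2.trans hb⟩ ?_
      rintro rfl; exact hv0n hy
    have hc : ContinuousOn (σ ∘ γ) (Icc a b) := hσ.comp hγ.continuousOn hne
    have hrn : r ∉ (σ ∘ γ) '' Icc a b := by
      rintro ⟨y, hy, h⟩
      have := hσinj _ (hne y hy) x (hUq x hx) h
      exact hUγ y ⟨ha.trans hy.1, hy.2.trans hb⟩ (this ▸ hx)
    have hqn : q ∉ (σ ∘ γ) '' Icc a b := by
      rintro ⟨y, hy, h⟩
      have := hσinj _ (hne y hy) _ hu'v h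
      refine hneq u' hu'I y ⟨ha.trans hy.1, hy.2.trans hb⟩ ?_ this
      rintro rfl; exact hu'n hy
    have hrz : ∀ z ∈ (σ ∘ γ) '' Icc a b, z - r ≠ 0 := fun z hz h => hrn (sub_eq_zero.1 h ▸ hz)
    have hqz : ∀ z ∈ (σ ∘ γ) '' Icc a b, z - q ≠ 0 := fun z hz h => hqn (sub_eq_zero.1 h ▸ hz)
    refine ⟨hasLog_arc hab hc ?_ ?_ ?_, (isCompact_Icc.image_of_continuousOn hc).isClosed, hrn, hqn⟩
    · intro y hy y' hy' h
      exact hi hy hy' (hσinj _ (hne y hy) _ (hne y' hy') h)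
    · exact (continuousOn_id.sub continuousOn_const).div (continuousOn_id.sub continuousOn_const) hqz
    · intro z hz
      exact div_ne_zero (hrz z hz) (hqz z hz)
  obtain ⟨hl1, hc1, hr1, hq1⟩ := harc 0 w (by linarith) le_rfl (by linarith) (fun h => by linarith [h.2])
    (fun h => by linarith [h.2]) (by
      intro a ha b hb h
      rcases eq_or_lt_of_le hb.1 with h' | h'
      · subst h'
        rcases eq_or_lt_of_le ha.1 with h'' | h''
        · exact h''.symm
        · exact (hinj0 0 ⟨le_rfl, by linarith⟩ a ⟨h'', by linarith [ha.2]⟩ h.symm).symm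
      · exact hinj0 a ⟨ha.1, by linarith [ha.2]⟩ b ⟨h', by linarith [hb.2]⟩ h)
  obtain ⟨hl2, hc2, hr2, hq2⟩ := harc v 1 (by linarith) (by linarith) le_rfl (fun h => by linarith [h.1])
    (fun h => by linarith [h.1]) (by
      intro a ha b hb h
      rcases eq_or_lt_of_le hb.2 with h' | h'
      · subst h'
        rcases eq_or_lt_of_le ha.2 with h'' | h''
        · exact h''
        · exact (hinj1 1 ⟨by linarith, le_rfl⟩ a ⟨by linarith [ha.1], h''⟩ h.symm).symm
      · exact hinj1 a ⟨by linarith [ha.1], ha.2⟩ b ⟨by linarith [hb.1], h'⟩ h)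
  have hYc : IsClosed (τ ⁻¹' Y) := hY.preimage hτ
  have hne1 : ∀ y ∈ Icc 0 w, γ y ≠ γ v0 := fun y hy =>
    hneq v0 hv0I y ⟨hy.1, by linarith [hy.2]⟩ (by linarith [hy.2])
  have hne2 : ∀ y ∈ Icc v 1, γ y ≠ γ v0 := fun y hy =>
    hneq v0 hv0I y ⟨by linarith [hy.1], by linarith [hy.2]⟩ (by linarith [hy.1])
  have hlog1 := hl1 |> hlogY.union_subsingleton hYc hc1 <| by
    have : ∀ z ∈ τ ⁻¹' Y ∩ (σ ∘ γ) '' Icc 0 w, z = σ (γ 0) := by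
      rintro z ⟨hz, a, ha, rfl⟩
      rw [mem_preimage, Function.comp, hτσ _ (hne1 a ha)] at hz
      rcases eq_or_lt_of_le ha.1 with h' | h'
      · subst h'; rfl
      · exact absurd hz (h_int a ⟨h', by linarith [ha.2]⟩)
    intro z hz z' hz'
    rw [this z hz, this z' hz']
  have hlog2 := hl2 |> hlog1.union_subsingleton (hYc.union hc1) hc2 <| by
    have : ∀ z ∈ (τ ⁻¹' Y ∪ (σ ∘ γ) '' Icc 0 w) ∩ (σ ∘ γ) '' Icc v 1, z = σ (γ 1) := by
      rintro z ⟨hz, a, ha, rfl⟩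
      rcases eq_or_lt_of_le ha.2 with h' | h'
      · subst h'; rfl
      · rcases hz with hz | ⟨b, hb, hz⟩
        · rw [mem_preimage, Function.comp, hτσ _ (hne2 a ha)] at hz
          exact absurd hz (h_int a ⟨by linarith [ha.1], h'⟩)
        · have := hσinj _ (hne1 b hb) _ (hne2 a ha) hz
          have := hinj0 b ⟨hb.1, by linarith [hb.2]⟩ a ⟨by linarith [ha.1], h'⟩ this
          linarith [hb.2, ha.1]
    intro z hz z' hz'
    rw [this z hz, this z' hz']
  classical
  have hclq : ∀ y ∈ closure U, y ≠ γ v0 := by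
    rintro y hy rfl; exact hwv v0 ⟨by linarith, by linarith⟩ hy
  have hfin := lemmaB (Finset.univ : Finset Bool) (fun b => if b then r else q) (fun b => if b then 1 else -1)
    (X := (τ ⁻¹' Y ∪ (σ ∘ γ) '' Icc 0 w) ∪ (σ ∘ γ) '' Icc v 1) (U := τ ⁻¹' U)
    ((hYc.union hc1).union hc2) (hUo.preimage hτ) ?_ ?_ ?_ ?_
  · have hrU : τ r ∈ U := by rw [hτr]; exact hx
    have hqU : τ q ∉ U := by rw [hτq']; exact hUγ _ ⟨by linarith, by linarith⟩
    rw [Finset.sum_filter] at hfin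
    simp [hrU, hqU] at hfin
  · have hcomp : IsCompact (σ '' closure U) :=
      isClosed_closure.isCompact.image_of_continuousOn (hσ.mono hclq)
    refine hcomp.isBounded.subset ?_
    intro z hz
    exact ⟨τ z, subset_closure hz, hστ z⟩
  · intro z hz
    have hz' : τ z ∈ frontier U := hτ.frontier_preimage_subset U hz
    rcases hfr hz' with h | ⟨a, ha, h⟩
    · exact Or.inl (Or.inl h)
    · have haz : (σ ∘ γ) a = z := by rw [Function.comp, h, hστ]
      have hna : a ∉ Icc w v := fun h' => hwv a h' (h ▸ frontier_subset_closure hz')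
      rw [mem_Icc, not_and_or, not_le, not_le] at hna
      rcases hna with h' | h'
      · exact Or.inl (Or.inr ⟨a, ⟨ha.1, h'.le⟩, haz⟩)
      · exact Or.inr ⟨a, ⟨h'.le, ha.2⟩, haz⟩
  · have hrY : τ r ∉ Y := by rw [hτr]; exact disjoint_left.1 hUY hx
    have hqY : τ q ∉ Y := by rw [hτq']; exact h_int _ hu'I
    intro b _ hb
    cases b
    · rcases hb with (h | h) | h
      · exact hqY (by simpa using h)
      · exact hq1 (by simpa using h)
      · exact hq2 (by simpa using h)
    · rcases hb with (h | h) | h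
      · exact hrY (by simpa using h)
      · exact hr1 (by simpa using h)
      · exact hr2 (by simpa using h)
  · refine hlog2.congr fun z _ => ?_
    simp [div_eq_mul_inv]

theorem F1 {Y U : Set Sphere2} {γ : ℝ → Sphere2} (hY : IsClosed Y) (hγ : Continuous γ)
    (h0 : γ 0 ∈ Y) (h1 : γ 1 ∈ Y) (h_int : ∀ u ∈ Ioo (0:ℝ) 1, γ u ∉ Y) (hinj : InjOn γ (Ioo 0 1))
    (hUo : IsOpen U) (hUc : IsPreconnected U) (hUY : Disjoint U Y) (hUγ : ∀ u ∈ Icc (0:ℝ) 1, γ u ∉ U)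
    (hfr : frontier U ⊆ Y ∪ γ '' Icc 0 1) {u : ℝ} (hu : u ∈ Ioo (0:ℝ) 1)
    (hγu : γ u ∈ frontier U) : γ 0 ∈ frontier U := by
  have hcl : IsClosed (γ ⁻¹' frontier U) := isClosed_frontier.preimage hγ
  have hsub : Ioo 0 u ⊆ γ ⁻¹' frontier U := by
    intro x hx
    have himg : (fun y => γ (1 - y)) '' Icc 0 1 = γ '' Icc 0 1 := by
      have : (fun y => γ (1 - y)) = γ ∘ (fun y => 1 - y) := rfl
      rw [this, image_comp]; simp
    have := F1_aux (γ := fun y => γ (1 - y)) (u := 1 - u) (u' := 1 - x) hY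
      (hγ.comp (continuous_const.sub continuous_id)) (by simpa using h1) (by simpa using h0)
      (fun y hy => h_int _ ⟨by linarith [hy.2], by linarith [hy.1]⟩) ?_ hUo hUc hUY
      (fun y hy => hUγ _ ⟨by linarith [hy.2], by linarith [hy.1]⟩) (by rw [himg]; exact hfr)
      (by linarith [hu.2]) (by linarith [hx.2]) (by linarith [hx.1]) (by simpa using hγu)
    · simpa using this
    · intro a ha b hb h
      have := hinj (x₁ := 1 - a) (x₂ := 1 - b) ⟨by linarith [ha.2], by linarith [ha.1]⟩
        ⟨by linarith [hb.2], by linarith [hb.1]⟩ h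
      linarith
  have h2 := hcl.closure_subset_iff.2 hsub
  rw [closure_Ioo hu.1.ne] at h2
  exact h2 ⟨le_rfl, hu.1.le⟩
end KP

namespace KP

theorem curve_interior (f : C(AddCircle (1:ℝ), Sphere2)) {V : Set Sphere2} (hV : V.Finite)
    (h1 : ∀ v ∉ V, (f ⁻¹' {v}).Subsingleton) {W : Set Sphere2} (hW : IsOpen W) (hne : W.Nonempty) :
    ∃ x ∈ W, x ∉ range f := by
  by_contra hcon
  push Not at hcon
  obtain ⟨w, hw⟩ := hne
  obtain ⟨σ, τ, hτ, hσ, hστ, hτσ, hτq⟩ := stereo (-w)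
  have hτinj : Function.Injective τ := Function.LeftInverse.injective hστ
  have hwne : w ≠ -w := by
    intro h
    have h2 : (w : EuclideanSpace ℝ (Fin 3)) = -w := by
      conv_lhs => rw [h]
      rfl
    have h3 : ‖(w : EuclideanSpace ℝ (Fin 3))‖ = 1 := norm_eq_of_mem_sphere w
    have h4 : (w : EuclideanSpace ℝ (Fin 3)) = 0 := by
      have h5 := eq_neg_iff_add_eq_zero.1 h2
      rw [← two_smul ℝ] at h5
      exact (smul_eq_zero.1 h5).resolve_left two_ne_zero
    rw [h4] at h3; simp at h3
  have hVf : (insert (f 0) V).Finite := hV.insert _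
  have hV' : (τ ⁻¹' (insert (f 0) V)).Finite := hVf.preimage hτinj.injOn
  have hO : IsOpen (τ ⁻¹' W \ τ ⁻¹' (insert (f 0) V)) := (hW.preimage hτ).sdiff hV'.isClosed
  have hOne : (τ ⁻¹' W \ τ ⁻¹' (insert (f 0) V)).Nonempty := by
    have hd : Dense (univ \ τ ⁻¹' (insert (f 0) V) : Set ℂ) := dense_univ.diff_finite hV'
    obtain ⟨z, hz⟩ := hd.inter_open_nonempty _ (hW.preimage hτ) ⟨σ w, by rw [mem_preimage, hτσ w hwne]; exact hw⟩
    exact ⟨z, hz.1, hz.2.2⟩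
  obtain ⟨z0, hz0⟩ := hOne
  obtain ⟨ε, hε, hball⟩ := Metric.isOpen_iff.1 hO z0 hz0
  set r := ε / 2 with hr
  let c : ℝ → ℂ := circleMap z0 r
  have hcc : Continuous c := continuous_circleMap z0 r
  have hcball : ∀ θ, c θ ∈ Metric.closedBall z0 r := fun θ =>
    circleMap_mem_closedBall z0 (by positivity) θ
  set D := Metric.closedBall z0 r with hD
  have hDsub : D ⊆ τ ⁻¹' W \ τ ⁻¹' (insert (f 0) V) :=
    (Metric.closedBall_subset_ball (by linarith)).trans hball
  let F : ℝ → Sphere2 := fun x => f (x : AddCircle (1:ℝ))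
  have hFc : Continuous F := f.continuous.comp (AddCircle.continuous_mk' 1)
  have hDc : IsCompact (τ '' D) := (isCompact_closedBall z0 r).image hτ
  set S : Set ℝ := Icc 0 1 ∩ F ⁻¹' (τ '' D) with hS
  have hSc : IsCompact S := isCompact_Icc.inter_right (hDc.isClosed.preimage hFc)
  have hnotD : ∀ y ∈ insert (f 0) V, y ∉ τ '' D := by
    rintro y hy ⟨z, hz, rfl⟩
    exact (hDsub hz).2 hy
  have hSinj : InjOn F S := by
    intro x hx y hy h
    have hF1 : F 1 = f 0 := by
      have := AddCircle.coe_period (1:ℝ)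
      simp only [F, this]
    have hlt : ∀ x ∈ S, x ∈ Ico (0:ℝ) (0 + 1) := by
      intro x hx
      refine ⟨hx.1.1, ?_⟩
      rw [zero_add]
      refine lt_of_le_of_ne hx.1.2 ?_
      rintro rfl
      exact hnotD _ (mem_insert _ _) (hF1 ▸ hx.2)
    have hnv : F x ∉ V := fun h => hnotD _ (mem_insert_of_mem _ h) hx.2
    have := h1 _ hnv (show (x : AddCircle (1:ℝ)) ∈ f ⁻¹' {F x} from rfl)
      (show (y : AddCircle (1:ℝ)) ∈ f ⁻¹' {F x} from h.symm)
    exact (AddCircle.coe_eq_coe_iff_of_mem_Ico (hlt x hx) (hlt y hy)).1 this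
  haveI : CompactSpace S := isCompact_iff_compactSpace.1 hSc
  have hemb : Topology.IsClosedEmbedding (S.domRestrict F) :=
    (continuousOn_iff_continuous_domRestrict.1 hFc.continuousOn).isClosedEmbedding
      (injOn_iff_injective.1 hSinj)
  have hex : ∀ θ : ℝ, ∃ x : S, S.domRestrict F x = τ (c θ) := by
    intro θ
    obtain ⟨y, hy⟩ := hcon (τ (c θ)) (hDsub (hcball θ)).1
    obtain ⟨x, hx, rfl⟩ := AddCircle.coe_image_Ico_eq (1:ℝ) 0 ▸ mem_univ y
    refine ⟨⟨x, ⟨hx.1, by have := hx.2; linarith⟩, ?_⟩, hy⟩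
    exact ⟨c θ, hcball θ, hy.symm⟩
  choose G hG using hex
  have hGc : Continuous G := by
    rw [hemb.isEmbedding.continuous_iff]
    have : S.domRestrict F ∘ G = τ ∘ c := funext hG
    rw [this]; exact hτ.comp hcc
  -- antipodal points
  let H : ℝ → ℝ := fun θ => (G θ : ℝ) - G (θ + Real.pi)
  have hHc : Continuous H := (continuous_subtype_val.comp hGc).sub
    (continuous_subtype_val.comp (hGc.comp (continuous_id.add continuous_const)))
  have hGper : ∀ θ, G (θ + Real.pi + Real.pi) = G θ := by
    intro θ
    apply hemb.injective
    rw [hG, hG]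
    congr 1
    have := periodic_circleMap z0 r θ
    simp only [c]
    rw [← this]; congr 1; ring
  have hH : H (0 + Real.pi) = - H 0 := by
    simp only [H]
    rw [hGper 0]; ring
  obtain ⟨θ, hθ⟩ : ∃ θ, H θ = 0 := by
    have h0 : (0:ℝ) ∈ uIcc (H 0) (H (0 + Real.pi)) := by
      rw [hH, mem_uIcc]
      rcases le_total 0 (H 0) with h | h
      · right; constructor <;> linarith
      · left; constructor <;> linarith
    obtain ⟨θ, -, h⟩ := intermediate_value_uIcc hHc.continuousOn h0
    exact ⟨θ, h⟩
  have hGG : G θ = G (θ + Real.pi) := Subtype.ext (sub_eq_zero.1 hθ)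
  have hττ : τ (c θ) = τ (c (θ + Real.pi)) := by rw [← hG, ← hG, hGG]
  have hcθ := hτinj hττ
  simp only [c, circleMap, add_right_inj] at hcθ
  have hrne : (r : ℂ) ≠ 0 := by
    rw [Complex.ofReal_ne_zero]; positivity
  have := mul_left_cancel₀ hrne hcθ
  push_cast at this
  rw [add_mul, Complex.exp_add, Complex.exp_pi_mul_I] at this
  have hne0 := Complex.exp_ne_zero (θ * Complex.I)
  apply hne0
  linear_combination this / 2
end KP

namespace KP

theorem fiber_subsingleton (P : KnotProjection) {v : Sphere2} (hv : v ∉ P.crossings) :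
    (P.f ⁻¹' {v}).Subsingleton := by
  have h1 := P.fibers_le_two v
  have h2 : Nat.card (P.f ⁻¹' {v} : Set Param) ≠ 2 := hv
  have h3 : Nat.card (P.f ⁻¹' {v} : Set Param) ≤ 1 := by omega
  haveI : Finite (P.f ⁻¹' {v} : Set Param) := P.fibers_finite v
  have := Finite.card_le_one_iff_subsingleton.1 h3
  exact (subsingleton_coe _).1 this

theorem crossings_fin (P : KnotProjection) : P.crossings.Finite := P.crossings_finite

theorem extract_knot (P : KnotProjection) [DecidableEq Sphere2] :
    ∃ (k : ℕ) (γ : Fin k → ℝ → Sphere2), 0 < k ∧ (∀ i, Continuous (γ i)) ∧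
      (∀ i, γ i 0 ∈ (crossings_fin P).toFinset) ∧ (∀ i, γ i 1 ∈ (crossings_fin P).toFinset) ∧
      (∀ i, ∀ u ∈ Ioo (0:ℝ) 1, γ i u ∉ (crossings_fin P).toFinset) ∧
      (∀ i j, ∀ u ∈ Ioo (0:ℝ) 1, ∀ v ∈ Ioo (0:ℝ) 1, γ i u = γ j v → i = j ∧ u = v) ∧
      (⋃ i, γ i '' Icc 0 1) = P.image ∧
      (∀ v ∈ (crossings_fin P).toFinset, degN (fun i => γ i 0) (fun i => γ i 1) Finset.univ v = 4) ∧
      Conn (fun i => γ i 0) (fun i => γ i 1) Finset.univ := by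
  refine extract P.f (crossings_fin P).toFinset ?_ (fun v _ => P.fibers_finite v) ?_ ?_
  · obtain ⟨p, hp⟩ := P.exists_crossing
    exact ⟨p, (Finite.mem_toFinset _).2 hp⟩
  · intro v hv
    have h : v ∈ P.crossings := (Finite.mem_toFinset (crossings_fin P)).1 hv
    exact h
  · intro v hv
    exact fiber_subsingleton P (fun h => hv ((Finite.mem_toFinset _).2 h))

theorem step (P : KnotProjection) (hN : 4 ≤ P.crossingNumber) :
    ∃ P' : KnotProjection, P'.image ⊆ P.image ∧ P'.crossingNumber < P.crossingNumber ∧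
      P.crossingNumber ≤ P'.crossingNumber + 3 := by
  classical
  obtain ⟨k, γ, hk, hcont, hs, ht, h_int, hinj, himg, hdeg, hconn⟩ := extract_knot P
  set V := (crossings_fin P).toFinset with hV
  have hVcard : V.card = P.crossingNumber := by
    rw [KnotProjection.crossingNumber, Nat.card_eq_card_finite_toFinset (crossings_fin P)]
  set s : Fin k → Sphere2 := fun i => γ i 0 with hsdef
  set t : Fin k → Sphere2 := fun i => γ i 1 with htdef
  have hvsV : ∀ S, vs s t S ⊆ V := by
    intro S v hv
    obtain ⟨i, -, h | h⟩ := (mem_vs s t).1 hv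
    · rw [← h]; exact hs i
    · rw [← h]; exact ht i
  obtain ⟨q0, -, hq0⟩ := curve_interior P.f (crossings_fin P) (fun v hv => fiber_subsingleton P hv)
    isOpen_univ ⟨P.f 0, trivial⟩
  have hγq : ∀ i, ∀ u ∈ Icc (0:ℝ) 1, γ i u ≠ q0 := by
    intro i u hu h
    apply hq0
    have : γ i u ∈ P.image := himg ▸ mem_iUnion.2 ⟨i, u, hu, rfl⟩
    rw [h] at this; exact this
  obtain ⟨σ, τ, hτ, hσ, hστ, hτσ, hτq⟩ := stereo q0
  have hσinj : ∀ x, x ≠ q0 → ∀ y, y ≠ q0 → σ x = σ y → x = y := by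
    intro x hx y hy h
    rw [← hτσ x hx, ← hτσ y hy, h]
  have hVq : ∀ v ∈ V, v ≠ q0 := by
    rintro v hv rfl
    apply hq0
    have h2 : Nat.card (P.f ⁻¹' {v} : Set Param) = 2 := (Finite.mem_toFinset (crossings_fin P)).1 hv
    by_contra hno
    have : (P.f ⁻¹' {v} : Set Param) = ∅ := by
      ext y; simp only [mem_preimage, mem_singleton_iff, mem_empty_iff_false, iff_false]
      intro hy; exact hno ⟨y, hy⟩
    rw [this] at h2; simp at h2
  have h01 : (0:ℝ) ∈ Icc (0:ℝ) 1 := by simp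
  have h11 : (1:ℝ) ∈ Icc (0:ℝ) 1 := by simp
  haveI : Nonempty (Fin k) := ⟨⟨0, hk⟩⟩
  obtain ⟨Z, hZ, hZbd, hZ3, hZc⟩ := comb_step s t
    (fun v hv => hdeg v (hvsV _ hv)) hconn (by
      intro S W hW hSW hcard
      have hSne : S.Nonempty := by
        rw [← Finset.card_pos]; have := Finset.card_pos.2 hW; omega
      let clampc : ℝ → ℝ := fun u => max 0 (min 1 u)
      have hclc : Continuous clampc := continuous_const.max (continuous_const.min continuous_id)
      have hcl01 : ∀ u, clampc u ∈ Icc (0:ℝ) 1 := fun u =>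
        ⟨le_max_left _ _, max_le zero_le_one (min_le_left _ _)⟩
      have hcleq : ∀ u ∈ Icc (0:ℝ) 1, clampc u = u := by
        intro u hu
        simp only [clampc]; rw [min_eq_right hu.2, max_eq_right hu.1]
      let A : ArcSys S :=
        { γ := fun i u => σ (γ i (clampc u))
          V := (W ∩ V).image σ
          cont := fun i => by
            rw [← continuousOn_univ]
            exact hσ.comp ((hcont i).comp hclc).continuousOn (fun u _ => hγq i _ (hcl01 u))
          s_mem := fun i => by
            rw [hcleq 0 h01]
            refine Finset.mem_image_of_mem _ (Finset.mem_inter.2 ⟨hSW ?_, hs i⟩)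
            exact (mem_vs s t).2 ⟨i, i.2, Or.inl rfl⟩
          t_mem := fun i => by
            rw [hcleq 1 h11]
            refine Finset.mem_image_of_mem _ (Finset.mem_inter.2 ⟨hSW ?_, ht i⟩)
            exact (mem_vs s t).2 ⟨i, i.2, Or.inr rfl⟩
          int_notMem := fun i u hu => by
            rw [hcleq u ⟨hu.1.le, hu.2.le⟩]
            intro h
            obtain ⟨v, hv, h⟩ := Finset.mem_image.1 h
            rw [Finset.mem_inter] at hv
            have := hσinj _ (hVq v hv.2) _ (hγq i u ⟨hu.1.le, hu.2.le⟩) h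
            exact h_int i u hu (this ▸ hv.2)
          inj := fun i j u hu v hv h => by
            rw [hcleq u ⟨hu.1.le, hu.2.le⟩, hcleq v ⟨hv.1.le, hv.2.le⟩] at h
            have := hinj i j u hu v hv (hσinj _ (hγq i u ⟨hu.1.le, hu.2.le⟩) _ (hγq j v ⟨hv.1.le, hv.2.le⟩) h)
            exact ⟨Subtype.ext this.1, this.2⟩ }
      have hA0 : ∀ i, A.γ i 0 = σ (s i) := fun i => by
        change σ (γ i (clampc 0)) = _; rw [hcleq 0 h01]
      have hA1 : ∀ i, A.γ i 1 = σ (t i) := fun i => by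
        change σ (γ i (clampc 1)) = _; rw [hcleq 1 h11]
      have hAV : A.V.Nonempty := by
        obtain ⟨e, he⟩ := hSne
        exact ⟨_, A.s_mem ⟨e, he⟩⟩
      have hAc : 2 * A.V.card ≤ Fintype.card S + 1 := by
        have h1 : A.V.card ≤ W.card :=
          Finset.card_image_le.trans (Finset.card_le_card Finset.inter_subset_left)
        rw [Fintype.card_coe]
        omega
      obtain ⟨Z, hZ, hZ3, hbd⟩ := A.planar_lemma hAV hAc
      refine ⟨Z.map (Function.Embedding.subtype _), ?_, by simpa using hZ, by simpa using hZ3, ?_⟩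
      · intro i hi
        obtain ⟨j, -, rfl⟩ := Finset.mem_map.1 hi
        exact j.2
      · intro v
        by_cases hv : v = q0
        · rw [bd, Finset.sum_eq_zero]
          intro i _
          have h1 : s i ≠ v := hv ▸ hγq i 0 h01
          have h2 : t i ≠ v := hv ▸ hγq i 1 h11
          simp [inc, h1, h2]
        · rw [← hbd (σ v), bd, bd, Finset.sum_map]
          refine Finset.sum_congr rfl fun i _ => ?_
          have e1 : (A.γ i 0 = σ v) ↔ (s i = v) := by
            rw [hA0]; exact ⟨fun h => hσinj _ (hγq i 0 h01) _ hv h, fun h => by rw [h]⟩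
          have e2 : (A.γ i 1 = σ v) ↔ (t i = v) := by
            rw [hA1]; exact ⟨fun h => hσinj _ (hγq i 1 h11) _ hv h, fun h => by rw [h]⟩
          simp only [inc, e1, e2]
          rfl)
  -- degrees in the complement
  have hdegZ : ∀ v ∈ V, degN s t Zᶜ v = 4 ↔ v ∉ vs s t Z := by
    intro v hv
    have h1 := degN_add_compl s t Z v
    rw [hdeg v hv] at h1
    rw [← degN_pos s t (K := Z)]
    omega
  have hZv : (vs s t Z).Nonempty := vs_nonempty s t hZ
  have hsdc : (V \ vs s t Z).card = V.card - (vs s t Z).card := Finset.card_sdiff_of_subset (hvsV Z)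
  obtain ⟨v0, hv0⟩ : (V \ vs s t Z).Nonempty := by
    rw [← Finset.card_pos]; omega
  rw [Finset.mem_sdiff] at hv0
  have hZcne : Zᶜ.Nonempty := by
    have h1 := (hdegZ v0 hv0.1).2 hv0.2
    by_contra h
    rw [Finset.not_nonempty_iff_eq_empty] at h
    rw [h] at h1; simp [degN] at h1
  have hZcbd : ∀ v, bd s t Zᶜ v = 0 := by
    intro v
    have h1 := hZbd v
    have h2 := degN_add_compl s t Z v
    have h3 : ((degN s t Finset.univ v : ℕ) : ZMod 2) = 0 := by
      by_cases hv : v ∈ V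
      · rw [hdeg v hv]; decide
      · have : ¬ 0 < degN s t Finset.univ v := fun h => hv (hvsV _ ((degN_pos s t).1 h))
        have : degN s t Finset.univ v = 0 := by omega
        rw [this]; simp
    rw [bd_eq_cast] at h1 ⊢
    rw [← h2] at h3
    push_cast at h3
    rw [h1, zero_add] at h3
    exact h3
  obtain ⟨f, hfr, hfV, hfn⟩ := euler_param hcont hs h_int hinj ht hZcne hZc hZcbd
  have hcr : ∀ v, Nat.card (f ⁻¹' {v}) = 2 ↔ v ∈ V \ vs s t Z := by
    intro v
    rw [Finset.mem_sdiff]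
    by_cases hv : v ∈ V
    · have h1 := (hfV v hv).2
      have h2 := hdegZ v hv
      change 2 * Nat.card (f ⁻¹' {v}) = degN s t Zᶜ v at h1
      rw [← h2]
      constructor
      · intro h; exact ⟨hv, by omega⟩
      · rintro ⟨-, h⟩; omega
    · have h1 : Nat.card (f ⁻¹' {v}) ≤ 1 := by
        haveI := (subsingleton_coe _).2 (hfn v hv)
        exact Finite.card_le_one_iff_subsingleton.2 this
      constructor
      · intro h; omega
      · rintro ⟨h, -⟩; exact absurd h hv
  have hcrset : {p : Sphere2 | Nat.card (f ⁻¹' {p} : Set Param) = 2} = ↑(V \ vs s t Z) := by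
    ext v
    exact hcr v
  let P' : KnotProjection :=
    { f := f
      fibers_finite := fun p => by
        by_cases hv : p ∈ V
        · exact (hfV p hv).1
        · exact (hfn p hv).finite
      fibers_le_two := fun p => by
        by_cases hv : p ∈ V
        · have h1 := (hfV p hv).2
          have h2 := degN_add_compl s t Z p
          rw [hdeg p hv] at h2
          change 2 * Nat.card (f ⁻¹' {p}) = degN s t Zᶜ p at h1
          omega
        · haveI := (subsingleton_coe _).2 (hfn p hv)
          exact (Finite.card_le_one_iff_subsingleton.2 this).trans (by norm_num)
      crossings_finite := hcrset ▸ Finset.finite_toSet _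
      exists_crossing := ⟨v0, (hcr v0).2 (Finset.mem_sdiff.2 hv0)⟩ }
  have hP'n : P'.crossingNumber = (V \ vs s t Z).card := by
    have : P'.crossings = ↑(V \ vs s t Z) := hcrset
    rw [KnotProjection.crossingNumber, this]
    exact Nat.card_eq_card_toFinset _ |>.trans (by simp)
  have hle := Finset.card_le_card (hvsV Z)
  have hpos := Finset.card_pos.2 hZv
  refine ⟨P', ?_, by omega, by omega⟩
  change range f ⊆ P.image
  rw [hfr, ← himg]
  exact iUnion₂_subset fun i _ => subset_iUnion (fun i => γ i '' Icc 0 1) i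

theorem reduce (n : ℕ) (hn : 0 < n) : ∀ (N : ℕ) (P : KnotProjection), P.crossingNumber = N → n ≤ N →
    ∃ P' : KnotProjection, P'.image ⊆ P.image ∧ n ≤ P'.crossingNumber ∧ P'.crossingNumber ≤ n + 2 := by
  intro N
  induction N using Nat.strong_induction_on with
  | _ N ih =>
    intro P hP hnN
    by_cases h : N ≤ n + 2
    · exact ⟨P, Subset.rfl, by omega, by omega⟩
    · obtain ⟨P1, h1, h2, h3⟩ := step P (by omega)
      obtain ⟨P', h4, h5⟩ := ih P1.crossingNumber (by omega) P1 rfl (by omega)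
      exact ⟨P', h4.trans h1, h5⟩
end KP

namespace KP

theorem image_closed (P : KnotProjection) : IsClosed P.image :=
  (isCompact_range P.f.continuous).isClosed

theorem region_open (P : KnotProjection) {R : Set Sphere2} (h : P.IsRegion R) : IsOpen R := by
  haveI := sphere_lc
  obtain ⟨x, -, rfl⟩ := h
  exact (image_closed P).isOpen_compl.connectedComponentIn

theorem region_disj (P : KnotProjection) {R : Set Sphere2} (h : P.IsRegion R) {y : Sphere2}
    (hy : y ∈ R) : y ∉ P.image := by
  obtain ⟨x, -, rfl⟩ := h
  exact connectedComponentIn_subset _ _ hy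

theorem region_eq (P : KnotProjection) {R : Set Sphere2} (h : P.IsRegion R) {y : Sphere2}
    (hy : y ∈ R) : R = connectedComponentIn P.imageᶜ y := by
  obtain ⟨x, -, rfl⟩ := h
  exact connectedComponentIn_eq hy

theorem region_nonempty (P : KnotProjection) {R : Set Sphere2} (h : P.IsRegion R) : R.Nonempty := by
  obtain ⟨x, hx, rfl⟩ := h
  exact ⟨x, mem_connectedComponentIn hx⟩

theorem region_frontier (P : KnotProjection) {R : Set Sphere2} (h : P.IsRegion R) :
    frontier R ⊆ P.image := by
  haveI := sphere_lc
  obtain ⟨x, hx, rfl⟩ := h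
  exact frontier_cc_subset (image_closed P) x

theorem region_preconn (P : KnotProjection) {R : Set Sphere2} (h : P.IsRegion R) :
    IsPreconnected R := by
  obtain ⟨x, hx, rfl⟩ := h
  exact isPreconnected_connectedComponentIn

/-- every point of the projection has a crossing on the boundary of all regions around it -/
theorem key (P : KnotProjection) {p : Sphere2} (hp : p ∈ P.image) :
    ∃ c ∈ P.crossings, ∀ R, P.IsRegion R → p ∈ frontier R → c ∈ frontier R := by
  classical
  by_cases hpc : p ∈ P.crossings
  · exact ⟨p, hpc, fun R _ h => h⟩
  obtain ⟨k, γ, hk, hcont, hs, ht, h_int, hinj, himg, -, -⟩ := extract_knot P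
  have hmem : ∀ x, x ∈ (crossings_fin P).toFinset ↔ x ∈ P.crossings :=
    fun x => Finite.mem_toFinset (crossings_fin P)
  have hp' := hp
  rw [← himg] at hp'
  obtain ⟨i, u, hu, rfl⟩ := mem_iUnion.1 hp'
  have hu0 : u ≠ 0 := by rintro rfl; exact hpc ((hmem _).1 (hs i))
  have hu1 : u ≠ 1 := by rintro rfl; exact hpc ((hmem _).1 (ht i))
  have hu' : u ∈ Ioo (0:ℝ) 1 := ⟨lt_of_le_of_ne hu.1 hu0.symm, lt_of_le_of_ne hu.2 hu1⟩
  refine ⟨γ i 0, (hmem _).1 (hs i), fun R hR hfr => ?_⟩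
  have hVimg : ∀ v ∈ P.crossings, v ∈ P.image := by
    intro v hv
    have h2 : Nat.card (P.f ⁻¹' {v} : Set Param) = 2 := hv
    by_contra hcon
    have : (P.f ⁻¹' {v} : Set Param) = ∅ := by
      ext x; simp only [mem_preimage, mem_singleton_iff, mem_empty_iff_false, iff_false]
      intro h; exact hcon ⟨x, h⟩
    rw [this] at h2; simp at h2
  have hγimg : ∀ j, ∀ w ∈ Icc (0:ℝ) 1, γ j w ∈ P.image := by
    intro j w hw; rw [← himg]; exact mem_iUnion.2 ⟨j, w, hw, rfl⟩
  set Y : Set Sphere2 := P.crossings ∪ ⋃ j ∈ {j : Fin k | j ≠ i}, γ j '' Icc 0 1 with hY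
  have hYc : IsClosed Y := by
    refine (crossings_fin P).isClosed.union ?_
    refine Set.Finite.isClosed_biUnion (toFinite _) fun j _ => ?_
    exact (isCompact_Icc.image (hcont j)).isClosed
  have hYimg : Y ⊆ P.image := by
    rintro y (hy | hy)
    · exact hVimg y hy
    · obtain ⟨j, -, w, hw, rfl⟩ := mem_iUnion₂.1 hy
      exact hγimg j w hw
  refine F1 hYc (hcont i) (Or.inl ((hmem _).1 (hs i))) (Or.inl ((hmem _).1 (ht i))) ?_ ?_
    (region_open P hR) (region_preconn P hR) ?_ ?_ ?_ hu' hfr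
  · rintro w hw (h | h)
    · exact h_int i w hw ((hmem _).2 h)
    · obtain ⟨j, hj, w', hw', he⟩ := mem_iUnion₂.1 h
      have h0 : w' ≠ 0 := by
        rintro rfl; exact h_int i w hw (he ▸ hs j)
      have h1 : w' ≠ 1 := by
        rintro rfl; exact h_int i w hw (he ▸ ht j)
      exact hj (hinj j i w' ⟨lt_of_le_of_ne hw'.1 h0.symm, lt_of_le_of_ne hw'.2 h1⟩ w hw he).1
  · intro a ha b hb hab
    exact (hinj i i a ha b hb hab).2
  · rw [Set.disjoint_left]
    intro y hy hy'
    exact region_disj P hR hy (hYimg hy')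
  · intro w hw h
    exact region_disj P hR h (hγimg i w hw)
  · intro y hy
    have := region_frontier P hR hy
    rw [← himg] at this
    obtain ⟨j, hj⟩ := mem_iUnion.1 this
    by_cases hji : j = i
    · subst hji; exact Or.inr hj
    · exact Or.inl (Or.inr (mem_iUnion₂.2 ⟨j, hji, hj⟩))

theorem sphere_preconn : PreconnectedSpace Sphere2 := by
  refine Subtype.preconnectedSpace (IsConnected.isPreconnected ?_)
  refine isConnected_sphere ?_ _ zero_le_one
  rw [← Module.finrank_eq_rank]
  simp

/-- every region has a crossing on its boundary -/
theorem region_crossing (P : KnotProjection) {R : Set Sphere2} (h : P.IsRegion R) :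
    ∃ c ∈ P.crossings, c ∈ frontier R := by
  haveI := sphere_preconn
  have hne : (frontier R).Nonempty := by
    rw [nonempty_iff_ne_empty]
    intro he
    have hcl : IsClopen R := isClopen_iff_frontier_eq_empty.2 he
    rcases isClopen_iff.1 hcl with h1 | h1
    · exact (region_nonempty P h).ne_empty h1
    · exact region_disj P h (h1 ▸ mem_univ (P.f 0)) ⟨0, rfl⟩
  obtain ⟨p, hp⟩ := hne
  obtain ⟨c, hc, hc'⟩ := key P (region_frontier P h hp)
  exact ⟨c, hc, hc' R h hp⟩

theorem card_indep_le (P : KnotProjection) {S : Finset (Set Sphere2)} (h : P.IndepRegions S) :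
    S.card ≤ P.crossingNumber := by
  classical
  have hch : ∀ R : Set Sphere2, ∃ c, R ∈ S → c ∈ P.crossings ∧ c ∈ frontier R := by
    intro R
    by_cases hR : R ∈ S
    · obtain ⟨c, h1, h2⟩ := region_crossing P (h.1 R hR)
      exact ⟨c, fun _ => ⟨h1, h2⟩⟩
    · exact ⟨P.f 0, fun h => absurd h hR⟩
  choose g hg using hch
  rw [KnotProjection.crossingNumber, Nat.card_eq_card_finite_toFinset (crossings_fin P)]
  refine Finset.card_le_card_of_injOn g ?_ ?_
  · intro R hR
    exact (Finite.mem_toFinset (crossings_fin P)).2 (hg R hR).1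
  · intro R hR R' hR' he
    by_contra hne
    exact h.2 hR hR' hne (g R) (hg R hR).1 ⟨(hg R hR).2, he ▸ (hg R' hR').2⟩

theorem card_le_IR (P : KnotProjection) {S : Finset (Set Sphere2)} {c : Sphere2}
    (hc : c ∈ P.crossings) (h : P.IndepRegionsFor c S) : S.card ≤ P.IR := by
  have hub : ∀ c, P.crossingNumber ∈ upperBounds
      {m : ℕ | ∃ S : Finset (Set Sphere2), P.IndepRegionsFor c S ∧ m = S.card} := by
    rintro c _ ⟨S, hS, rfl⟩
    exact card_indep_le P hS.1
  have h1 : S.card ≤ P.IRat c := le_csSup ⟨_, hub c⟩ ⟨S, h, rfl⟩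
  refine h1.trans (le_csSup ⟨P.crossingNumber, ?_⟩ ⟨c, hc, rfl⟩)
  rintro _ ⟨c', -, rfl⟩
  refine csSup_le ⟨0, ∅, ⟨⟨by simp, by simp⟩, by simp⟩, by simp⟩ (hub c')

theorem fiber_card (P : KnotProjection) (p : Sphere2) :
    Nat.card ((fun x : Fin 1 × Param => P.f x.2) ⁻¹' {p} : Set (Fin 1 × Param)) =
      Nat.card (P.f ⁻¹' {p} : Set Param) := by
  refine Nat.card_congr ⟨fun x => ⟨x.1.2, x.2⟩, fun x => ⟨(0, x.1), x.2⟩, ?_, ?_⟩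
  · rintro ⟨⟨i, x⟩, hx⟩
    simp [Subsingleton.elim i 0]
  · rintro ⟨x, hx⟩; rfl

/-- a knot projection as a link projection -/
def toLink (P : KnotProjection) : LinkProjection where
  comps := 1
  comps_pos := one_pos
  f := ⟨fun x => P.f x.2, by fun_prop⟩
  fibers_finite p := by
    refine ((P.fibers_finite p).preimage (f := Prod.snd) ?_)
    rintro ⟨i, x⟩ - ⟨j, y⟩ - h
    exact Prod.ext (Subsingleton.elim _ _) h
  fibers_le_two p := by
    have := fiber_card P p
    exact this.le.trans (P.fibers_le_two p)
  crossings_finite := by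
    refine P.crossings_finite.subset ?_
    intro p hp
    exact (fiber_card P p).symm.trans hp

theorem toLink_image (P : KnotProjection) : (toLink P).image = P.image := by
  ext y
  constructor
  · rintro ⟨x, hx⟩; exact ⟨x.2, hx⟩
  · rintro ⟨x, hx⟩; exact ⟨(⟨0, one_pos⟩, x), hx⟩

theorem toLink_crossings (P : KnotProjection) : (toLink P).crossings = P.crossings := by
  ext p
  have h := fiber_card P p
  constructor
  · intro hp; exact h.symm.trans hp
  · intro hp; exact h.trans hp

theorem toLink_connected (P : KnotProjection) : (toLink P).Connected := by
  unfold LinkProjection.Connected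
  rw [toLink_image]
  exact isConnected_range P.f.continuous

theorem main_bound (n m : ℕ) (hn : 0 < n)
    (h : ∀ L : LinkProjection, L.Connected →
      (L.crossingNumber = n ∨ L.crossingNumber = n + 1 ∨ L.crossingNumber = n + 2) →
      L.HasIndepRegions m) (P : KnotProjection) (hP : n ≤ P.crossingNumber) : m - 1 ≤ P.IR := by
  classical
  obtain ⟨P', himg, hn1, hn2⟩ := reduce n hn _ P rfl hP
  have hcn : (toLink P').crossingNumber = P'.crossingNumber := by
    rw [LinkProjection.crossingNumber, toLink_crossings]; rfl
  obtain ⟨S, ⟨hS1, hS2⟩, hm⟩ := h (toLink P') (toLink_connected P') (by omega)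
  have hreg : ∀ R ∈ S, P'.IsRegion R := by
    intro R hR
    obtain ⟨x, hx, he⟩ := hS1 R hR
    rw [toLink_image] at hx he
    exact ⟨x, hx, he⟩
  have hch : ∀ R : Set Sphere2, ∃ x, R ∈ S → x ∈ R ∧ x ∉ P.image := by
    intro R
    by_cases hR : R ∈ S
    · obtain ⟨x, hx, hx'⟩ := curve_interior P.f (crossings_fin P)
        (fun v hv => fiber_subsingleton P hv) (region_open P' (hreg R hR))
        (region_nonempty P' (hreg R hR))
      exact ⟨x, fun _ => ⟨hx, hx'⟩⟩
    · exact ⟨P.f 0, fun h => absurd h hR⟩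
  choose g hg using hch
  set Φ : Set Sphere2 → Set Sphere2 := fun R => connectedComponentIn P.imageᶜ (g R) with hΦ
  have hΦreg : ∀ R ∈ S, P.IsRegion (Φ R) := fun R hR => ⟨g R, (hg R hR).2, rfl⟩
  have hΦsub : ∀ R ∈ S, Φ R ⊆ R := by
    intro R hR
    rw [region_eq P' (hreg R hR) (hg R hR).1]
    have : Φ (connectedComponentIn P'.imageᶜ (g R)) = Φ R := by
      rw [← region_eq P' (hreg R hR) (hg R hR).1]
    rw [this]
    exact connectedComponentIn_mono _ (compl_subset_compl.2 himg)
  have hdis : ∀ R ∈ S, ∀ R' ∈ S, ∀ x, x ∈ R → x ∈ R' → R = R' := by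
    intro R hR R' hR' x hx hx'
    rw [region_eq P' (hreg R hR) hx, region_eq P' (hreg R' hR') hx']
  have hnofr : ∀ R ∈ S, ∀ R' ∈ S, R ≠ R' → ∀ p, p ∈ frontier (Φ R) → p ∉ frontier (Φ R') := by
    intro R hR R' hR' hne p hp hp'
    have hcl : ∀ Q ∈ S, p ∈ frontier (Φ Q) → p ∈ closure Q := fun Q hQ hq =>
      closure_mono (hΦsub Q hQ) hq.1
    by_cases hpi : p ∈ P'.image
    · obtain ⟨c, hc, hc'⟩ := key P' hpi
      have hf : ∀ Q ∈ S, p ∈ frontier (Φ Q) → p ∈ frontier Q := by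
        intro Q hQ hq
        rw [(region_open P' (hreg Q hQ)).frontier_eq]
        exact ⟨hcl Q hQ hq, fun h => region_disj P' (hreg Q hQ) h hpi⟩
      exact hS2 hR hR' hne c (by rw [toLink_crossings]; exact hc)
        ⟨hc' R (hreg R hR) (hf R hR hp), hc' R' (hreg R' hR') (hf R' hR' hp')⟩
    · have hf : ∀ Q ∈ S, p ∈ frontier (Φ Q) → p ∈ Q := by
        intro Q hQ hq
        by_contra hpQ
        apply hpi
        refine region_frontier P' (hreg Q hQ) ?_
        rw [(region_open P' (hreg Q hQ)).frontier_eq]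
        exact ⟨hcl Q hQ hq, hpQ⟩
      exact hne (hdis R hR R' hR' p (hf R hR hp) (hf R' hR' hp'))
  obtain ⟨c, hc⟩ := P.exists_crossing
  set S1 := S.filter (fun R => c ∉ frontier (Φ R)) with hS1d
  have hS1S : ∀ R ∈ S1, R ∈ S := fun R hR => (Finset.mem_filter.1 hR).1
  have hinj : Set.InjOn Φ S1 := by
    intro R hR R' hR' he
    have h1 := hS1S R hR
    have h2 := hS1S R' hR'
    obtain ⟨x, hx⟩ := region_nonempty P (hΦreg R h1)
    exact hdis R h1 R' h2 x (hΦsub R h1 hx) (hΦsub R' h2 (he ▸ hx))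
  have hcard : m - 1 ≤ S1.card := by
    have h1 : S1.card + (S.filter (fun R => ¬ (c ∉ frontier (Φ R)))).card = S.card := by
      rw [hS1d]
      convert Finset.card_filter_add_card_filter_not (s := S) (fun R => c ∉ frontier (Φ R))
    have h2 : (S.filter (fun R => ¬ (c ∉ frontier (Φ R)))).card ≤ 1 := by
      rw [Finset.card_le_one]
      intro R hR R' hR'
      rw [Finset.mem_filter, not_not] at hR hR'
      by_contra hne
      exact hnofr R hR.1 R' hR'.1 hne c hR.2 hR'.2
    omega
  have hT : P.IndepRegionsFor c (S1.image Φ) := by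
    refine ⟨⟨?_, ?_⟩, ?_⟩
    · intro R hR
      obtain ⟨Q, hQ, rfl⟩ := Finset.mem_image.1 hR
      exact hΦreg Q (hS1S Q hQ)
    · intro R hR R' hR' hne p hp hpp
      obtain ⟨Q, hQ, rfl⟩ := Finset.mem_image.1 hR
      obtain ⟨Q', hQ', rfl⟩ := Finset.mem_image.1 hR'
      exact hnofr Q (hS1S Q hQ) Q' (hS1S Q' hQ') (fun h => hne (h ▸ rfl)) p hpp.1 hpp.2
    · intro R hR
      obtain ⟨Q, hQ, rfl⟩ := Finset.mem_image.1 hR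
      exact (Finset.mem_filter.1 hQ).2
  calc m - 1 ≤ S1.card := hcard
    _ = (S1.image Φ).card := (Finset.card_image_of_injOn hinj).symm
    _ ≤ P.IR := card_le_IR P hc hT

end KP

/-- **Corollary.**
Let `n, m` be positive integers.  If all the connected link projections with
`n`, `n+1` or `n+2` crossings have `m` or more pairwise independent regions,
then `IR(P) ≥ m - 1` holds for every reduced knot projection `P` with `n` or
more crossings. -/
theorem IR_ge_of_link_indep_regions
    (n m : ℕ) (hn : 0 < n) (hm : 0 < m)
    (h : ∀ L : LinkProjection, L.Connected →
      (L.crossingNumber = n ∨ L.crossingNumber = n + 1 ∨ L.crossingNumber = n + 2) →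
      L.HasIndepRegions m) :
    ∀ P : KnotProjection, P.Reduced → n ≤ P.crossingNumber → m - 1 ≤ P.IR := by
  intro P _ hP
  exact KP.main_bound n m hn h P hP
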